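/- For every d ≥ 1 and every α > 0 there is a constant C(α,d) > 0 with the following property. Let A ⊆ ℙ^d satisfy limsup_{N→∞} |A ∩ [1,N]^d| / |ℙ ∩ [1,N]|^d ≥ α. Then for infinitely many N ∈ ℕ, the number of pairs (x,t) ∈ ℤ^d × ℤ with t ≠ 0 such that x ∈ A ∩ [1,N]^d and x + t·e_i ∈ A ∩ [1,N]^d for every 1 ≤ i ≤ d is at least C(α,d) · N^{d+1} / (log N)^{2d}. -/

import Mathlib

/-- The number of primes in `[1,N]`. -/
def primeCount (N : ℕ) : ℕ := ((Finset.Icc 1 N).filter Nat.Prime).card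

/-- The relative upper density of a set `A` of `d`-tuples of primes. -/
noncomputable def relUpperDensity (d : ℕ) (A : Set (Fin d → ℤ)) : ℝ :=
  Filter.limsup (fun N : ℕ =>
    ((A ∩ {x | ∀ i, 1 ≤ x i ∧ x i ≤ (N : ℤ)}).ncard : ℝ) / (primeCount N : ℝ) ^ d)
    Filter.atTop

/-- The set of nondegenerate corners of `A` inside `[1,N]^d`: pairs `(x,t)` with `t ≠ 0`,
`x ∈ A ∩ [1,N]^d` and `x + t eᵢ ∈ A ∩ [1,N]^d` for every `i`. -/
def cornerPairs (d : ℕ) (A : Set (Fin d → ℤ)) (N : ℕ) : Set ((Fin d → ℤ) × ℤ) :=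
  {p | p.2 ≠ 0 ∧
    (p.1 ∈ A ∧ ∀ i, 1 ≤ p.1 i ∧ p.1 i ≤ (N : ℤ)) ∧
    ∀ i, ((fun j => p.1 j + if j = i then p.2 else 0) ∈ A ∧
      ∀ i', 1 ≤ p.1 i' + (if i' = i then p.2 else 0) ∧
        p.1 i' + (if i' = i then p.2 else 0) ≤ (N : ℤ))}

set_option linter.unusedSectionVars false
set_option linter.unusedVariables false

namespace CornersInPrimes

open Filter Topology

section Expectation

variable {ι : Type} [Fintype ι] [DecidableEq ι] {V : Type} [Fintype V]

/-- The expectation of `F` when the coordinates are independent with weights `μ i`. -/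
def wE (μ : ι → V → ℝ) (F : (ι → V) → ℝ) : ℝ := ∑ x, (∏ i, μ i (x i)) * F x

/-- Each `μ i` is a probability weight. -/
structure IsWeight (μ : ι → V → ℝ) : Prop where
  nonneg : ∀ i v, 0 ≤ μ i v
  sum_one : ∀ i, ∑ v, μ i v = 1

variable {μ : ι → V → ℝ}

lemma IsWeight.prod_nonneg (hμ : IsWeight μ) (x : ι → V) : 0 ≤ ∏ i, μ i (x i) :=
  Finset.prod_nonneg fun i _ => hμ.nonneg i _

lemma wE_const (hμ : IsWeight μ) (c : ℝ) : wE μ (fun _ => c) = c := by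
  have : ∑ x : ι → V, ∏ i, μ i (x i) = 1 := by
    rw [← Fintype.piFinset_univ, ← Finset.prod_univ_sum]
    simp [hμ.sum_one]
  unfold wE
  rw [← Finset.sum_mul, this, one_mul]

lemma wE_add (F G : (ι → V) → ℝ) : wE μ (fun x => F x + G x) = wE μ F + wE μ G := by
  simp [wE, mul_add, Finset.sum_add_distrib]

lemma wE_sub (F G : (ι → V) → ℝ) : wE μ (fun x => F x - G x) = wE μ F - wE μ G := by
  simp [wE, mul_sub, Finset.sum_sub_distrib]

lemma wE_neg (F : (ι → V) → ℝ) : wE μ (fun x => -F x) = -wE μ F := by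
  simp [wE]

lemma wE_const_mul (c : ℝ) (F : (ι → V) → ℝ) : wE μ (fun x => c * F x) = c * wE μ F := by
  simp only [wE, Finset.mul_sum]
  exact Finset.sum_congr rfl fun x _ => by ring

lemma wE_mul_const (c : ℝ) (F : (ι → V) → ℝ) : wE μ (fun x => F x * c) = wE μ F * c := by
  simp only [mul_comm _ c, wE_const_mul]

lemma wE_sum {β : Type*} (s : Finset β) (F : β → (ι → V) → ℝ) :
    wE μ (fun x => ∑ b ∈ s, F b x) = ∑ b ∈ s, wE μ (F b) := by
  simp only [wE, Finset.mul_sum]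
  exact Finset.sum_comm

lemma wE_mono (hμ : IsWeight μ) {F G : (ι → V) → ℝ} (h : ∀ x, F x ≤ G x) : wE μ F ≤ wE μ G :=
  Finset.sum_le_sum fun x _ => mul_le_mul_of_nonneg_left (h x) (hμ.prod_nonneg x)

lemma wE_nonneg (hμ : IsWeight μ) {F : (ι → V) → ℝ} (h : ∀ x, 0 ≤ F x) : 0 ≤ wE μ F :=
  Finset.sum_nonneg fun x _ => mul_nonneg (hμ.prod_nonneg x) (h x)

lemma abs_wE_le (hμ : IsWeight μ) (F : (ι → V) → ℝ) : |wE μ F| ≤ wE μ (fun x => |F x|) := by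
  rw [abs_le, ← wE_neg]
  exact ⟨wE_mono hμ fun x => neg_abs_le _, wE_mono hμ fun x => le_abs_self _⟩

lemma wE_le_const (hμ : IsWeight μ) {F : (ι → V) → ℝ} {c : ℝ} (h : ∀ x, F x ≤ c) : wE μ F ≤ c :=
  (wE_mono hμ h).trans_eq (wE_const hμ c)

lemma exists_wE_le (hμ : IsWeight μ) (F : (ι → V) → ℝ) : ∃ x, wE μ F ≤ F x := by
  by_contra! h
  have h1 : ∀ x, 0 ≤ (∏ i, μ i (x i)) * (wE μ F - F x) := fun x =>
    mul_nonneg (hμ.prod_nonneg x) (sub_nonneg.2 (h x).le)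
  have h2 : ∑ x, (∏ i, μ i (x i)) * (wE μ F - F x) = 0 := by
    have : wE μ (fun x => wE μ F - F x) = 0 := by rw [wE_sub, wE_const hμ, sub_self]
    exact this
  have h3 := (Finset.sum_eq_zero_iff_of_nonneg fun x _ => h1 x).1 h2
  have h4 : ∀ x : ι → V, ∏ i, μ i (x i) = 0 := fun x =>
    (mul_eq_zero.1 (h3 x (Finset.mem_univ x))).resolve_right (sub_pos.2 (h x)).ne'
  have h5 := wE_const hμ 1
  simp [wE, h4] at h5

lemma wE_comm (F : (ι → V) → (ι → V) → ℝ) :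
    wE μ (fun x => wE μ fun y => F x y) = wE μ (fun y => wE μ fun x => F x y) := by
  simp only [wE, Finset.mul_sum]
  rw [Finset.sum_comm]
  exact Finset.sum_congr rfl fun x _ => Finset.sum_congr rfl fun y _ => by ring

lemma wE_cauchy (hμ : IsWeight μ) {a b c : (ι → V) → ℝ} (h : ∀ x, |a x| ≤ c x) :
    wE μ (fun x => a x * b x) ^ 2 ≤ wE μ c * wE μ (fun x => c x * b x ^ 2) := by
  have hc : ∀ x, 0 ≤ c x := fun x => (abs_nonneg _).trans (h x)
  have h1 : |wE μ (fun x => a x * b x)| ≤ wE μ (fun x => c x * |b x|) :=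
    (abs_wE_le hμ _).trans (wE_mono hμ fun x => by
      rw [abs_mul]; exact mul_le_mul_of_nonneg_right (h x) (abs_nonneg _))
  calc wE μ (fun x => a x * b x) ^ 2 ≤ wE μ (fun x => c x * |b x|) ^ 2 := by
        rw [← sq_abs]; exact pow_le_pow_left₀ (abs_nonneg _) h1 2
    _ ≤ _ := Finset.sum_sq_le_sum_mul_sum_of_sq_le_mul _
        (fun x _ => mul_nonneg (hμ.prod_nonneg x) (hc x))
        (fun x _ => mul_nonneg (hμ.prod_nonneg x) (mul_nonneg (hc x) (sq_nonneg _)))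
        (fun x _ => by rw [← sq_abs (b x)]; exact le_of_eq (by ring))

lemma wE_cauchy₂ (hμ : IsWeight μ) {a b c : (ι → V) → (ι → V) → ℝ} (h : ∀ x y, |a x y| ≤ c x y) :
    wE μ (fun x => wE μ fun y => a x y * b x y) ^ 2 ≤
      wE μ (fun x => wE μ fun y => c x y) *
        wE μ (fun x => wE μ fun y => c x y * b x y ^ 2) := by
  have hc : ∀ x y, 0 ≤ c x y := fun x y => (abs_nonneg _).trans (h x y)
  calc wE μ (fun x => wE μ fun y => a x y * b x y) ^ 2
      ≤ wE μ (fun x => 1 * |wE μ fun y => a x y * b x y|) ^ 2 := by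
        rw [← sq_abs]
        refine pow_le_pow_left₀ (abs_nonneg _) ?_ 2
        simpa using abs_wE_le hμ _
    _ ≤ _ := Finset.sum_sq_le_sum_mul_sum_of_sq_le_mul _
        (fun x _ => mul_nonneg (hμ.prod_nonneg x) (wE_nonneg hμ (hc x)))
        (fun x _ => mul_nonneg (hμ.prod_nonneg x)
          (wE_nonneg hμ fun y => mul_nonneg (hc x y) (sq_nonneg _)))
        (fun x _ => by
          have := wE_cauchy hμ (a := a x) (b := b x) (c := c x) (h x)
          simp only [one_mul, mul_pow, sq_abs]
          calc _ ≤ (∏ i, μ i (x i)) ^ 2 * _ := mul_le_mul_of_nonneg_left this (sq_nonneg _)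
            _ = _ := by ring)

lemma wE_swap (A : Finset ι) (F : (ι → V) → (ι → V) → ℝ) :
    wE μ (fun x => wE μ fun y => F (A.piecewise x y) (A.piecewise y x)) =
      wE μ (fun x => wE μ fun y => F x y) := by
  simp only [wE, Finset.mul_sum]
  rw [← Finset.sum_product', ← Finset.sum_product']
  let e : (ι → V) × (ι → V) → (ι → V) × (ι → V) := fun p =>
    (A.piecewise p.1 p.2, A.piecewise p.2 p.1)
  have he : Function.Involutive e := by
    rintro ⟨x, y⟩
    simp only [e, Prod.mk.injEq]
    constructor <;> ext i <;> by_cases hi : i ∈ A <;> simp [hi]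
  refine Fintype.sum_equiv he.toPerm _ _ ?_
  rintro ⟨x, y⟩
  simp only [Function.Involutive.coe_toPerm, e]
  rw [← mul_assoc, ← mul_assoc]
  congr 1
  rw [← Finset.prod_mul_distrib, ← Finset.prod_mul_distrib]
  refine Finset.prod_congr rfl fun i _ => ?_
  by_cases hi : i ∈ A <;> simp [hi, mul_comm]

lemma wE_piecewise (hμ : IsWeight μ) (A : Finset ι) (G : (ι → V) → ℝ) :
    wE μ (fun x => wE μ fun y => G (A.piecewise y x)) = wE μ G := by
  have := wE_swap (μ := μ) A (fun _ y => G y)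
  rw [this, wE_const hμ]

lemma wE_diag (hμ : IsWeight μ) (j : ι) (H : (ι → V) → (ι → V) → ℝ)
    (h₁ : ∀ y z t, H (({j} : Finset ι).piecewise t y) z = H y z)
    (h₂ : ∀ y z t, H y (({j} : Finset ι).piecewise z t) = H y z) :
    wE μ (fun y => H y y) = wE μ (fun y => wE μ fun z => H y z) := by
  rw [← wE_piecewise hμ {j} (fun y => H y y)]
  simp only [h₁, h₂]

lemma wE_cauchy_coordinate (hμ : IsWeight μ) (j : ι) {a b c : (ι → V) → (ι → V) → ℝ}
    (h : ∀ x y, |a x y| ≤ c x y)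
    (ha : ∀ x y z, a (({j} : Finset ι).piecewise z x) y = a x y)
    (hc₀ : ∀ x y z, c (({j} : Finset ι).piecewise z x) y = c x y)
    (hc₁ : ∀ x y z, c x (({j} : Finset ι).piecewise z y) = c x y)
    (hb₁ : ∀ x y z, b x (({j} : Finset ι).piecewise z y) = b x y) :
    wE μ (fun x => wE μ fun y => a x y * b x y) ^ 2 ≤
      wE μ (fun x => wE μ fun y => c x y) *
        wE μ (fun x => wE μ fun y => c x y * (b x y * b (({j} : Finset ι).piecewise y x) y)) := by
  set B : (ι → V) → (ι → V) → ℝ := fun x y =>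
    wE μ fun z => b (({j} : Finset ι).piecewise z x) y with hB
  have hpp : ∀ x y z : ι → V, ({j} : Finset ι).piecewise z (({j} : Finset ι).piecewise y x) =
      ({j} : Finset ι).piecewise z x := fun x y z => by
    ext i; by_cases hi : i ∈ ({j} : Finset ι) <;> simp [Finset.piecewise, hi]
  have hpp' : ∀ x y z : ι → V, ({j} : Finset ι).piecewise (({j} : Finset ι).piecewise z x) y =
      ({j} : Finset ι).piecewise z y := fun x y z => by
    ext i; by_cases hi : i ∈ ({j} : Finset ι) <;> simp [Finset.piecewise, hi]
  have hBx : ∀ x y z, B (({j} : Finset ι).piecewise z x) y = B x y := fun x y z => by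
    simp only [hB, hpp]
  -- averaging over the coordinate `j` of the first variable
  have key : ∀ d : (ι → V) → (ι → V) → ℝ,
      (∀ x y z, d (({j} : Finset ι).piecewise z x) y = d x y) →
      wE μ (fun x => wE μ fun y => d x y * b x y) =
        wE μ (fun x => wE μ fun y => d x y * B x y) := by
    intro d hd
    rw [wE_comm, wE_comm (fun x y => d x y * B x y)]
    congr 1; funext y
    rw [← wE_piecewise hμ {j} (fun x => d x y * b x y)]
    simp only [hd, wE_const_mul, hB]
  have h1 := wE_cauchy₂ hμ (a := a) (b := B) (c := c) h
  rw [key a ha]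
  refine h1.trans_eq ?_
  congr 1
  have h2 : wE μ (fun x => wE μ fun y => c x y * B x y ^ 2) =
      wE μ (fun x => wE μ fun y => (c x y * B x y) * b x y) := by
    rw [key (fun x y => c x y * B x y) (fun x y z => by rw [hc₀, hBx])]
    simp only [sq, mul_assoc]
  rw [h2]
  congr 1; funext x
  have h3 := wE_diag hμ j (fun y z => c x y * (b x y * b (({j} : Finset ι).piecewise z x) y))
    (fun y z t => by simp only [hc₁, hb₁])
    (fun y z t => by
      have : ({j} : Finset ι).piecewise (({j} : Finset ι).piecewise z t) x =
        ({j} : Finset ι).piecewise z x := hpp' _ _ _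
      simp only [this])
  rw [h3]
  congr 1; funext y
  simp only [hB, wE_const_mul]
  ring

end Expectation

section Counting

variable {ι : Type} [Fintype ι] [DecidableEq ι] {V : ℕ → Type} [∀ m, Fintype (V m)]
  {μ : ∀ m, ι → V m → ℝ} {ν : ∀ m, ι → (ι → V m) → ℝ} {l : Filter ℕ}

/-- The linear forms condition along the filter `l`. -/
def LinearForms (l : Filter ℕ) (μ : ∀ m, ι → V m → ℝ) (ν : ∀ m, ι → (ι → V m) → ℝ) : Prop :=
  ∀ 𝒜 : ι → Finset (Finset ι), (∀ i, ∀ A ∈ 𝒜 i, i ∉ A) →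
    Tendsto (fun m => wE (μ m) fun x => wE (μ m) fun y =>
      ∏ i, ∏ A ∈ 𝒜 i, ν m i (A.piecewise y x)) l (𝓝 1)

lemma LinearForms.prod_add_const (h : LinearForms l μ ν) (c : ι → ℝ)
    (𝒜 : ι → Finset (Finset ι)) (h𝒜 : ∀ i, ∀ A ∈ 𝒜 i, i ∉ A) :
    Tendsto (fun m => wE (μ m) fun x => wE (μ m) fun y =>
      ∏ i, ∏ A ∈ 𝒜 i, (ν m i (A.piecewise y x) + c i)) l (𝓝 (∏ i, ∏ _A ∈ 𝒜 i, (1 + c i))) := by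
  have expand : ∀ g : ι → Finset ι → ℝ, ∏ i, ∏ A ∈ 𝒜 i, (g i A + c i) =
      ∑ p ∈ Fintype.piFinset (fun i => (𝒜 i).powerset),
        (∏ i, ∏ _A ∈ 𝒜 i \ p i, c i) * ∏ i, ∏ A ∈ p i, g i A := by
    intro g
    simp only [Finset.prod_add, Finset.prod_univ_sum]
    refine Finset.sum_congr rfl fun p _ => ?_
    rw [Finset.prod_mul_distrib, mul_comm]
  have h1 := expand fun _ _ => 1
  rw [h1]
  simp only [expand, wE_sum, wE_const_mul]
  refine tendsto_finsetSum _ fun p hp => ?_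
  rw [Finset.prod_eq_one (f := fun i => ∏ A ∈ p i, (1 : ℝ)) (fun i _ => by simp)]
  refine (h p fun i A hA => h𝒜 i A ?_).const_mul _
  exact Finset.mem_powerset.1 (Fintype.mem_piFinset.1 hp i) hA

lemma DependsOn.piecewise_eq {X : Type} {F : (ι → X) → ℝ} {j : ι} (h : DependsOn F {j}ᶜ)
    (x z : ι → X) : F (({j} : Finset ι).piecewise z x) = F x :=
  h fun i hi => by simp at hi; simp [hi]

lemma DependsOn.piecewise_congr {X : Type} {F : (ι → X) → ℝ} {j : ι} (h : DependsOn F {j}ᶜ)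
    (A : Finset ι) {x y x' y' : ι → X} (hx : ∀ i, i ≠ j → x i = x' i)
    (hy : ∀ i, i ≠ j → y i = y' i) : F (A.piecewise y x) = F (A.piecewise y' x') :=
  h fun i hi => by
    simp at hi
    by_cases hA : i ∈ A <;> simp [hA, hx i hi, hy i hi]

lemma tendsto_zero_of_sq_le {a b c : ℕ → ℝ} {C : ℝ} (h : ∀ m, a m ^ 2 ≤ b m * c m)
    (hb : Tendsto b l (𝓝 C)) (hc : Tendsto c l (𝓝 0)) : Tendsto a l (𝓝 0) := by
  have h1 : Tendsto (fun m => a m ^ 2) l (𝓝 0) :=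
    squeeze_zero (fun m => sq_nonneg _) h (by simpa using hb.mul hc)
  have h2 := h1.sqrt
  simp only [Real.sqrt_sq_eq_abs, Real.sqrt_zero] at h2
  exact (tendsto_zero_iff_abs_tendsto_zero _).2 h2

/-- The mixed product occurring in the iterated Cauchy–Schwarz argument. -/
def cubeProduct {X : Type} (c : ι → ℝ) (ν : ι → (ι → X) → ℝ) (S R : Finset ι)
    (F : ι → Finset ι → (ι → X) → ℝ) (x y : ι → X) : ℝ :=
  (∏ i ∈ S, ∏ A ∈ (S.erase i).powerset, (ν i (A.piecewise y x) + c i)) *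
    ∏ i ∈ R, ∏ A ∈ S.powerset, F i A (A.piecewise y x)

lemma insert_piecewise_eq {X : Type} (A : Finset ι) (j : ι) (x y : ι → X) :
    (insert j A).piecewise y x = A.piecewise y (({j} : Finset ι).piecewise y x) := by
  ext i
  by_cases h : i ∈ A <;> by_cases h' : i = j <;> simp [Finset.piecewise, h, h']

lemma piecewise_piecewise_of_notMem {X : Type} {A : Finset ι} {j : ι} (h : j ∉ A)
    (x y z : ι → X) : A.piecewise (({j} : Finset ι).piecewise z y) x = A.piecewise y x := by
  ext i
  by_cases hi : i ∈ A
  · have : i ≠ j := fun e => h (e ▸ hi)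
    simp [hi, this]
  · simp [hi]

lemma cubeProduct_insert {X : Type} (c : ι → ℝ) (ν : ι → (ι → X) → ℝ) (S R : Finset ι) (j : ι)
    (hj : j ∉ S) (hc : c j = 1) (F : ι → Finset ι → (ι → X) → ℝ) (x y : ι → X) :
    cubeProduct c ν (insert j S) R (fun i A => F i (A.erase j)) x y =
      (∏ A ∈ S.powerset, (ν j (A.piecewise y x) + 1)) *
        (cubeProduct c ν S R F x y *
          cubeProduct c ν S R F (({j} : Finset ι).piecewise y x) y) := by
  unfold cubeProduct
  rw [Finset.prod_insert hj, Finset.erase_insert hj, hc]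
  have h1 : ∀ i ∈ S, ∏ A ∈ ((insert j S).erase i).powerset, (ν i (A.piecewise y x) + c i) =
      (∏ A ∈ (S.erase i).powerset, (ν i (A.piecewise y x) + c i)) *
      ∏ A ∈ (S.erase i).powerset,
        (ν i (A.piecewise y (({j} : Finset ι).piecewise y x)) + c i) := by
    intro i hi
    have hij : j ≠ i := fun e => hj (e ▸ hi)
    rw [Finset.erase_insert_of_ne hij, Finset.prod_powerset_insert (by simp [hj])]
    simp only [insert_piecewise_eq]
  have h2 : ∀ i, ∏ A ∈ (insert j S).powerset, F i (A.erase j) (A.piecewise y x) =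
      (∏ A ∈ S.powerset, F i A (A.piecewise y x)) *
      ∏ A ∈ S.powerset, F i A (A.piecewise y (({j} : Finset ι).piecewise y x)) := by
    intro i
    rw [Finset.prod_powerset_insert hj]
    congr 1
    · refine Finset.prod_congr rfl fun A hA => ?_
      rw [Finset.erase_eq_of_notMem fun h => hj (Finset.mem_powerset.1 hA h)]
    · refine Finset.prod_congr rfl fun A hA => ?_
      rw [Finset.erase_insert fun h => hj (Finset.mem_powerset.1 hA h), insert_piecewise_eq]
  rw [Finset.prod_congr rfl h1, Finset.prod_mul_distrib,
    Finset.prod_congr rfl fun i _ => h2 i, Finset.prod_mul_distrib]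
  ring

/-- The weighted Gowers–Cauchy–Schwarz inequality, qualitatively. -/
lemma tendsto_cubeProduct (hμ : ∀ m, IsWeight (μ m)) (hν : LinearForms l μ ν)
    (hd : ∀ m i, DependsOn (ν m i) {i}ᶜ) (j₁ : ι) (R : Finset ι) (hR : j₁ ∉ R)
    (F : ∀ m, ι → Finset ι → (ι → V m) → ℝ) (hF : ∀ m i A, DependsOn (F m i A) {i}ᶜ)
    (hFν : ∀ m i A x, |F m i A x| ≤ ν m i x + 1) :
    Tendsto (fun m => wE (μ m) fun x => wE (μ m) fun y =>
      cubeProduct (fun i => if i = j₁ then -1 else 1) (ν m) Rᶜ R (F m) x y) l (𝓝 0) := by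
  set c : ι → ℝ := fun i => if i = j₁ then -1 else 1 with hc
  induction R using Finset.induction_on generalizing F with
  | empty =>
    have h := hν.prod_add_const c (fun i => (Finset.univ.erase i).powerset) (by
      intro i A hA hi
      simpa using Finset.mem_powerset.1 hA hi)
    rw [Finset.prod_eq_zero (Finset.mem_univ j₁) (Finset.prod_eq_zero
      (Finset.empty_mem_powerset _) (by simp [hc]))] at h
    simpa [cubeProduct] using h
  | insert j R hjR ih =>
    have hj₁ : j ≠ j₁ := fun e => hR (by simp [e])
    have hR' : j₁ ∉ R := fun h => hR (Finset.mem_insert_of_mem h)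
    set S : Finset ι := (insert j R)ᶜ with hS
    have hjS : j ∉ S := by simp [hS]
    have hS' : Rᶜ = insert j S := by
      ext i; by_cases h : i = j <;> simp [hS, h, hjR]
    have ih' := ih hR' (fun m i A => F m i (A.erase j)) (fun m i A => hF _ _ _)
      (fun m i A => hFν _ _ _)
    rw [hS'] at ih'
    simp only [cubeProduct_insert c _ S R j hjS (by simp [hc, hj₁])] at ih'
    have hC := hν.prod_add_const (fun _ => 1) (fun i => if i = j then S.powerset else ∅) (by
      intro i A hA hi
      split_ifs at hA with h
      · subst h; exact hjS (Finset.mem_powerset.1 hA hi)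
      · simp at hA)
    have hone : ∀ f : ι → Finset ι → ℝ,
        ∏ i, ∏ A ∈ (if i = j then S.powerset else ∅), f i A = ∏ A ∈ S.powerset, f j A := by
      intro f
      rw [Finset.prod_eq_single j (fun i _ hi => by simp [hi]) (fun h => (h (by simp)).elim)]
      simp
    simp only [hone] at hC
    refine tendsto_zero_of_sq_le (fun m => ?_) hC ih'
    have := wE_cauchy_coordinate (hμ m) j
      (a := fun x y => ∏ A ∈ S.powerset, F m j A (A.piecewise y x))
      (b := fun x y => cubeProduct c (ν m) S R (F m) x y)
      (c := fun x y => ∏ A ∈ S.powerset, (ν m j (A.piecewise y x) + 1))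
      (fun x y => by
        rw [Finset.abs_prod]
        exact Finset.prod_le_prod (fun A _ => abs_nonneg _) fun A _ => hFν _ _ _ _)
      (fun x y z => Finset.prod_congr rfl fun A _ =>
        DependsOn.piecewise_congr (hF m j A) A (fun i hi => by simp [hi]) (fun i hi => rfl))
      (fun x y z => Finset.prod_congr rfl fun A _ => congrArg (· + 1)
        (DependsOn.piecewise_congr (hd m j) A (fun i hi => by simp [hi]) (fun i hi => rfl)))
      (fun x y z => Finset.prod_congr rfl fun A _ => congrArg (· + 1)
        (DependsOn.piecewise_congr (hd m j) A (fun i hi => rfl) (fun i hi => by simp [hi])))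
      (fun x y z => by
        unfold cubeProduct
        congr 1
        · refine Finset.prod_congr rfl fun i _ => Finset.prod_congr rfl fun A hA => ?_
          rw [piecewise_piecewise_of_notMem fun h =>
            hjS (Finset.mem_of_mem_erase (Finset.mem_powerset.1 hA h))]
        · refine Finset.prod_congr rfl fun i _ => Finset.prod_congr rfl fun A hA => ?_
          rw [piecewise_piecewise_of_notMem fun h => hjS (Finset.mem_powerset.1 hA h)])
    refine le_trans (le_of_eq ?_) this
    congr 1
    congr 1; funext x; congr 1; funext y
    unfold cubeProduct
    rw [Finset.prod_insert hjR]
    ring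

/-- The weight `ν j₁ - 1` is orthogonal to products of pairs of functions that are dominated by
the other weights. -/
lemma tendsto_weight_sub_one_mul (hμ : ∀ m, IsWeight (μ m)) (hν : LinearForms l μ ν)
    (hd : ∀ m i, DependsOn (ν m i) {i}ᶜ) (j₁ : ι)
    (F F' : ∀ m, ι → (ι → V m) → ℝ) (hF : ∀ m i, DependsOn (F m i) {i}ᶜ)
    (hF' : ∀ m i, DependsOn (F' m i) {i}ᶜ)
    (hFν : ∀ m i x, |F m i x| ≤ ν m i x + 1) (hFν' : ∀ m i x, |F' m i x| ≤ ν m i x + 1) :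
    Tendsto (fun m => wE (μ m) fun x => wE (μ m) fun y => (ν m j₁ x - 1) *
      ((∏ i ∈ Finset.univ.erase j₁, F m i x) *
        ∏ i ∈ Finset.univ.erase j₁, F' m i (({j₁} : Finset ι).piecewise y x))) l (𝓝 0) := by
  have h := tendsto_cubeProduct hμ hν hd j₁ (Finset.univ.erase j₁) (by simp)
    (fun m i A => if A = ∅ then F m i else F' m i)
    (fun m i A => by split_ifs; exacts [hF m i, hF' m i])
    (fun m i A x => by split_ifs; exacts [hFν m i x, hFν' m i x])
  have hc : (Finset.univ.erase j₁)ᶜ = ({j₁} : Finset ι) := by ext i; simp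
  have hp : ({j₁} : Finset ι).powerset = {∅, {j₁}} := by
    ext A; simp [Finset.subset_singleton_iff]
  rw [hc] at h
  refine h.congr fun m => ?_
  congr 1; funext x; congr 1; funext y
  unfold cubeProduct
  have hne : (∅ : Finset ι) ≠ {j₁} := (Finset.singleton_ne_empty _).symm
  simp only [Finset.prod_singleton, Finset.erase_singleton, Finset.powerset_empty, hp,
    Finset.piecewise_empty, if_true, Finset.prod_pair hne, Finset.singleton_ne_empty, if_false,
    Finset.prod_mul_distrib]
  ring

end Counting

section RelativeCounting

variable {ι : Type} [Fintype ι] [DecidableEq ι]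

lemma wE_average {V : Type} [Fintype V] {μ : ι → V → ℝ} (hμ : IsWeight μ) (j : ι)
    {d : (ι → V) → ℝ} (hd : DependsOn d {j}ᶜ) (p : (ι → V) → ℝ) :
    wE μ (fun x => d x * p x) =
      wE μ (fun x => d x * wE μ fun z => p (({j} : Finset ι).piecewise z x)) := by
  rw [← wE_piecewise hμ {j} (fun x => d x * p x)]
  simp only [DependsOn.piecewise_eq hd, wE_const_mul]

lemma dependsOn_average {V : Type} [Fintype V] (μ : ι → V → ℝ) (j : ι) (p : (ι → V) → ℝ) :
    DependsOn (fun x => wE μ fun z => p (({j} : Finset ι).piecewise z x)) {j}ᶜ := by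
  intro x x' h
  have : ∀ z : ι → V, ({j} : Finset ι).piecewise z x = ({j} : Finset ι).piecewise z x' := by
    intro z; ext i
    by_cases hi : i = j
    · simp [hi]
    · simp [hi, h i (by simpa using hi)]
  simp only [this]

/-- Truncation of `t` to the interval `[-N, N]`. -/
noncomputable def clamp (N t : ℝ) : ℝ := max (-N) (min N t)

lemma abs_clamp_le {N : ℝ} (hN : 0 ≤ N) (t : ℝ) : |clamp N t| ≤ N := by
  rw [abs_le]
  exact ⟨le_max_left _ _, max_le (by linarith) (min_le_left _ _)⟩

lemma mul_sub_clamp_le {c t n : ℝ} (hc : 0 ≤ c) (h : |t| ≤ n) :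
    t * (t - clamp (c + 1) t) ≤ (1 + c) * (n - c) ^ 2 := by
  rw [abs_le] at h
  unfold clamp
  rcases le_total t (c + 1) with h1 | h1
  · rw [min_eq_right h1]
    rcases le_total (-(c + 1)) t with h2 | h2
    · rw [max_eq_right h2, sub_self, mul_zero]; positivity
    · rw [max_eq_left h2]
      have h3 : c + 1 ≤ -t := by linarith
      have h4 : -t ≤ n := by linarith
      calc t * (t - -(c + 1)) = (-t) * (-t - (c + 1)) := by ring
        _ ≤ n * (n - (c + 1)) := mul_le_mul h4 (by linarith) (by linarith) (by linarith)
        _ ≤ _ := by nlinarith [mul_nonneg hc (by linarith : 0 ≤ n - (c + 1)),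
          mul_nonneg hc (sq_nonneg (n - c))]
  · rw [min_eq_left h1, max_eq_right (by linarith)]
    calc t * (t - (c + 1)) ≤ n * (n - (c + 1)) :=
          mul_le_mul h.2 (by linarith) (by linarith) (by linarith)
      _ ≤ _ := by nlinarith [mul_nonneg hc (by linarith : 0 ≤ n - (c + 1)),
          mul_nonneg hc (sq_nonneg (n - c))]

variable {V : ℕ → Type} [∀ m, Fintype (V m)]
  {μ : ∀ m, ι → V m → ℝ} {ν : ∀ m, ι → (ι → V m) → ℝ} {l : Filter ℕ}

lemma LinearForms.tendsto_weight (hμ : ∀ m, IsWeight (μ m)) (hν : LinearForms l μ ν) (j : ι) :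
    Tendsto (fun m => wE (μ m) fun x => ν m j x + 1) l (𝓝 2) := by
  have h := hν.prod_add_const (fun _ => 1) (fun i => if i = j then {∅} else ∅) (by
    intro i A hA hi
    split_ifs at hA with h
    · simp at hA; simp [hA] at hi
    · simp at hA)
  have hone : ∀ f : ι → Finset ι → ℝ,
      ∏ i, ∏ A ∈ (if i = j then ({∅} : Finset (Finset ι)) else ∅), f i A = f j ∅ := by
    intro f
    rw [Finset.prod_eq_single j (fun i _ hi => by simp [hi]) (fun h => (h (by simp)).elim)]
    simp
  simp only [hone, Finset.piecewise_empty] at h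
  norm_num at h
  refine h.congr fun m => ?_
  simp only [wE_const (hμ m)]

lemma LinearForms.tendsto_majorant (hμ : ∀ m, IsWeight (μ m)) (hν : LinearForms l μ ν) (j : ι)
    (k : ℝ) (hk : k = ∏ _i ∈ Finset.univ.erase j, (2 : ℝ)) :
    Tendsto (fun m => wE (μ m) fun x => ((wE (μ m) fun z => ∏ i ∈ Finset.univ.erase j,
      (ν m i (({j} : Finset ι).piecewise z x) + 1)) - k) ^ 2) l (𝓝 0) := by
  have hone : ∀ (𝒜 : Finset (Finset ι)) (f : ι → Finset ι → ℝ),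
      ∏ i, ∏ A ∈ (if i = j then (∅ : Finset (Finset ι)) else 𝒜), f i A =
        ∏ i ∈ Finset.univ.erase j, ∏ A ∈ 𝒜, f i A := by
    intro 𝒜 f
    rw [← Finset.mul_prod_erase _ _ (Finset.mem_univ j)]
    simp only [if_true, Finset.prod_empty, one_mul]
    exact Finset.prod_congr rfl fun i hi => by rw [if_neg (Finset.ne_of_mem_erase hi)]
  have hne : (∅ : Finset ι) ≠ {j} := (Finset.singleton_ne_empty _).symm
  have h1 := hν.prod_add_const (fun _ => 1) (fun i => if i = j then ∅ else {{j}}) (by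
    intro i A hA hi
    split_ifs at hA with h
    · simp at hA
    · simp at hA; subst hA; simp at hi; exact h hi)
  have h2 := hν.prod_add_const (fun _ => 1) (fun i => if i = j then ∅ else {∅, {j}}) (by
    intro i A hA hi
    split_ifs at hA with h
    · simp at hA
    · simp at hA
      rcases hA with rfl | rfl
      · simp at hi
      · simp at hi; exact h hi)
  simp only [hone, Finset.prod_singleton, Finset.prod_pair hne, Finset.piecewise_empty] at h1 h2
  have e1 : ∏ i ∈ Finset.univ.erase j, ((1 : ℝ) + 1) = k := by rw [hk]; norm_num
  have e2 : ∏ i ∈ Finset.univ.erase j, (((1 : ℝ) + 1) * (1 + 1)) = k * k := by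
    rw [hk, ← Finset.prod_mul_distrib]; norm_num
  rw [e1] at h1
  rw [e2] at h2
  have h3 := (h2.sub (h1.const_mul (2 * k))).add_const (k * k)
  have e3 : k * k - 2 * k * k + k * k = 0 := by ring
  rw [e3] at h3
  refine h3.congr fun m => ?_
  set p : (ι → V m) → ℝ := fun x => ∏ i ∈ Finset.univ.erase j, (ν m i x + 1) with hp
  set N : (ι → V m) → ℝ := fun x => wE (μ m) fun z => p (({j} : Finset ι).piecewise z x) with hN
  have h4 : (wE (μ m) fun x => N x * N x) = wE (μ m) fun x => wE (μ m) fun z =>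
      p x * p (({j} : Finset ι).piecewise z x) := by
    rw [← wE_average (hμ m) j (dependsOn_average _ j p) p]
    simp only [wE_const_mul, mul_comm]
  have h5 : wE (μ m) (fun x => (N x - k) ^ 2) =
      (wE (μ m) fun x => N x * N x) - 2 * k * (wE (μ m) N) + k * k := by
    rw [← wE_const_mul, ← wE_sub]
    conv_rhs => rw [← wE_const (hμ m) (k * k), ← wE_add]
    congr 1; funext x; ring
  have h6 : ∀ x, (wE (μ m) fun z => ∏ i ∈ Finset.univ.erase j,
      (ν m i (({j} : Finset ι).piecewise z x) + 1)) = N x := fun x => rfl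
  simp only [h6]
  rw [h5, h4]
  simp only [hN, hp, Finset.prod_mul_distrib]

/-- A function that is orthogonal to products of bounded functions of fewer coordinates is
orthogonal to products of functions dominated by the weights. -/
lemma relative_counting (hμ : ∀ m, IsWeight (μ m)) (hν : LinearForms l μ ν)
    (hd : ∀ m i, DependsOn (ν m i) {i}ᶜ) (hν₀ : ∀ m i x, 0 ≤ ν m i x) (j₀ : ι)
    (s : ∀ m, (ι → V m) → ℝ)
    (orth : ∀ u : ∀ m, ι → (ι → V m) → ℝ, (∀ m k, DependsOn (u m k) {k}ᶜ) →
      (∀ m k x, |u m k x| ≤ 1) →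
      Tendsto (fun m => wE (μ m) fun x => s m x * ∏ k ∈ Finset.univ.erase j₀, u m k x) l (𝓝 0))
    (B : Finset ι) (F : ∀ m, ι → (ι → V m) → ℝ) (hF : ∀ m i, DependsOn (F m i) {i}ᶜ)
    (hF₀ : ∀ m, F m j₀ = s m) (hFν : ∀ m i x, |F m i x| ≤ ν m i x + 1)
    (hF₁ : ∀ m i x, i ≠ j₀ → i ∉ B → |F m i x| ≤ 1) :
    Tendsto (fun m => wE (μ m) fun x => ∏ i, F m i x) l (𝓝 0) := by
  induction B using Finset.induction_on generalizing F with
  | empty =>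
    have := orth (fun m k => if k = j₀ then fun _ => 0 else F m k)
      (fun m k => by split_ifs; exacts [fun _ _ _ => rfl, hF m k])
      (fun m k x => by split_ifs with h; exacts [by simp, hF₁ m k x h (by simp)])
    refine this.congr fun m => ?_
    congr 1; funext x
    rw [← Finset.mul_prod_erase _ _ (Finset.mem_univ j₀), hF₀]
    congr 1
    exact Finset.prod_congr rfl fun k hk => by rw [if_neg (Finset.ne_of_mem_erase hk)]
  | insert j₁ B hjB ih =>
    by_cases hj : j₁ = j₀
    · exact ih F hF hF₀ hFν fun m i x h h' => hF₁ m i x h (by simp [h', hj, h])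
    set P : ∀ m, (ι → V m) → ℝ := fun m x => ∏ i ∈ Finset.univ.erase j₁, F m i x with hP
    set G : ∀ m, (ι → V m) → ℝ := fun m x =>
      wE (μ m) fun z => P m (({j₁} : Finset ι).piecewise z x) with hG
    have hGd : ∀ m, DependsOn (G m) {j₁}ᶜ := fun m => dependsOn_average _ _ _
    set k : ℝ := ∏ _i ∈ Finset.univ.erase j₁, (2 : ℝ) with hk
    have hk0 : 0 ≤ k := Finset.prod_nonneg fun _ _ => by norm_num
    have hsplit : ∀ m x, ∏ i, F m i x = F m j₁ x * P m x := fun m x =>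
      (Finset.mul_prod_erase _ _ (Finset.mem_univ j₁)).symm
    -- the square of `G` against the weight minus one
    have hA : Tendsto (fun m => wE (μ m) fun x => (ν m j₁ x - 1) * G m x ^ 2) l (𝓝 0) := by
      refine (tendsto_weight_sub_one_mul hμ hν hd j₁ F F hF hF hFν hFν).congr fun m => ?_
      have h1 : (wE (μ m) fun x => (ν m j₁ x - 1) * G m x ^ 2) =
          wE (μ m) fun x => (ν m j₁ x - 1) * G m x * wE (μ m) fun z =>
            P m (({j₁} : Finset ι).piecewise z x) := by
        congr 1; funext x; simp only [hG]; ring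
      rw [h1, ← wE_average (hμ m) j₁ (d := fun x => (ν m j₁ x - 1) * G m x)
        (fun x y h => by simp only [hd m j₁ h, hGd m h])]
      congr 1; funext x
      simp only [wE_const_mul, hG]
      ring
    -- the square of `G`
    have hB : Tendsto (fun m => wE (μ m) fun x => G m x ^ 2) l (𝓝 0) := by
      have hN := (hν.tendsto_majorant hμ j₁ k hk).const_mul (1 + k)
      have hT : Tendsto (fun m => wE (μ m) fun x => clamp (k + 1) (G m x) * G m x) l (𝓝 0) := by
        have := ih (fun m => Function.update (F m) j₁ fun x => (k + 1)⁻¹ * clamp (k + 1) (G m x))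
          (fun m i => by
            by_cases h : i = j₁
            · subst h; simp only [Function.update_self]
              exact fun x y h => by simp only [hGd m h]
            · simp only [Function.update_of_ne h]; exact hF m i)
          (fun m => by rw [Function.update_of_ne (Ne.symm hj), hF₀])
          (fun m i x => by
            by_cases h : i = j₁
            · subst h; simp only [Function.update_self, abs_mul]
              rw [abs_of_nonneg (by positivity : 0 ≤ (k + 1)⁻¹)]
              calc _ ≤ (k + 1)⁻¹ * (k + 1) :=
                    mul_le_mul_of_nonneg_left (abs_clamp_le (by linarith) _) (by positivity)
                _ = 1 := inv_mul_cancel₀ (by positivity)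
                _ ≤ _ := by linarith [hν₀ m i x]
            · simp only [Function.update_of_ne h]; exact hFν m i x)
          (fun m i x h0 h' => by
            by_cases h : i = j₁
            · subst h; simp only [Function.update_self, abs_mul]
              rw [abs_of_nonneg (by positivity : 0 ≤ (k + 1)⁻¹)]
              calc _ ≤ (k + 1)⁻¹ * (k + 1) :=
                    mul_le_mul_of_nonneg_left (abs_clamp_le (by linarith) _) (by positivity)
                _ = 1 := inv_mul_cancel₀ (by positivity)
            · simp only [Function.update_of_ne h]; exact hF₁ m i x h0 (by simp [h, h']))
        have h2 := this.const_mul (k + 1)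
        rw [mul_zero] at h2
        refine h2.congr fun m => ?_
        rw [← wE_const_mul, hG, ← wE_average (hμ m) j₁
          (d := fun x => clamp (k + 1) (wE (μ m) fun z => P m (({j₁} : Finset ι).piecewise z x)))
          (fun x y h => congrArg (clamp (k + 1)) (hGd m h))]
        congr 1; funext x
        rw [← Finset.mul_prod_erase _ _ (Finset.mem_univ j₁), Function.update_self,
          ← mul_assoc, ← mul_assoc, mul_inv_cancel₀ (by positivity), one_mul]
        congr 1
        exact Finset.prod_congr rfl fun i hi => by
          rw [Function.update_of_ne (Finset.ne_of_mem_erase hi)]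
      have hsum := hN.add hT
      rw [mul_zero, add_zero] at hsum
      refine squeeze_zero (fun m => wE_nonneg (hμ m) fun x => sq_nonneg _) (fun m => ?_) hsum
      rw [← wE_const_mul, ← wE_add]
      refine wE_mono (hμ m) fun x => ?_
      have hle : |G m x| ≤ wE (μ m) fun z => ∏ i ∈ Finset.univ.erase j₁,
          (ν m i (({j₁} : Finset ι).piecewise z x) + 1) :=
        (abs_wE_le (hμ m) _).trans (wE_mono (hμ m) fun z => by
          simp only [hP, Finset.abs_prod]
          exact Finset.prod_le_prod (fun _ _ => abs_nonneg _) fun i _ => hFν m i _)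
      have := mul_sub_clamp_le hk0 hle
      nlinarith [this]
    have hC : Tendsto (fun m => wE (μ m) fun x => (ν m j₁ x + 1) * G m x ^ 2) l (𝓝 0) := by
      have := hA.add (hB.const_mul 2)
      simp only [mul_zero, add_zero] at this
      refine this.congr fun m => ?_
      rw [← wE_const_mul, ← wE_add]
      congr 1; funext x; ring
    refine tendsto_zero_of_sq_le (fun m => ?_) (hν.tendsto_weight hμ j₁) hC
    simp only [hsplit]
    rw [wE_average (hμ m) j₁ (hF m j₁)]
    exact wE_cauchy (hμ m) (hFν m j₁)

end RelativeCounting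

section ConditionalAverage

variable {ι : Type} [Fintype ι] [DecidableEq ι] {V : Type} [Fintype V] {μ : ι → V → ℝ}
  {γ κ : Type} [DecidableEq γ] [DecidableEq κ]

/-- The average of `f` over the atom `c = a`. -/
noncomputable def condAvg (μ : ι → V → ℝ) (c : (ι → V) → γ) (f : (ι → V) → ℝ) (a : γ) : ℝ :=
  wE μ (fun x => f x * if c x = a then 1 else 0) / wE μ (fun x => if c x = a then 1 else 0)

/-- The average of `f` over the atom `c = a`, truncated at `1`. -/
noncomputable def capAvg (μ : ι → V → ℝ) (c : (ι → V) → γ) (f : (ι → V) → ℝ) (a : γ) : ℝ :=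
  min (condAvg μ c f a) 1

lemma condAvg_nonneg (hμ : IsWeight μ) (c : (ι → V) → γ) {f : (ι → V) → ℝ} (hf : ∀ x, 0 ≤ f x)
    (a : γ) : 0 ≤ condAvg μ c f a :=
  div_nonneg (wE_nonneg hμ fun x => mul_nonneg (hf x) (by split_ifs <;> norm_num))
    (wE_nonneg hμ fun x => by split_ifs <;> norm_num)

lemma capAvg_nonneg (hμ : IsWeight μ) (c : (ι → V) → γ) {f : (ι → V) → ℝ} (hf : ∀ x, 0 ≤ f x)
    (a : γ) : 0 ≤ capAvg μ c f a :=
  le_min (condAvg_nonneg hμ c hf a) zero_le_one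

lemma capAvg_le_one (c : (ι → V) → γ) (f : (ι → V) → ℝ) (a : γ) : capAvg μ c f a ≤ 1 :=
  min_le_right _ _

lemma sum_capAvg_le (hμ : IsWeight μ) (c : (ι → V) → γ) {L : Type} [Fintype L]
    {f : L → (ι → V) → ℝ} (hf : ∀ x, ∑ b, f b x ≤ 1) (a : γ) :
    ∑ b, capAvg μ c (f b) a ≤ 1 := by
  calc ∑ b, capAvg μ c (f b) a ≤ ∑ b, condAvg μ c (f b) a :=
        Finset.sum_le_sum fun b _ => min_le_left _ _
    _ ≤ 1 := by
        unfold condAvg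
        rw [← Finset.sum_div, ← wE_sum]
        have hP : 0 ≤ wE μ (fun x => if c x = a then (1 : ℝ) else 0) :=
          wE_nonneg hμ fun x => by split_ifs <;> norm_num
        refine div_le_one_of_le₀ (wE_mono hμ fun x => ?_) hP
        rw [← Finset.sum_mul]
        split_ifs
        · simpa using hf x
        · simp

lemma wE_mul_indicator (hμ : IsWeight μ) (c : (ι → V) → γ) (f : (ι → V) → ℝ) (a : γ) :
    wE μ (fun x => f x * if c x = a then 1 else 0) =
      condAvg μ c f a * wE μ (fun x => if c x = a then 1 else 0) := by
  unfold condAvg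
  by_cases h : wE μ (fun x => if c x = a then (1 : ℝ) else 0) = 0
  · rw [h, mul_zero]
    have h1 : ∀ x : ι → V, (∏ i, μ i (x i)) * (if c x = a then (1 : ℝ) else 0) = 0 := fun x =>
      (Finset.sum_eq_zero_iff_of_nonneg fun x _ => mul_nonneg (hμ.prod_nonneg x)
        (by split_ifs <;> norm_num)).1 h x (Finset.mem_univ x)
    refine Finset.sum_eq_zero fun x _ => ?_
    rw [mul_left_comm, h1, mul_zero]
  · rw [div_mul_cancel₀ _ h]

lemma sum_indicator_mul {c : (ι → V) → γ} {T : Finset γ} (hT : ∀ x, c x ∈ T) (φ : γ → ℝ)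
    (x : ι → V) : φ (c x) = ∑ a ∈ T, φ a * if c x = a then 1 else 0 := by
  simp [hT]

lemma wE_mul_comp (hμ : IsWeight μ) {c : (ι → V) → γ} {T : Finset γ} (hT : ∀ x, c x ∈ T)
    (f : (ι → V) → ℝ) (φ : γ → ℝ) :
    wE μ (fun x => f x * φ (c x)) = wE μ (fun x => condAvg μ c f (c x) * φ (c x)) := by
  have h1 : ∀ x, f x * φ (c x) = ∑ a ∈ T, φ a * (f x * if c x = a then 1 else 0) := fun x => by
    rw [sum_indicator_mul hT φ x, Finset.mul_sum]
    exact Finset.sum_congr rfl fun a _ => by ring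
  have h2 : ∀ x, condAvg μ c f (c x) * φ (c x) =
      ∑ a ∈ T, condAvg μ c f a * φ a * if c x = a then 1 else 0 := fun x =>
    sum_indicator_mul hT (fun a => condAvg μ c f a * φ a) x
  simp only [h1, h2, wE_sum, wE_const_mul]
  exact Finset.sum_congr rfl fun a _ => by rw [wE_mul_indicator hμ c f a]; ring

/-- The mean error committed by truncating the conditional average. -/
noncomputable def capError (μ : ι → V → ℝ) (c : (ι → V) → γ) (f : (ι → V) → ℝ) : ℝ :=
  wE μ fun x => |condAvg μ c f (c x) - capAvg μ c f (c x)|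

lemma capError_nonneg (hμ : IsWeight μ) (c : (ι → V) → γ) (f : (ι → V) → ℝ) :
    0 ≤ capError μ c f := wE_nonneg hμ fun _ => abs_nonneg _

lemma capError_le (hμ : IsWeight μ) {c : (ι → V) → γ} {T : Finset γ} (hT : ∀ x, c x ∈ T)
    {f ν : (ι → V) → ℝ} (hfν : ∀ x, f x ≤ ν x) :
    capError μ c f ≤ ∑ a ∈ T, |wE μ fun x => (ν x - 1) * if c x = a then 1 else 0| := by
  unfold capError
  have h2 : ∀ x, |condAvg μ c f (c x) - capAvg μ c f (c x)| =
      ∑ a ∈ T, |condAvg μ c f a - capAvg μ c f a| * if c x = a then 1 else 0 := fun x =>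
    sum_indicator_mul hT (fun a => |condAvg μ c f a - capAvg μ c f a|) x
  simp only [h2, wE_sum, wE_const_mul]
  refine Finset.sum_le_sum fun a _ => ?_
  have hP : 0 ≤ wE μ (fun x => if c x = a then (1 : ℝ) else 0) :=
    wE_nonneg hμ fun x => by split_ifs <;> norm_num
  unfold capAvg
  rcases le_total (condAvg μ c f a) 1 with h | h
  · rw [min_eq_left h]; simp
  · rw [min_eq_right h, abs_of_nonneg (by linarith), sub_mul, one_mul, ← wE_mul_indicator hμ,
      ← wE_sub]
    refine le_trans (wE_mono hμ fun x => ?_) (le_abs_self _)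
    split_ifs
    · simpa using hfν x
    · simp

lemma abs_wE_mul_le (hμ : IsWeight μ) {f φ : (ι → V) → ℝ} (hφ : ∀ x, |φ x| ≤ 1) :
    |wE μ fun x => f x * φ x| ≤ wE μ fun x => |f x| :=
  (abs_wE_le hμ _).trans (wE_mono hμ fun x => by
    rw [abs_mul]; exact mul_le_of_le_one_right (abs_nonneg _) (hφ x))

lemma wE_abs_le_sqrt (hμ : IsWeight μ) (f : (ι → V) → ℝ) :
    wE μ (fun x => |f x|) ≤ √(wE μ fun x => f x ^ 2) := by
  refine Real.le_sqrt_of_sq_le ?_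
  have := wE_cauchy hμ (a := fun _ => 1) (b := fun x => |f x|) (c := fun _ => 1) (by simp)
  simpa [wE_const hμ] using this

lemma wE_sq_sub_le (hμ : IsWeight μ) {c : (ι → V) → γ} {c' : (ι → V) → κ} {T : Finset γ}
    {T' : Finset κ} (hT : ∀ x, c x ∈ T) (hT' : ∀ x, c' x ∈ T') (ψ : κ → γ)
    (hψ : ∀ x, c x = ψ (c' x)) {f : (ι → V) → ℝ} (hf : ∀ x, 0 ≤ f x) :
    wE μ (fun x => (capAvg μ c' f (c' x) - capAvg μ c f (c x)) ^ 2) ≤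
      wE μ (fun x => capAvg μ c' f (c' x) ^ 2) - wE μ (fun x => capAvg μ c f (c x) ^ 2) +
        2 * (capError μ c' f + capError μ c f) := by
  set g' := fun x => capAvg μ c' f (c' x) with hg'
  set g := fun x => capAvg μ c f (c x) with hg
  set k' := fun x => condAvg μ c' f (c' x) with hk'
  set k := fun x => condAvg μ c f (c x) with hk
  have h1 : wE μ (fun x => k' x * g x) = wE μ (fun x => k x * g x) := by
    rw [hk, hg, ← wE_mul_comp hμ hT f (capAvg μ c f)]
    simp only [hψ, hk']
    exact (wE_mul_comp hμ hT' f (fun a => capAvg μ c f (ψ a))).symm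
  have hgb : ∀ x, |g x| ≤ 1 := fun x => by
    rw [abs_of_nonneg (capAvg_nonneg hμ c hf _)]; exact capAvg_le_one _ _ _
  have h2 := (abs_le.1 (abs_wE_mul_le hμ (f := fun x => k' x - g' x) hgb)).2
  have h3 := (abs_le.1 (abs_wE_mul_le hμ (f := fun x => k x - g x) hgb)).1
  have e' : capError μ c' f = wE μ fun x => |k' x - g' x| := rfl
  have e : capError μ c f = wE μ fun x => |k x - g x| := rfl
  rw [← e'] at h2
  rw [← e] at h3
  have h4 : wE μ (fun x => (g' x - g x) ^ 2) = wE μ (fun x => g' x ^ 2) - wE μ (fun x => g x ^ 2)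
      + 2 * (wE μ (fun x => (k' x - g' x) * g x) - wE μ (fun x => (k x - g x) * g x)
        - (wE μ (fun x => k' x * g x) - wE μ (fun x => k x * g x))) := by
    simp only [← wE_sub, ← wE_const_mul, ← wE_add]
    congr 1; funext x; ring
  rw [h4, h1, sub_self]
  linarith

lemma abs_wE_sub_capAvg_le (hμ : IsWeight μ) {c : (ι → V) → γ} {c' : (ι → V) → κ}
    {T' : Finset κ} (hT' : ∀ x, c' x ∈ T') (f : (ι → V) → ℝ) (φ : κ → ℝ) (hφ : ∀ x, |φ (c' x)| ≤ 1) :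
    |wE μ fun x => (f x - capAvg μ c f (c x)) * φ (c' x)| ≤
      capError μ c' f + √(wE μ fun x => (capAvg μ c' f (c' x) - capAvg μ c f (c x)) ^ 2) := by
  have h1 : wE μ (fun x => (f x - capAvg μ c f (c x)) * φ (c' x)) =
      wE μ (fun x => (condAvg μ c' f (c' x) - capAvg μ c' f (c' x)) * φ (c' x)) +
      wE μ (fun x => (capAvg μ c' f (c' x) - capAvg μ c f (c x)) * φ (c' x)) := by
    simp only [sub_mul, wE_sub]
    rw [wE_mul_comp hμ hT' f φ]
    ring
  rw [h1]
  refine (abs_add_le _ _).trans (add_le_add (abs_wE_mul_le hμ hφ) ?_)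
  exact (abs_wE_mul_le hμ hφ).trans (wE_abs_le_sqrt hμ _)

end ConditionalAverage

lemma exists_tendsto_of_mem_Icc (U : Ultrafilter ℕ) {a : ℕ → ℝ} {p q : ℝ}
    (h : ∀ m, a m ∈ Set.Icc p q) : ∃ x ∈ Set.Icc p q, Tendsto a U (𝓝 x) := by
  have := (isCompact_Icc (a := p) (b := q)).ultrafilter_le_nhds (U.map a)
    (le_principal_iff.2 (by
      rw [Ultrafilter.mem_coe, Ultrafilter.mem_map]
      exact Filter.univ_mem' h))
  simpa [Tendsto] using this

lemma abs_prod_sub_prod_le {α : Type*} [DecidableEq α] (s : Finset α) {u v : α → ℝ}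
    (hu : ∀ k ∈ s, |u k| ≤ 1) (hv : ∀ k ∈ s, |v k| ≤ 1) :
    |∏ k ∈ s, u k - ∏ k ∈ s, v k| ≤ ∑ k ∈ s, |u k - v k| := by
  induction s using Finset.induction_on with
  | empty => simp
  | insert a s ha ih =>
    rw [Finset.prod_insert ha, Finset.prod_insert ha, Finset.sum_insert ha]
    have h1 := ih (fun k hk => hu k (Finset.mem_insert_of_mem hk))
      (fun k hk => hv k (Finset.mem_insert_of_mem hk))
    have h2 : |∏ k ∈ s, v k| ≤ 1 := by
      rw [Finset.abs_prod]
      exact Finset.prod_le_one (fun _ _ => abs_nonneg _)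
        fun k hk => hv k (Finset.mem_insert_of_mem hk)
    calc |u a * ∏ k ∈ s, u k - v a * ∏ k ∈ s, v k|
        = |(u a - v a) * ∏ k ∈ s, v k + u a * (∏ k ∈ s, u k - ∏ k ∈ s, v k)| := by
          congr 1; ring
      _ ≤ |u a - v a| * |∏ k ∈ s, v k| + |u a| * |∏ k ∈ s, u k - ∏ k ∈ s, v k| := by
          rw [← abs_mul, ← abs_mul]; exact abs_add_le _ _
      _ ≤ |u a - v a| * 1 + 1 * ∑ k ∈ s, |u k - v k| := by
          gcongr
          exact hu a (Finset.mem_insert_self _ _)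
      _ = _ := by ring

section Colourings

variable {ι : Type} [Fintype ι] [DecidableEq ι] {V : ℕ → Type} [∀ m, Fintype (V m)]
  {μ : ∀ m, ι → V m → ℝ} {e : Finset ι}

/-- `s` is asymptotically orthogonal to products of bounded functions of fewer coordinates
of `e`. -/
def OrthLocal (l : Filter ℕ) (μ : ∀ m, ι → V m → ℝ) (e : Finset ι)
    (s : ∀ m, (ι → V m) → ℝ) : Prop :=
  ∀ u : ∀ m, ι → (ι → V m) → ℝ,
    (∀ m, ∀ k ∈ e, DependsOn (u m k) (e.erase k : Finset ι)) → (∀ m k x, |u m k x| ≤ 1) →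
    Tendsto (fun m => wE (μ m) fun x => s m x * ∏ k ∈ e, u m k x) l (𝓝 0)

/-- A bounded system of colourings, one for each facet of `e`. -/
structure Colouring (e : Finset ι) (V : ℕ → Type) where
  K : ℕ
  col : ∀ m, (ι → V m) → ι → ℕ
  lt : ∀ m x k, col m x k < K
  off : ∀ m x k, k ∉ e → col m x k = 0
  dep : ∀ m, ∀ k ∈ e, DependsOn (fun x => col m x k) (e.erase k : Finset ι)

namespace Colouring

/-- The possible values of the joint colour. -/
def atoms (C : Colouring e V) : Finset (ι → ℕ) := Fintype.piFinset fun _ => Finset.range C.K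

lemma mem_atoms (C : Colouring e V) (m : ℕ) (x : ι → V m) : C.col m x ∈ C.atoms :=
  Fintype.mem_piFinset.2 fun k => Finset.mem_range.2 (C.lt m x k)

lemma dependsOn (C : Colouring e V) (m : ℕ) : DependsOn (C.col m) e := by
  intro x y h
  funext k
  by_cases hk : k ∈ e
  · exact C.dep m k hk fun i hi => h i (Finset.mem_of_mem_erase hi)
  · rw [C.off m x k hk, C.off m y k hk]

/-- The constant colouring. -/
def trivial (e : Finset ι) (V : ℕ → Type) : Colouring e V where
  K := 1
  col _ _ _ := 0
  lt _ _ _ := zero_lt_one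
  off _ _ _ _ := rfl
  dep _ _ _ _ _ _ := rfl

/-- The common refinement of two colourings. -/
def join (C D : Colouring e V) : Colouring e V where
  K := (max C.K D.K + 1) ^ 2
  col m x k := Nat.pair (C.col m x k) (D.col m x k)
  lt m x k := (Nat.pair_lt_max_add_one_sq _ _).trans_le (by
    gcongr
    · exact (C.lt m x k).le
    · exact (D.lt m x k).le)
  off m x k hk := by rw [C.off m x k hk, D.off m x k hk]; rfl
  dep m k hk x y h := by
    have h1 : C.col m x k = C.col m y k := C.dep m k hk h
    have h2 : D.col m x k = D.col m y k := D.dep m k hk h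
    simp only [h1, h2]

/-- `C` is a refinement of `D`. -/
def Refines (C D : Colouring e V) : Prop :=
  ∃ ψ : (ι → ℕ) → ι → ℕ, ∀ m x, D.col m x = ψ (C.col m x)

lemma Refines.refl (C : Colouring e V) : C.Refines C := ⟨id, fun _ _ => rfl⟩

lemma Refines.trans {C D E : Colouring e V} (h : C.Refines D) (h' : D.Refines E) :
    C.Refines E := by
  obtain ⟨ψ, hψ⟩ := h
  obtain ⟨ψ', hψ'⟩ := h'
  exact ⟨ψ' ∘ ψ, fun m x => by rw [hψ', hψ]; rfl⟩

lemma join_refines_left (C D : Colouring e V) : (C.join D).Refines C :=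
  ⟨fun c k => (c k).unpair.1, fun m x => by funext k; simp [join]⟩

lemma join_refines_right (C D : Colouring e V) : (C.join D).Refines D :=
  ⟨fun c k => (c k).unpair.2, fun m x => by funext k; simp [join]⟩

/-- The colouring obtained by rounding functions with values in `[-1, 1]`. -/
noncomputable def round (D : ℕ) (u : ∀ m, ι → (ι → V m) → ℝ)
    (hu : ∀ m, ∀ k ∈ e, DependsOn (u m k) (e.erase k : Finset ι))
    (hu₁ : ∀ m k x, |u m k x| ≤ 1) : Colouring e V where
  K := 2 * D + 1
  col m x k := if k ∈ e then ⌊(u m k x + 1) * D⌋₊ else 0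
  lt m x k := by
    split_ifs
    · have h := abs_le.1 (hu₁ m k x)
      have : ⌊(u m k x + 1) * D⌋₊ ≤ 2 * D := by
        refine Nat.floor_le_of_le ?_
        push_cast
        exact mul_le_mul_of_nonneg_right (by linarith) (Nat.cast_nonneg _)
      omega
    · omega
  off m x k hk := by simp [hk]
  dep m k hk x y h := by simp [hk, hu m k hk h]

lemma abs_sub_round_le {D : ℕ} (hD : 0 < D) {t : ℝ} (ht : |t| ≤ 1) :
    |t - ((⌊(t + 1) * D⌋₊ : ℝ) / D - 1)| ≤ 1 / D ∧ |(⌊(t + 1) * D⌋₊ : ℝ) / D - 1| ≤ 1 := by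
  have hD' : (0 : ℝ) < D := by exact_mod_cast hD
  have h := abs_le.1 ht
  have h0 : 0 ≤ (t + 1) * D := mul_nonneg (by linarith) hD'.le
  have h1 : (⌊(t + 1) * D⌋₊ : ℝ) / D ≤ t + 1 := by
    rw [div_le_iff₀ hD']; exact Nat.floor_le h0
  have h2 : t + 1 ≤ (⌊(t + 1) * D⌋₊ : ℝ) / D + 1 / D := by
    rw [← add_div, le_div_iff₀ hD']; exact (Nat.lt_floor_add_one _).le
  have h3 : (0 : ℝ) ≤ (⌊(t + 1) * D⌋₊ : ℝ) / D := by positivity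
  constructor <;> rw [abs_le] <;> constructor <;> linarith [one_div_pos.2 hD']

lemma indicator_eq (C : Colouring e V) (a : ι → ℕ) (ha : ∀ k, k ∉ e → a k = 0) (m : ℕ)
    (x : ι → V m) : (if C.col m x = a then (1 : ℝ) else 0) =
      ∏ k ∈ e, if C.col m x k = a k then 1 else 0 := by
  by_cases h : C.col m x = a
  · rw [if_pos h, Finset.prod_eq_one fun k _ => by rw [h, if_pos rfl]]
  · rw [if_neg h]
    have : ∃ k ∈ e, C.col m x k ≠ a k := by
      by_contra! h'
      refine h (funext fun k => ?_)
      by_cases hk : k ∈ e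
      · exact h' k hk
      · rw [C.off m x k hk, ha k hk]
    obtain ⟨k, hk, hk'⟩ := this
    exact (Finset.prod_eq_zero hk (if_neg hk')).symm

end Colouring

lemma OrthLocal.tendsto_indicator {l : Filter ℕ} {s : ∀ m, (ι → V m) → ℝ}
    (h : OrthLocal l μ e s) (C : Colouring e V) (a : ι → ℕ) :
    Tendsto (fun m => wE (μ m) fun x => s m x * if C.col m x = a then 1 else 0) l (𝓝 0) := by
  by_cases ha : ∀ k, k ∉ e → a k = 0
  · simp only [C.indicator_eq a ha]
    refine h (fun m k x => if C.col m x k = a k then 1 else 0) (fun m k hk x y hxy => ?_)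
      (fun m k x => by split_ifs <;> simp)
    have : C.col m x k = C.col m y k := C.dep m k hk hxy
    simp only [this]
  · push Not at ha
    obtain ⟨k, hk, hk'⟩ := ha
    have : ∀ m x, C.col m x ≠ a := fun m x hx => hk' (by rw [← hx, C.off m x k hk])
    simp [this, wE, tendsto_const_nhds]

lemma OrthLocal.tendsto_capError {l : Filter ℕ} (hμ : ∀ m, IsWeight (μ m))
    {f ν : ∀ m, (ι → V m) → ℝ} (hfν : ∀ m x, f m x ≤ ν m x)
    (h : OrthLocal l μ e fun m x => ν m x - 1) (C : Colouring e V) :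
    Tendsto (fun m => capError (μ m) (C.col m) (f m)) l (𝓝 0) := by
  refine squeeze_zero (fun m => capError_nonneg (hμ m) _ _)
    (fun m => capError_le (hμ m) (C.mem_atoms m) (hfν m)) ?_
  have := tendsto_finsetSum C.atoms fun a _ => (h.tendsto_indicator C a).abs
  simpa using this

end Colourings

section Projection

variable {ι : Type} [Fintype ι] [DecidableEq ι] {V : ℕ → Type} [∀ m, Fintype (V m)]
  {μ : ∀ m, ι → V m → ℝ} {e : Finset ι} {L : Type} [Fintype L]

lemma OrthLocal.mul_comp {l : Filter ℕ} {s : ∀ m, (ι → V m) → ℝ}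
    (h : OrthLocal l μ e s) (C : Colouring e V) (φ : (ι → ℕ) → ℝ) :
    OrthLocal l μ e fun m x => s m x * φ (C.col m x) := by
  intro u hu hu₁
  have h1 : ∀ m x, s m x * φ (C.col m x) * ∏ k ∈ e, u m k x =
      ∑ a ∈ C.atoms, φ a * ((s m x * ∏ k ∈ e, u m k x) * if C.col m x = a then 1 else 0) :=
    fun m x => by
      rw [sum_indicator_mul (C.mem_atoms m) φ x, Finset.mul_sum, Finset.sum_mul]
      exact Finset.sum_congr rfl fun a _ => by ring
  simp only [h1, wE_sum, wE_const_mul]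
  have h2 : ∀ a, Tendsto (fun m => wE (μ m) fun x =>
      (s m x * ∏ k ∈ e, u m k x) * if C.col m x = a then 1 else 0) l (𝓝 0) := by
    intro a
    by_cases ha : ∀ k, k ∉ e → a k = 0
    · simp only [C.indicator_eq a ha, mul_assoc, ← Finset.prod_mul_distrib]
      refine h (fun m k x => u m k x * if C.col m x k = a k then 1 else 0)
        (fun m k hk x y hxy => ?_) (fun m k x => ?_)
      · have h3 : C.col m x k = C.col m y k := C.dep m k hk hxy
        simp only [h3, hu m k hk hxy]
      · split_ifs
        · simpa using hu₁ m k x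
        · simp
    · push Not at ha
      obtain ⟨k, hk, hk'⟩ := ha
      have : ∀ m x, C.col m x ≠ a := fun m x hx => hk' (by rw [← hx, C.off m x k hk])
      simp [this, wE, tendsto_const_nhds]
  simpa using tendsto_finsetSum C.atoms fun a _ => (h2 a).const_mul (φ a)

/-- The truncated projection of `f` onto a colouring. -/
noncomputable def capProj (μ : ∀ m, ι → V m → ℝ) (f : ∀ m, L → (ι → V m) → ℝ)
    (C : Colouring e V) (m : ℕ) (a : L) (x : ι → V m) : ℝ :=
  capAvg (μ m) (C.col m) (f m a) (C.col m x)

/-- The squared distance between two truncated projections. -/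
noncomputable def projDist (μ : ∀ m, ι → V m → ℝ) (f : ∀ m, L → (ι → V m) → ℝ)
    (C' C : Colouring e V) (m : ℕ) : ℝ :=
  ∑ a, wE (μ m) fun x => (capProj μ f C' m a x - capProj μ f C m a x) ^ 2

/-- The energy of a truncated projection. -/
noncomputable def projEnergy (μ : ∀ m, ι → V m → ℝ) (f : ∀ m, L → (ι → V m) → ℝ)
    (C : Colouring e V) (m : ℕ) : ℝ :=
  ∑ a, wE (μ m) fun x => capProj μ f C m a x ^ 2

lemma abs_capProj_le (hμ : ∀ m, IsWeight (μ m)) {f : ∀ m, L → (ι → V m) → ℝ}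
    (hf : ∀ m a x, 0 ≤ f m a x) (C : Colouring e V) (m : ℕ) (a : L) (x : ι → V m) :
    |capProj μ f C m a x| ≤ 1 := by
  rw [capProj, abs_of_nonneg (capAvg_nonneg (hμ m) _ (hf m a) _)]
  exact capAvg_le_one _ _ _

lemma projEnergy_mem_Icc (hμ : ∀ m, IsWeight (μ m)) {f : ∀ m, L → (ι → V m) → ℝ}
    (hf : ∀ m a x, 0 ≤ f m a x) (C : Colouring e V) (m : ℕ) :
    projEnergy μ f C m ∈ Set.Icc (0 : ℝ) (Fintype.card L) := by
  constructor
  · exact Finset.sum_nonneg fun a _ => wE_nonneg (hμ m) fun x => sq_nonneg _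
  · have : ∀ a ∈ (Finset.univ : Finset L), (wE (μ m) fun x => capProj μ f C m a x ^ 2) ≤ 1 :=
      fun a _ => wE_le_const (hμ m) fun x => by
        rw [sq_le_one_iff_abs_le_one]; exact abs_capProj_le hμ hf C m a x
    simpa [projEnergy] using Finset.sum_le_sum this

lemma projDist_nonneg (hμ : ∀ m, IsWeight (μ m)) (f : ∀ m, L → (ι → V m) → ℝ)
    (C' C : Colouring e V) (m : ℕ) : 0 ≤ projDist μ f C' C m :=
  Finset.sum_nonneg fun a _ => wE_nonneg (hμ m) fun x => sq_nonneg _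

lemma wE_sq_le_projDist (hμ : ∀ m, IsWeight (μ m)) (f : ∀ m, L → (ι → V m) → ℝ)
    (C' C : Colouring e V) (m : ℕ) (a : L) :
    wE (μ m) (fun x => (capProj μ f C' m a x - capProj μ f C m a x) ^ 2) ≤
      projDist μ f C' C m :=
  Finset.single_le_sum (f := fun a => wE (μ m) fun x =>
    (capProj μ f C' m a x - capProj μ f C m a x) ^ 2)
    (fun a _ => wE_nonneg (hμ m) fun x => sq_nonneg _) (Finset.mem_univ a)

lemma exists_projDist_le {l : Filter ℕ} (hμ : ∀ m, IsWeight (μ m))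
    {f ν : ∀ m, L → (ι → V m) → ℝ} (hf : ∀ m a x, 0 ≤ f m a x)
    (hfν : ∀ m a x, f m a x ≤ ν m a x)
    (hν : ∀ a, OrthLocal l μ e fun m x => ν m a x - 1) {C' C : Colouring e V}
    (h : C'.Refines C) :
    ∃ err : ℕ → ℝ, Tendsto err l (𝓝 0) ∧
      ∀ m, projDist μ f C' C m ≤ projEnergy μ f C' m - projEnergy μ f C m + err m := by
  obtain ⟨ψ, hψ⟩ := h
  refine ⟨fun m => ∑ a, 2 * (capError (μ m) (C'.col m) (f m a) + capError (μ m) (C.col m) (f m a)),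
    ?_, fun m => ?_⟩
  · have := tendsto_finsetSum (Finset.univ : Finset L) fun a _ =>
      (((hν a).tendsto_capError hμ (fun m => hfν m a) C').add
        ((hν a).tendsto_capError hμ (fun m => hfν m a) C)).const_mul 2
    simpa using this
  · unfold projDist projEnergy
    rw [← Finset.sum_sub_distrib, ← Finset.sum_add_distrib]
    exact Finset.sum_le_sum fun a _ => wE_sq_sub_le (hμ m) (C.mem_atoms m) (C'.mem_atoms m) ψ
      (hψ m) (hf m a)

/-- A chain of colourings whose projections are eventually Cauchy. -/
lemma exists_chain (U : Ultrafilter ℕ) (hμ : ∀ m, IsWeight (μ m))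
    {f ν : ∀ m, L → (ι → V m) → ℝ} (hf : ∀ m a x, 0 ≤ f m a x)
    (hfν : ∀ m a x, f m a x ≤ ν m a x)
    (hν : ∀ a, OrthLocal (U : Filter ℕ) μ e fun m x => ν m a x - 1) :
    ∃ C : ℕ → Colouring e V, (∀ p p', p ≤ p' → (C p').Refines (C p)) ∧
      ∀ p C', Colouring.Refines C' (C p) →
        ∀ᶠ m in (U : Filter ℕ), projDist μ f C' (C p) m ≤ 2 / (p + 1) := by
  choose en hen₁ hen using fun C : Colouring e V =>
    exists_tendsto_of_mem_Icc U (projEnergy_mem_Icc hμ hf C)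
  have hmono : ∀ C' C : Colouring e V, C'.Refines C → en C ≤ en C' := by
    intro C' C h
    obtain ⟨err, herr, hle⟩ := exists_projDist_le hμ hf hfν hν h
    have := ge_of_tendsto' (((hen C').sub (hen C)).add herr) fun m =>
      (projDist_nonneg hμ f C' C m).trans (hle m)
    linarith
  have hbdd : BddAbove (Set.range en) := ⟨Fintype.card L, by
    rintro _ ⟨C, rfl⟩; exact (hen₁ C).2⟩
  set σ := sSup (Set.range en) with hσ
  have hle : ∀ C, en C ≤ σ := fun C => le_csSup hbdd ⟨C, rfl⟩
  have hD : ∀ p : ℕ, ∃ D : Colouring e V, σ - 1 / (p + 1) < en D := fun p => by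
    obtain ⟨_, ⟨D, rfl⟩, hD⟩ := exists_lt_of_lt_csSup
      (⟨_, ⟨Colouring.trivial e V, rfl⟩⟩ : (Set.range en).Nonempty)
      (sub_lt_self σ (by positivity : (0 : ℝ) < 1 / (p + 1)))
    exact ⟨D, hD⟩
  choose D hD using hD
  let C : ℕ → Colouring e V := fun p => Nat.rec (D 0) (fun p E => E.join (D (p + 1))) p
  have hCD : ∀ p, (C p).Refines (D p) := by
    intro p
    cases p with
    | zero => exact .refl _
    | succ p => exact Colouring.join_refines_right _ _
  refine ⟨C, fun p p' h => ?_, fun p C' h => ?_⟩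
  · induction h with
    | refl => exact .refl _
    | step _ ih => exact (Colouring.join_refines_left _ _).trans ih
  · obtain ⟨err, herr, hle'⟩ := exists_projDist_le hμ hf hfν hν h
    have h1 := ((hen C').sub (hen (C p))).add herr
    have h2 : en C' - en (C p) + 0 < 2 / (p + 1) := by
      have h3 := hmono _ _ (hCD p)
      have h4 := hD p
      have h5 := hle C'
      have h6 : (2 : ℝ) / (p + 1) = 1 / (p + 1) + 1 / (p + 1) := by ring
      have h7 : (0 : ℝ) < 1 / (p + 1) := by positivity
      linarith
    filter_upwards [h1.eventually_lt_const h2] with m hm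
    exact (hle' m).trans hm.le

lemma exists_diagonal (U : Ultrafilter ℕ) (hU : (U : Filter ℕ) ≤ atTop)
    {δ : ℕ → ℕ → ℕ → ℝ} {b : ℕ → ℝ}
    (h : ∀ p p', p ≤ p' → ∀ᶠ m in (U : Filter ℕ), δ p' p m ≤ b p) :
    ∃ q : ℕ → ℕ, ∀ p, ∀ᶠ m in (U : Filter ℕ), δ (q m) p m ≤ b p := by
  classical
  let good : ℕ → ℕ → Prop := fun m q => ∀ p' ≤ q, ∀ p ≤ p', δ p' p m ≤ b p
  have hgood : ∀ q, ∀ᶠ m in (U : Filter ℕ), good m q := fun q => by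
    refine (Set.finite_Iic q).eventually_all.2 fun p' _ => ?_
    exact (Set.finite_Iic p').eventually_all.2 fun p hp => h p p' hp
  refine ⟨fun m => Nat.findGreatest (good m) m, fun p => ?_⟩
  filter_upwards [hgood p, hU (eventually_ge_atTop p)] with m hm hpm
  exact Nat.findGreatest_spec hpm hm _ le_rfl _ (Nat.le_findGreatest hpm hm)

lemma abs_prod_le_one {α : Type*} (s : Finset α) {u : α → ℝ} (hu : ∀ k ∈ s, |u k| ≤ 1) :
    |∏ k ∈ s, u k| ≤ 1 := by
  rw [Finset.abs_prod]
  exact Finset.prod_le_one (fun _ _ => abs_nonneg _) hu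

lemma eventually_abs_wE_sub_capProj_le (U : Ultrafilter ℕ) (hμ : ∀ m, IsWeight (μ m))
    {f ν : ∀ m, L → (ι → V m) → ℝ} (hf : ∀ m a x, 0 ≤ f m a x)
    (hfν : ∀ m a x, f m a x ≤ ν m a x)
    (hν : ∀ a, OrthLocal (U : Filter ℕ) μ e fun m x => ν m a x - 1) (C : Colouring e V) {δ : ℝ}
    (hC : ∀ C', Colouring.Refines C' C → ∀ᶠ m in (U : Filter ℕ), projDist μ f C' C m ≤ δ) (a : L)
    {u : ∀ m, ι → (ι → V m) → ℝ} (hu : ∀ m, ∀ k ∈ e, DependsOn (u m k) (e.erase k : Finset ι))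
    (hu₁ : ∀ m k x, |u m k x| ≤ 1) {ε : ℝ} (hε : 0 < ε) :
    ∀ᶠ m in (U : Filter ℕ),
      |wE (μ m) fun x => (f m a x - capProj μ f C m a x) * ∏ k ∈ e, u m k x| ≤ √δ + ε := by
  obtain ⟨D, hD⟩ := exists_nat_gt (3 * (e.card : ℝ) / (ε / 2))
  have hD0 : 0 < D := by
    have : (0 : ℝ) < D := lt_of_le_of_lt (by positivity) hD
    exact_mod_cast this
  have hD' : (0 : ℝ) < D := by exact_mod_cast hD0
  set R := Colouring.round D u hu hu₁ with hR
  set C' := C.join R with hC'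
  let φ : (ι → ℕ) → ℝ := fun c => ∏ k ∈ e, (((c k).unpair.2 : ℝ) / D - 1)
  have hφ : ∀ m x, φ (C'.col m x) = ∏ k ∈ e, ((⌊(u m k x + 1) * D⌋₊ : ℝ) / D - 1) := by
    intro m x
    refine Finset.prod_congr rfl fun k hk => ?_
    simp [hC', Colouring.join, hR, Colouring.round, hk]
  have hφ₁ : ∀ m x, |φ (C'.col m x)| ≤ 1 := fun m x => by
    rw [hφ]
    exact abs_prod_le_one _ fun k _ => (Colouring.abs_sub_round_le hD0 (hu₁ m k x)).2
  have hφ₂ : ∀ m x, |∏ k ∈ e, u m k x - φ (C'.col m x)| ≤ e.card / D := fun m x => by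
    rw [hφ]
    refine (abs_prod_sub_prod_le e (fun k _ => hu₁ m k x)
      fun k _ => (Colouring.abs_sub_round_le hD0 (hu₁ m k x)).2).trans ?_
    refine (Finset.sum_le_sum fun k _ =>
      (Colouring.abs_sub_round_le hD0 (hu₁ m k x)).1).trans_eq ?_
    simp [div_eq_mul_inv]
  have herr := (hν a).tendsto_capError hμ (fun m => hfν m a) C'
  have hone : Tendsto (fun m => wE (μ m) fun x => ν m a x - 1) (U : Filter ℕ) (𝓝 0) := by
    have := hν a (fun _ _ _ => 1) (fun _ _ _ _ _ _ => rfl) (fun _ _ _ => by simp)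
    simpa using this
  filter_upwards [hC C' (Colouring.join_refines_left _ _),
    herr.eventually_lt_const (half_pos hε), hone.eventually_lt_const one_pos] with m h1 h2 h3
  have h4 : wE (μ m) (fun x => |f m a x - capProj μ f C m a x|) ≤ 3 := by
    have : wE (μ m) (fun x => |f m a x - capProj μ f C m a x|) ≤
        wE (μ m) (fun x => (ν m a x - 1) + 2) := wE_mono (hμ m) fun x => by
      have h5 := abs_le.1 (abs_capProj_le hμ hf C m a x)
      have h6 : 0 ≤ capProj μ f C m a x := capAvg_nonneg (hμ m) _ (hf m a) _
      rw [abs_le]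
      constructor <;> linarith [hf m a x, hfν m a x]
    rw [wE_add, wE_const (hμ m)] at this
    linarith
  have h5 : |wE (μ m) fun x => (f m a x - capProj μ f C m a x) * φ (C'.col m x)| ≤ ε / 2 + √δ := by
    refine (abs_wE_sub_capAvg_le (hμ m) (C'.mem_atoms m) (f m a) φ (hφ₁ m)).trans ?_
    gcongr
    exact (wE_sq_le_projDist hμ f C' C m a).trans h1
  have h6 : |wE (μ m) fun x => (f m a x - capProj μ f C m a x) *
      (∏ k ∈ e, u m k x - φ (C'.col m x))| ≤ ε / 2 := by
    refine (abs_wE_le (hμ m) _).trans ?_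
    calc wE (μ m) (fun x => |(f m a x - capProj μ f C m a x) *
          (∏ k ∈ e, u m k x - φ (C'.col m x))|)
        ≤ wE (μ m) (fun x => |f m a x - capProj μ f C m a x| * (e.card / D)) :=
          wE_mono (hμ m) fun x => by
            rw [abs_mul]; exact mul_le_mul_of_nonneg_left (hφ₂ m x) (abs_nonneg _)
      _ ≤ 3 * (e.card / D) := by
          rw [wE_mul_const]
          exact mul_le_mul_of_nonneg_right h4 (by positivity)
      _ ≤ ε / 2 := by
          rw [div_lt_iff₀ (by positivity)] at hD
          rw [← mul_div_assoc, div_le_iff₀ hD']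
          linarith
  have h7 : (wE (μ m) fun x => (f m a x - capProj μ f C m a x) * ∏ k ∈ e, u m k x) =
      (wE (μ m) fun x => (f m a x - capProj μ f C m a x) * φ (C'.col m x)) +
      wE (μ m) fun x => (f m a x - capProj μ f C m a x) *
        (∏ k ∈ e, u m k x - φ (C'.col m x)) := by
    rw [← wE_add]; congr 1; funext x; ring
  rw [h7]
  exact (abs_add_le _ _).trans (by linarith)

/-- Every function majorised by a pseudorandom weight is the sum of a bounded function and of
a function orthogonal to products of functions of fewer variables; moreover the bounded function
is approximated by functions of colourings of the facets. -/
theorem exists_bounded_projection (U : Ultrafilter ℕ) (hU : (U : Filter ℕ) ≤ atTop)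
    (hμ : ∀ m, IsWeight (μ m)) {f ν : ∀ m, L → (ι → V m) → ℝ} (hf : ∀ m a x, 0 ≤ f m a x)
    (hfν : ∀ m a x, f m a x ≤ ν m a x)
    (hν : ∀ a, OrthLocal (U : Filter ℕ) μ e fun m x => ν m a x - 1) :
    ∃ h : ∀ m, L → (ι → V m) → ℝ, (∀ m a, DependsOn (h m a) e) ∧ (∀ m a x, 0 ≤ h m a x) ∧
      (∀ m a x, h m a x ≤ 1) ∧ ((∀ m x, ∑ a, f m a x ≤ 1) → ∀ m x, ∑ a, h m a x ≤ 1) ∧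
      (∀ a, OrthLocal (U : Filter ℕ) μ e fun m x => f m a x - h m a x) ∧
      ∀ τ : ℝ, 0 < τ → ∃ (C : Colouring e V) (η : L → (ι → ℕ) → ℝ), (∀ a b, 0 ≤ η a b) ∧
        (∀ a b, η a b ≤ 1) ∧ ((∀ m x, ∑ a, f m a x ≤ 1) → ∀ b, ∑ a, η a b ≤ 1) ∧
        ∀ᶠ m in (U : Filter ℕ), ∀ a, wE (μ m) (fun x => |h m a x - η a (C.col m x)|) ≤ τ := by
  obtain ⟨C, hCr, hC⟩ := exists_chain U hμ hf hfν hν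
  obtain ⟨q, hq⟩ := exists_diagonal U hU (δ := fun p' p m => projDist μ f (C p') (C p) m)
    (b := fun p => 2 / (p + 1)) fun p p' h => hC p (C p') (hCr p p' h)
  have hb : Tendsto (fun p : ℕ => √(2 / ((p : ℝ) + 1))) atTop (𝓝 0) := by
    have := (tendsto_const_div_atTop_nhds_zero_nat (2 : ℝ)).comp (tendsto_add_atTop_nat 1)
    have := this.sqrt
    simpa using this
  have hclose : ∀ ε : ℝ, 0 < ε → ∃ p : ℕ, √(2 / ((p : ℝ) + 1)) < ε ∧
      ∀ᶠ m in (U : Filter ℕ), ∀ a, wE (μ m) (fun x =>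
        |capProj μ f (C (q m)) m a x - capProj μ f (C p) m a x|) ≤ ε := fun ε hε => by
    obtain ⟨p, hp⟩ := (hb.eventually_lt_const hε).exists
    refine ⟨p, hp, ?_⟩
    filter_upwards [hq p] with m hm a
    refine (wE_abs_le_sqrt (hμ m) _).trans ((Real.sqrt_le_sqrt ?_).trans hp.le)
    exact (wE_sq_le_projDist hμ f _ _ m a).trans hm
  refine ⟨fun m a => capProj μ f (C (q m)) m a, fun m a x y hxy => ?_,
    fun m a x => capAvg_nonneg (hμ m) _ (hf m a) _, fun m a x => capAvg_le_one _ _ _,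
    fun hs m x => sum_capAvg_le (hμ m) _ (hs m) _, fun a u hu hu₁ => ?_, fun τ hτ => ?_⟩
  · simp only [capProj, (C (q m)).dependsOn m hxy]
  · rw [Metric.tendsto_nhds]
    intro ε hε
    obtain ⟨p, hp, hp'⟩ := hclose (ε / 4) (by positivity)
    filter_upwards [hp', eventually_abs_wE_sub_capProj_le U hμ hf hfν hν (C p) (hC p) a hu hu₁
      (by positivity : 0 < ε / 4)] with m h1 h2
    rw [dist_zero_right, Real.norm_eq_abs]
    have h3 : (wE (μ m) fun x => (f m a x - capProj μ f (C (q m)) m a x) * ∏ k ∈ e, u m k x) =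
        (wE (μ m) fun x => (f m a x - capProj μ f (C p) m a x) * ∏ k ∈ e, u m k x) -
        wE (μ m) fun x => (capProj μ f (C (q m)) m a x - capProj μ f (C p) m a x) *
          ∏ k ∈ e, u m k x := by
      rw [← wE_sub]; congr 1; funext x; ring
    rw [h3]
    have h4 := (abs_wE_mul_le (hμ m) (f := fun x => capProj μ f (C (q m)) m a x -
      capProj μ f (C p) m a x) fun x => abs_prod_le_one e fun k _ => hu₁ m k x).trans (h1 a)
    exact (abs_sub _ _).trans_lt (by linarith)
  · obtain ⟨p, hp, hp'⟩ := hclose (τ / 2) (by positivity)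
    have hmem : ∀ (a : L) (b : ι → ℕ) (m : ℕ),
        capAvg (μ m) ((C p).col m) (f m a) b ∈ Set.Icc (0 : ℝ) 1 := fun a b m =>
      ⟨capAvg_nonneg (hμ m) _ (hf m a) _, capAvg_le_one _ _ _⟩
    choose η hη₁ hη using fun (a : L) (b : ι → ℕ) => exists_tendsto_of_mem_Icc U (hmem a b)
    refine ⟨C p, η, fun a b => (hη₁ a b).1, fun a b => (hη₁ a b).2, fun hs b => ?_, ?_⟩
    · exact le_of_tendsto' (tendsto_finsetSum _ fun a _ => hη a b) fun m =>
        sum_capAvg_le (hμ m) _ (hs m) b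
    · have h1 : ∀ᶠ m in (U : Filter ℕ), ∀ a, ∀ b ∈ (C p).atoms,
          |capAvg (μ m) ((C p).col m) (f m a) b - η a b| ≤ τ / 2 := by
        refine eventually_all.2 fun a => (Finset.eventually_all _).2 fun b _ => ?_
        have := (hη a b).eventually (Metric.closedBall_mem_nhds (η a b) (half_pos hτ))
        filter_upwards [this] with m hm
        simpa [Real.dist_eq] using hm
      filter_upwards [hp', h1] with m h2 h3 a
      calc wE (μ m) (fun x => |capProj μ f (C (q m)) m a x - η a ((C p).col m x)|)
          ≤ wE (μ m) (fun x => |capProj μ f (C (q m)) m a x - capProj μ f (C p) m a x| + τ / 2) :=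
            wE_mono (hμ m) fun x => (abs_sub_le _ (capProj μ f (C p) m a x) _).trans
              (add_le_add_right (h3 a _ ((C p).mem_atoms m x)) _)
        _ ≤ τ := by
            rw [wE_add, wE_const (hμ m)]
            linarith [h2 a]

end Projection

section Labels

variable {ι : Type} [Fintype ι] [DecidableEq ι] {V : ℕ → Type} [∀ m, Fintype (V m)]
  {μ : ∀ m, ι → V m → ℝ} {e : Finset ι}

lemma OrthLocal.zero {l : Filter ℕ} : OrthLocal l μ e fun _ _ => 0 := by
  intro u hu hu₁
  simp [wE, tendsto_const_nhds]

lemma OrthLocal.neg {l : Filter ℕ} {s : ∀ m, (ι → V m) → ℝ} (hs : OrthLocal l μ e s) :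
    OrthLocal l μ e fun m x => -s m x := by
  intro u hu hu₁
  simpa only [neg_mul, wE_neg, neg_zero] using (hs u hu hu₁).neg

lemma OrthLocal.sum {l : Filter ℕ} {β : Type*} (S : Finset β) {s : β → ∀ m, (ι → V m) → ℝ}
    (hs : ∀ b ∈ S, OrthLocal l μ e (s b)) : OrthLocal l μ e fun m x => ∑ b ∈ S, s b m x := by
  intro u hu hu₁
  simpa only [Finset.sum_mul, wE_sum, Finset.sum_const_zero] using
    tendsto_finsetSum S fun b hb => hs b hb u hu hu₁

lemma OrthLocal.mul_approx {l : Filter ℕ} (hμ : ∀ m, IsWeight (μ m))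
    {s T : ∀ m, (ι → V m) → ℝ} (hs : OrthLocal l μ e s) (hs₁ : ∀ m x, |s m x| ≤ 1)
    (hT : ∀ τ : ℝ, 0 < τ → ∃ (C : Colouring e V) (φ : (ι → ℕ) → ℝ),
      ∀ᶠ m in l, wE (μ m) (fun x => |T m x - φ (C.col m x)|) ≤ τ) :
    OrthLocal l μ e fun m x => s m x * T m x := by
  intro u hu hu₁
  rw [Metric.tendsto_nhds]
  intro ε hε
  obtain ⟨C, φ, hφ⟩ := hT (ε / 2) (half_pos hε)
  have h1 := hs.mul_comp C φ u hu hu₁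
  filter_upwards [hφ, (Metric.tendsto_nhds.1 h1) (ε / 2) (half_pos hε)] with m h2 h3
  rw [dist_zero_right, Real.norm_eq_abs] at h3 ⊢
  have h4 : (wE (μ m) fun x => s m x * T m x * ∏ k ∈ e, u m k x) =
      (wE (μ m) fun x => (T m x - φ (C.col m x)) * (s m x * ∏ k ∈ e, u m k x)) +
        wE (μ m) fun x => s m x * φ (C.col m x) * ∏ k ∈ e, u m k x := by
    rw [← wE_add]; congr 1; funext x; ring
  rw [h4]
  have h5 := (abs_wE_mul_le (hμ m) (f := fun x => T m x - φ (C.col m x))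
    (φ := fun x => s m x * ∏ k ∈ e, u m k x) fun x => by
      rw [abs_mul]
      exact mul_le_one₀ (hs₁ m x) (abs_nonneg _)
        (abs_prod_le_one e fun k _ => hu₁ m k x)).trans h2
  exact (abs_add_le _ _).trans_lt (by linarith)

/-- The projection of a colouring of `e` onto colourings of the facets of `e`. -/
theorem exists_colour_projection (U : Ultrafilter ℕ) (hU : (U : Filter ℕ) ≤ atTop)
    (hμ : ∀ m, IsWeight (μ m)) {Γ : ℕ} {c : ∀ m, (ι → V m) → ℕ} (hc : ∀ m x, c m x ≤ Γ)
    (hd : ∀ m, DependsOn (c m) e) :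
    ∃ h : ∀ m, ℕ → (ι → V m) → ℝ, (∀ m a, DependsOn (h m a) e) ∧ (∀ m a x, 0 ≤ h m a x) ∧
      (∀ m x, ∑ a ∈ Finset.range (Γ + 1), h m a x = 1) ∧
      (∀ a ≤ Γ, OrthLocal (U : Filter ℕ) μ e fun m x => (if c m x = a then 1 else 0) - h m a x) ∧
      ∀ τ : ℝ, 0 < τ → ∃ (C : Colouring e V) (η : ℕ → (ι → ℕ) → ℝ), (∀ a b, 0 ≤ η a b) ∧
        (∀ b, ∑ a ∈ Finset.range (Γ + 1), η a b = 1) ∧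
        ∀ᶠ m in (U : Filter ℕ), wE (μ m) (fun x =>
          ∑ a ∈ Finset.range (Γ + 1), |h m a x - η a (C.col m x)|) ≤ τ := by
  set f : ∀ m, Fin Γ → (ι → V m) → ℝ := fun m a x => if c m x = a + 1 then 1 else 0 with hf
  have hfs : ∀ m x, ∑ a, f m a x ≤ 1 := fun m x => by
    simp only [hf, Finset.sum_boole]
    have : (Finset.univ.filter fun a : Fin Γ => c m x = a + 1).card ≤ 1 :=
      Finset.card_le_one.2 fun a ha b hb => by
        simp at ha hb; exact Fin.ext (by omega)
    exact_mod_cast this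
  have hf1 : ∀ m a x, f m a x ≤ 1 := fun m a x => by simp only [hf]; split_ifs <;> norm_num
  obtain ⟨h, hdep, h0, h1, hsum, horth, happ⟩ := exists_bounded_projection U hU hμ (f := f)
    (ν := fun _ _ _ => 1) (e := e) (fun m a x => by simp only [hf]; split_ifs <;> norm_num) hf1
    (fun a => by simpa using OrthLocal.zero)
  have hsplit : ∀ F : ℕ → ℝ, ∑ a ∈ Finset.range (Γ + 1), F a = F 0 + ∑ a : Fin Γ, F (a + 1) :=
    fun F => by rw [← Fin.sum_univ_eq_sum_range, Fin.sum_univ_succ]; simp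
  let H : ∀ m, ℕ → (ι → V m) → ℝ := fun m a x =>
    if a = 0 then 1 - ∑ b, h m b x else if ha : a - 1 < Γ then h m ⟨a - 1, ha⟩ x else 0
  have H0 : ∀ m x, H m 0 x = 1 - ∑ b, h m b x := fun m x => by simp [H]
  have HS : ∀ m (a : Fin Γ) x, H m (a + 1) x = h m a x := fun m a x => by simp [H]
  refine ⟨H, fun m a x y hxy => ?_, fun m a x => ?_, fun m x => ?_, fun a ha => ?_, fun τ hτ => ?_⟩
  · have h2 : ∀ b, h m b x = h m b y := fun b => hdep m b hxy
    simp only [H, h2]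
  · simp only [H]
    split_ifs
    · exact sub_nonneg.2 (hsum hfs m x)
    · exact h0 _ _ _
    · exact le_rfl
  · rw [hsplit, H0]
    simp only [HS]
    ring
  · rcases Nat.eq_zero_or_pos a with rfl | hapos
    · have := (OrthLocal.sum Finset.univ fun b _ => horth b).neg
      convert this using 3 with m x
      rw [H0, Finset.sum_sub_distrib]
      have h3 : ∑ b, f m b x = 1 - if c m x = 0 then 1 else 0 := by
        split_ifs with h4
        · simp [hf, h4]
        · obtain ⟨k, hk⟩ := Nat.exists_eq_succ_of_ne_zero h4
          have hk' : k < Γ := by have := hc m x; omega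
          rw [Finset.sum_eq_single (⟨k, hk'⟩ : Fin Γ)]
          · simp [hf, hk]
          · intro b _ hb
            simp only [hf, hk, ite_eq_right_iff]
            intro hb'
            exact (hb (Fin.ext (by simp; omega))).elim
          · simp
      rw [h3]; ring
    · obtain ⟨b, rfl⟩ := Nat.exists_eq_succ_of_ne_zero hapos.ne'
      have := horth ⟨b, ha⟩
      convert this using 3 with m x
      rw [← HS m ⟨b, ha⟩ x]
  · obtain ⟨C, η, hη0, hη1, hηs, hη⟩ := happ (τ / (2 * Γ + 1)) (by positivity)
    refine ⟨C, fun a b => if a = 0 then 1 - ∑ b', η b' b else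
      if ha : a - 1 < Γ then η ⟨a - 1, ha⟩ b else 0, fun a b => ?_, fun b => ?_, ?_⟩
    · dsimp only
      split_ifs
      · exact sub_nonneg.2 (hηs hfs b)
      · exact hη0 _ _
      · exact le_rfl
    · rw [hsplit]
      simp
    · filter_upwards [hη] with m hm
      simp only [hsplit, H0, HS]
      simp only [if_true, Nat.add_eq_zero_iff, one_ne_zero, and_false, if_false,
        Nat.add_sub_cancel, Fin.is_lt, dite_true, Fin.eta]
      calc wE (μ m) (fun x => |1 - ∑ b, h m b x - (1 - ∑ b', η b' (C.col m x))| +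
            ∑ a, |h m a x - η a (C.col m x)|)
          ≤ wE (μ m) (fun x => 2 * ∑ a, |h m a x - η a (C.col m x)|) := wE_mono (hμ m) fun x => by
            have : |1 - ∑ b, h m b x - (1 - ∑ b', η b' (C.col m x))| ≤
                ∑ a, |h m a x - η a (C.col m x)| := by
              rw [sub_sub_sub_cancel_left, ← Finset.sum_sub_distrib]
              refine (Finset.abs_sum_le_sum_abs _ _).trans_eq ?_
              exact Finset.sum_congr rfl fun a _ => abs_sub_comm _ _
            linarith
        _ ≤ 2 * ∑ a : Fin Γ, τ / (2 * Γ + 1) := by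
            rw [wE_const_mul, wE_sum]
            gcongr
            exact hm _
        _ ≤ τ := by
            rw [Finset.sum_const, Finset.card_univ, Fintype.card_fin, nsmul_eq_mul,
              ← mul_div_assoc, ← mul_div_assoc, div_le_iff₀ (by positivity)]
            nlinarith

end Labels

section Marginal

variable {ι : Type} [Fintype ι] [DecidableEq ι] {q : ℕ}

lemma sum_update (g : Finset ι) (F : (Finset ι → Fin q) → ℝ) :
    ∑ i, ∑ a, F (Function.update i g a) = q * ∑ i, F i := by
  let e : (Finset ι → Fin q) × Fin q → (Finset ι → Fin q) × Fin q :=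
    fun p => (Function.update p.1 g p.2, p.1 g)
  have he : Function.Involutive e := fun p => by simp [e]
  rw [← Fintype.sum_prod_type' (f := fun i a => F (Function.update i g a))]
  have := (Equiv.sum_comp he.toPerm fun p : (Finset ι → Fin q) × Fin q => F p.1)
  calc ∑ p : (Finset ι → Fin q) × Fin q, F (Function.update p.1 g p.2)
      = ∑ p : (Finset ι → Fin q) × Fin q, F p.1 := this
    _ = _ := by
      rw [Fintype.sum_prod_type]
      simp [Finset.mul_sum]

/-- Summing out the labels of a family of sets, from the largest to the smallest. -/
lemma sum_mul_prod_eq (hq : 0 < q) (S : Finset (Finset ι))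
    (w : Finset ι → (Finset ι → Fin q) → ℝ)
    (hw : ∀ g ∈ S, ∀ i i' : Finset ι → Fin q, (∀ g' ⊆ g, i g' = i' g') → w g i = w g i')
    (hs : ∀ g ∈ S, ∀ i, ∑ a, w g (Function.update i g a) = 1)
    (Φ : (Finset ι → Fin q) → ℝ) (hΦ : ∀ g ∈ S, ∀ i a, Φ (Function.update i g a) = Φ i) :
    ∑ i, Φ i * ∏ g ∈ S, w g i = (q : ℝ)⁻¹ ^ S.card * ∑ i, Φ i := by
  have hq' : (q : ℝ) ≠ 0 := by exact_mod_cast hq.ne'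
  revert hw hs hΦ
  refine Finset.induction_on_max_value Finset.card S (by simp) fun g S hg hmax ih hw hs hΦ => ?_
  have h1 : ∀ i, ∑ a, Φ (Function.update i g a) * ∏ g' ∈ insert g S,
      w g' (Function.update i g a) = Φ i * ∏ g' ∈ S, w g' i := fun i => by
    have h2 : ∀ a, ∏ g' ∈ insert g S, w g' (Function.update i g a) =
        w g (Function.update i g a) * ∏ g' ∈ S, w g' i := fun a => by
      rw [Finset.prod_insert hg]
      congr 1
      refine Finset.prod_congr rfl fun g' hg' => ?_
      refine hw g' (Finset.mem_insert_of_mem hg') _ _ fun g'' hg'' => ?_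
      refine Function.update_of_ne ?_ _ _
      rintro rfl
      exact hg (Finset.eq_of_subset_of_card_le hg'' (hmax g' hg') ▸ hg')
    simp only [h2, hΦ g (Finset.mem_insert_self _ _), ← Finset.mul_sum, ← Finset.sum_mul,
      hs g (Finset.mem_insert_self _ _), one_mul]
  have h3 := sum_update g fun i => Φ i * ∏ g' ∈ insert g S, w g' i
  simp only [h1] at h3
  rw [ih (fun g hg => hw g (Finset.mem_insert_of_mem hg))
    (fun g hg => hs g (Finset.mem_insert_of_mem hg))
    fun g hg => hΦ g (Finset.mem_insert_of_mem hg)] at h3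
  rw [Finset.card_insert_of_notMem hg, pow_succ]
  field_simp at h3 ⊢
  linarith

end Marginal

section Kernels

variable {ι : Type} [Fintype ι] [DecidableEq ι] {V : ℕ → Type} [∀ m, Fintype (V m)]

/-- A system of random labels for the subsets of `ι`: the label of `g` has `q` possible values, and
its conditional distribution `w m g`, given the labels of the smaller sets and the coordinates in
`g`, differs from the distribution `p g` by a function orthogonal to functions of fewer
coordinates. Only labels of sets with fewer than `s` elements are relevant. -/
structure LabelKernel (l : Filter ℕ) (μ : ∀ m, ι → V m → ℝ) (s q : ℕ)
    (w : ∀ m, Finset ι → (Finset ι → Fin q) → (ι → V m) → ℝ)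
    (p : Finset ι → (Finset ι → Fin q) → ℝ) : Prop where
  dep : ∀ m g i, DependsOn (w m g i) g
  congr : ∀ m g (i i' : Finset ι → Fin q), (∀ g' ⊆ g, i g' = i' g') → w m g i = w m g i'
  pcongr : ∀ g (i i' : Finset ι → Fin q), (∀ g' ⊆ g, i g' = i' g') → p g i = p g i'
  nonneg : ∀ m g i x, 0 ≤ w m g i x
  sum_one : ∀ m g i x, ∑ a, w m g (Function.update i g a) x = 1
  pnonneg : ∀ g i, 0 ≤ p g i
  psum_one : ∀ g i, ∑ a, p g (Function.update i g a) = 1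
  pzero : ∀ g i, p g i = 0 → ∀ m x, w m g i x = 0
  orth : ∀ g i, OrthLocal l μ g fun m x => w m g i x - p g i
  high : ∀ m g i x, s ≤ g.card → w m g i x = (q : ℝ)⁻¹
  phigh : ∀ g i, s ≤ g.card → p g i = (q : ℝ)⁻¹

variable {l : Filter ℕ} {μ : ∀ m, ι → V m → ℝ} {s q : ℕ}
  {w : ∀ m, Finset ι → (Finset ι → Fin q) → (ι → V m) → ℝ}
  {p : Finset ι → (Finset ι → Fin q) → ℝ}

namespace LabelKernel

lemma le_one (h : LabelKernel l μ s q w p) (m : ℕ) (g : Finset ι) (i : Finset ι → Fin q)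
    (x : ι → V m) : w m g i x ≤ 1 := by
  rw [← h.sum_one m g i x]
  have := Finset.single_le_sum (f := fun a => w m g (Function.update i g a) x)
    (fun a _ => h.nonneg m g _ x) (Finset.mem_univ (i g))
  simpa using this

lemma abs_le_one (h : LabelKernel l μ s q w p) (m : ℕ) (g : Finset ι) (i : Finset ι → Fin q)
    (x : ι → V m) : |w m g i x| ≤ 1 := by
  rw [abs_of_nonneg (h.nonneg m g i x)]; exact h.le_one m g i x

lemma sum_mul_prod (h : LabelKernel l μ s q w p) (hq : 0 < q) (m : ℕ) (x : ι → V m)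
    (S : Finset (Finset ι)) (Φ : (Finset ι → Fin q) → ℝ)
    (hΦ : ∀ g ∈ S, ∀ i a, Φ (Function.update i g a) = Φ i) :
    ∑ i, Φ i * ∏ g ∈ S, w m g i x = (q : ℝ)⁻¹ ^ S.card * ∑ i, Φ i :=
  sum_mul_prod_eq hq S (fun g i => w m g i x) (fun g _ i i' hi => by rw [h.congr m g i i' hi])
    (fun g _ i => h.sum_one m g i x) Φ hΦ

lemma sum_prod_eq_one (h : LabelKernel l μ s q w p) (hq : 0 < q) (m : ℕ) (x : ι → V m) :
    ∑ i, ∏ g, w m g i x = 1 := by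
  have := h.sum_mul_prod hq m x Finset.univ (fun _ => 1) (fun _ _ _ _ => rfl)
  simp only [one_mul] at this
  rw [this]
  simp
  field_simp

lemma prod_nonneg (h : LabelKernel l μ s q w p) (m : ℕ) (S : Finset (Finset ι))
    (i : Finset ι → Fin q) (x : ι → V m) : 0 ≤ ∏ g ∈ S, w m g i x :=
  Finset.prod_nonneg fun g _ => h.nonneg m g i x

/-- A label of `e` differs from `c` with expected frequency given by this error. -/
noncomputable def colourError (μ : ∀ m, ι → V m → ℝ)
    (w : ∀ m, Finset ι → (Finset ι → Fin q) → (ι → V m) → ℝ) (m : ℕ) (e : Finset ι)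
    (c : (ι → V m) → ℕ) : ℝ :=
  wE (μ m) fun x => ∑ i, (if (i e : ℕ) = c x then 0 else 1) * ∏ g, w m g i x

/-- If the label of `g` is independent of everything else, it may be altered. -/
lemma uniform (hq : 0 < q) : LabelKernel l μ 0 q
    (fun (m : ℕ) (_ : Finset ι) (_ : Finset ι → Fin q) (_ : ι → V m) => (q : ℝ)⁻¹)
    (fun _ _ => (q : ℝ)⁻¹) where
  dep _ _ _ _ _ _ := rfl
  congr _ _ _ _ _ := rfl
  pcongr _ _ _ _ := rfl
  nonneg _ _ _ _ := by positivity
  sum_one _ _ _ _ := by simp; field_simp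
  pnonneg _ _ := by positivity
  psum_one _ _ := by simp; field_simp
  pzero g i h := by
    have : (0 : ℝ) < q := by exact_mod_cast hq
    exact ((inv_pos.2 this).ne' h).elim
  orth _ _ := by simpa using OrthLocal.zero
  high _ _ _ _ _ := rfl
  phigh _ _ _ := rfl

end LabelKernel

/-- The decoding of the labels of the facets of `e`. -/
noncomputable def decode (enc : (ι → ℕ) → ℕ) (e : Finset ι) (i : Finset ι → Fin q) (k : ι) : ℕ :=
  if k ∈ e then (Function.invFun enc (i (e.erase k))) k else 0

lemma decode_congr (enc : (ι → ℕ) → ℕ) (e : Finset ι) {i i' : Finset ι → Fin q}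
    (h : ∀ g ⊂ e, i g = i' g) : decode enc e i = decode enc e i' := by
  funext k
  unfold decode
  split_ifs with hk
  · rw [h _ (Finset.erase_ssubset hk)]
  · rfl

/-- The joint colours of the facets `insert k f`, for `k ∉ f`. -/
def facetCode (enc : (ι → ℕ) → ℕ) (C : ∀ e : Finset ι, Colouring e V) (m : ℕ) (f : Finset ι)
    (x : ι → V m) : ℕ :=
  enc fun k => if k ∈ f then 0 else (C (insert k f)).col m x k

lemma facetCode_dependsOn (enc : (ι → ℕ) → ℕ) (C : ∀ e : Finset ι, Colouring e V) (m : ℕ)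
    (f : Finset ι) : DependsOn (facetCode enc C m f) f := by
  intro x y h
  unfold facetCode
  congr 1
  funext k
  split_ifs with hk
  · rfl
  · exact (C (insert k f)).dep m k (Finset.mem_insert_self _ _) (by
      rw [Finset.erase_insert hk]; exact h)

lemma exists_facetCode_le (enc : (ι → ℕ) → ℕ) (C : ∀ e : Finset ι, Colouring e V) :
    ∃ Γ, ∀ m f x, facetCode enc C m f x ≤ Γ := by
  set K := ∑ e, (C e).K with hK
  refine ⟨(Fintype.piFinset fun _ : ι => Finset.range (K + 1)).sup enc, fun m f x => ?_⟩
  refine Finset.le_sup (f := enc) (Fintype.mem_piFinset.2 fun k => Finset.mem_range.2 ?_)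
  split_ifs
  · omega
  · have h1 := (C (insert k f)).lt m x k
    have h2 : (C (insert k f)).K ≤ K :=
      Finset.single_le_sum (f := fun e => (C e).K) (fun _ _ => Nat.zero_le _) (Finset.mem_univ _)
    omega

lemma decode_eq {enc : (ι → ℕ) → ℕ} (henc : Function.Injective enc)
    (C : ∀ e : Finset ι, Colouring e V) {m : ℕ} {e : Finset ι} {x : ι → V m}
    {i : Finset ι → Fin q} (h : ∀ k ∈ e, (i (e.erase k) : ℕ) = facetCode enc C m (e.erase k) x) :
    decode enc e i = (C e).col m x := by
  funext k
  unfold decode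
  split_ifs with hk
  · rw [h k hk, facetCode, Function.leftInverse_invFun henc]
    rw [if_neg (Finset.notMem_erase k e), Finset.insert_erase hk]
  · exact ((C e).off m x k hk).symm

lemma sum_fin_eq_sum_range {Γ : ℕ} (h : Γ < q) (F : ℕ → ℝ) (hF : ∀ a, Γ < a → F a = 0) :
    ∑ a : Fin q, F a = ∑ a ∈ Finset.range (Γ + 1), F a := by
  rw [Fin.sum_univ_eq_sum_range]
  refine (Finset.sum_subset (fun a ha => ?_) fun a _ ha => ?_).symm
  · rw [Finset.mem_range] at *; omega
  · exact hF a (by rw [Finset.mem_range] at ha; omega)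

/-- Bounding the discrepancy of decoded tables by the colour errors. -/
lemma wE_table_le (hμ : ∀ m, IsWeight (μ m)) (h : LabelKernel l μ s q w p) (hq : 0 < q)
    {enc : (ι → ℕ) → ℕ} (henc : Function.Injective enc) (C : ∀ e : Finset ι, Colouring e V)
    (m : ℕ) (e : Finset ι) {b : ℝ} (D : (ι → V m) → (ι → ℕ) → ℝ) (hD : ∀ x c, D x c ≤ b)
    (hD₀ : ∀ x c, 0 ≤ D x c) :
    wE (μ m) (fun x => ∑ i, D x (decode enc e i) * ∏ g, w m g i x) ≤
      wE (μ m) (fun x => D x ((C e).col m x)) +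
        b * ∑ k ∈ e, LabelKernel.colourError μ w m (e.erase k)
          (facetCode enc C m (e.erase k)) := by
  unfold LabelKernel.colourError
  rw [← wE_sum, ← wE_const_mul, ← wE_add]
  refine wE_mono (hμ m) fun x => ?_
  have h1 : ∀ i : Finset ι → Fin q, D x (decode enc e i) ≤ D x ((C e).col m x) + b * ∑ k ∈ e,
      if (i (e.erase k) : ℕ) = facetCode enc C m (e.erase k) x then 0 else 1 := fun i => by
    have hb : 0 ≤ b := (hD₀ x 0).trans (hD x 0)
    by_cases hi : ∀ k ∈ e, (i (e.erase k) : ℕ) = facetCode enc C m (e.erase k) x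
    · rw [decode_eq henc C hi]
      exact le_add_of_nonneg_right (mul_nonneg hb
        (Finset.sum_nonneg fun k _ => by split_ifs <;> norm_num))
    · push Not at hi
      obtain ⟨k, hk, hk'⟩ := hi
      have h2 : (1 : ℝ) ≤ ∑ k ∈ e,
          if (i (e.erase k) : ℕ) = facetCode enc C m (e.erase k) x then 0 else 1 := by
        have := Finset.single_le_sum (f := fun k => if (i (e.erase k) : ℕ) =
          facetCode enc C m (e.erase k) x then (0 : ℝ) else 1)
          (fun k _ => by split_ifs <;> norm_num) hk
        simpa [hk'] using this
      calc D x (decode enc e i) ≤ b * 1 := by rw [mul_one]; exact hD x _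
        _ ≤ b * _ := mul_le_mul_of_nonneg_left h2 hb
        _ ≤ _ := le_add_of_nonneg_left (hD₀ x _)
  calc ∑ i, D x (decode enc e i) * ∏ g, w m g i x
      ≤ ∑ i, (D x ((C e).col m x) + b * ∑ k ∈ e,
          if (i (e.erase k) : ℕ) = facetCode enc C m (e.erase k) x then 0 else 1) *
            ∏ g, w m g i x :=
        Finset.sum_le_sum fun i _ => mul_le_mul_of_nonneg_right (h1 i)
          (h.prod_nonneg m _ i x)
    _ = D x ((C e).col m x) * ∑ i, ∏ g, w m g i x + b * ∑ k ∈ e, ∑ i,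
          (if (i (e.erase k) : ℕ) = facetCode enc C m (e.erase k) x then 0 else 1) *
            ∏ g, w m g i x := by
        simp only [add_mul, Finset.sum_add_distrib, ← Finset.mul_sum]
        congr 1
        rw [Finset.sum_comm, Finset.mul_sum]
        exact Finset.sum_congr rfl fun i _ => by rw [← Finset.sum_mul, mul_assoc]
    _ = _ := by rw [h.sum_prod_eq_one hq, mul_one]

end Kernels

section Perturbation

/-- The `ℓ¹` distance of two vectors indexed by `0, …, Γ`. -/
noncomputable def l1Dist (Γ : ℕ) (u v : ℕ → ℝ) : ℝ := ∑ a ∈ Finset.range (Γ + 1), |u a - v a|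

lemma l1Dist_nonneg (Γ : ℕ) (u v : ℕ → ℝ) : 0 ≤ l1Dist Γ u v :=
  Finset.sum_nonneg fun _ _ => abs_nonneg _

lemma abs_l1Dist_sub_le (Γ : ℕ) (u u' v : ℕ → ℝ) :
    |l1Dist Γ u v - l1Dist Γ u' v| ≤ l1Dist Γ u u' := by
  unfold l1Dist
  rw [← Finset.sum_sub_distrib]
  refine (Finset.abs_sum_le_sum_abs _ _).trans (Finset.sum_le_sum fun a _ => ?_)
  refine (abs_abs_sub_abs_le _ _).trans_eq ?_
  congr 1; ring

lemma l1Dist_le_two {Γ : ℕ} {u v : ℕ → ℝ} (hu : ∀ a, 0 ≤ u a) (hv : ∀ a, 0 ≤ v a)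
    (hu₁ : ∑ a ∈ Finset.range (Γ + 1), u a = 1) (hv₁ : ∑ a ∈ Finset.range (Γ + 1), v a = 1) :
    l1Dist Γ u v ≤ 2 := by
  have : l1Dist Γ u v ≤ ∑ a ∈ Finset.range (Γ + 1), (u a + v a) :=
    Finset.sum_le_sum fun a _ => by
      rw [abs_le]; constructor <;> linarith [hu a, hv a]
  rw [Finset.sum_add_distrib, hu₁, hv₁] at this
  linarith

/-- A cutoff which vanishes when `D ≥ ρ`. -/
noncomputable def cutoff (σ ρ D : ℝ) : ℝ := (1 - σ) * max 0 (1 - D / ρ)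

lemma abs_cutoff_sub_le {σ ρ : ℝ} (hσ : 0 ≤ σ) (hσ₁ : σ ≤ 1) (hρ : 0 < ρ) (D D' : ℝ) :
    |cutoff σ ρ D - cutoff σ ρ D'| ≤ |D - D'| / ρ := by
  unfold cutoff
  rw [← mul_sub, abs_mul, abs_of_nonneg (sub_nonneg.2 hσ₁)]
  have h1 : |max 0 (1 - D / ρ) - max 0 (1 - D' / ρ)| ≤ |D - D'| / ρ := by
    have := abs_max_sub_max_le_abs (1 - D / ρ) (1 - D' / ρ) 0
    rw [max_comm 0, max_comm 0]
    refine this.trans_eq ?_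
    rw [show 1 - D / ρ - (1 - D' / ρ) = -((D - D') / ρ) by ring, abs_neg, abs_div, abs_of_pos hρ]
  calc (1 - σ) * _ ≤ 1 * (|D - D'| / ρ) := by gcongr; linarith
    _ = _ := one_mul _

/-- The distribution `η`, smoothed so that all its values are positive. -/
noncomputable def smoothed (Γ : ℕ) (σ : ℝ) (η : ℕ → ℝ) (a : ℕ) : ℝ :=
  if a ≤ Γ then (1 - σ) * η a + σ / (Γ + 1) else 0

/-- A distribution close to the point mass at `c` if `u` and `η` are close. -/
noncomputable def perturbed (Γ : ℕ) (σ : ℝ) (c : ℕ) (u η : ℕ → ℝ) (a : ℕ) : ℝ :=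
  smoothed Γ σ η a + if a ≤ Γ then
    ((if c = a then 1 else 0) - u a) * cutoff σ (σ / (Γ + 1)) (l1Dist Γ u η) else 0

variable {Γ q c : ℕ} {σ : ℝ} {u η : ℕ → ℝ}

lemma smoothed_pos (hσ : 0 < σ) (hσ₁ : σ ≤ 1) (hη : ∀ a, 0 ≤ η a) {a : ℕ} (ha : a ≤ Γ) :
    0 < smoothed Γ σ η a := by
  rw [smoothed, if_pos ha]
  have := mul_nonneg (sub_nonneg.2 hσ₁) (hη a)
  positivity

lemma smoothed_nonneg (hσ : 0 < σ) (hσ₁ : σ ≤ 1) (hη : ∀ a, 0 ≤ η a) (a : ℕ) :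
    0 ≤ smoothed Γ σ η a := by
  by_cases ha : a ≤ Γ
  · exact (smoothed_pos hσ hσ₁ hη ha).le
  · rw [smoothed, if_neg ha]

lemma sum_range_smoothed (hη₁ : ∑ a ∈ Finset.range (Γ + 1), η a = 1) :
    ∑ a ∈ Finset.range (Γ + 1), smoothed Γ σ η a = 1 := by
  have : ∀ a ∈ Finset.range (Γ + 1), smoothed Γ σ η a = (1 - σ) * η a + σ / (Γ + 1) :=
    fun a ha => if_pos (by rw [Finset.mem_range] at ha; omega)
  rw [Finset.sum_congr rfl this, Finset.sum_add_distrib, ← Finset.mul_sum, hη₁]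
  simp
  field_simp
  ring

lemma sum_smoothed (hq : Γ < q) (hη₁ : ∑ a ∈ Finset.range (Γ + 1), η a = 1) :
    ∑ a : Fin q, smoothed Γ σ η a = 1 := by
  rw [sum_fin_eq_sum_range hq (smoothed Γ σ η) fun a ha => if_neg (by omega),
    sum_range_smoothed hη₁]

lemma sum_perturbed (hq : Γ < q) (hc : c ≤ Γ) (hη₁ : ∑ a ∈ Finset.range (Γ + 1), η a = 1)
    (hu₁ : ∑ a ∈ Finset.range (Γ + 1), u a = 1) :
    ∑ a : Fin q, perturbed Γ σ c u η a = 1 := by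
  unfold perturbed
  rw [Finset.sum_add_distrib, sum_smoothed hq hη₁]
  rw [sum_fin_eq_sum_range hq (fun a => if a ≤ Γ then
    ((if c = a then 1 else 0) - u a) * cutoff σ (σ / (Γ + 1)) (l1Dist Γ u η) else 0)
    fun a ha => if_neg (by omega)]
  have : ∀ a ∈ Finset.range (Γ + 1), (if a ≤ Γ then
      ((if c = a then 1 else 0) - u a) * cutoff σ (σ / (Γ + 1)) (l1Dist Γ u η) else 0) =
      ((if c = a then 1 else 0) - u a) * cutoff σ (σ / (Γ + 1)) (l1Dist Γ u η) :=
    fun a ha => if_pos (by rw [Finset.mem_range] at ha; omega)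
  rw [Finset.sum_congr rfl this, ← Finset.sum_mul, Finset.sum_sub_distrib, hu₁,
    Finset.sum_ite_eq, if_pos (by rw [Finset.mem_range]; omega)]
  simp

lemma mul_cutoff_le (hσ : 0 < σ) (hσ₁ : σ ≤ 1) {a : ℕ} (ha : a ≤ Γ) (hη : ∀ a, 0 ≤ η a) :
    u a * cutoff σ (σ / (Γ + 1)) (l1Dist Γ u η) ≤ smoothed Γ σ η a := by
  have hρ : 0 < σ / ((Γ : ℝ) + 1) := by positivity
  set ρ := σ / ((Γ : ℝ) + 1) with hρd
  set D := l1Dist Γ u η with hD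
  have hD0 : 0 ≤ D := l1Dist_nonneg _ _ _
  rw [smoothed, if_pos ha, ← hρd]
  have hη' := mul_nonneg (sub_nonneg.2 hσ₁) (hη a)
  unfold cutoff
  rcases le_total (1 - D / ρ) 0 with h | h
  · rw [max_eq_left h]
    simp only [mul_zero]; linarith
  · rw [max_eq_right h]
    have h1 : |u a - η a| ≤ D := Finset.single_le_sum (f := fun a => |u a - η a|)
      (fun _ _ => abs_nonneg _) (Finset.mem_range.2 (by omega))
    have h2 : u a ≤ η a + D := by linarith [(abs_le.1 h1).2]
    have h3 : D / ρ ≤ 1 := by linarith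
    have h4 : D ≤ ρ := by rwa [div_le_one hρ] at h3
    have h5 : 0 ≤ D / ρ := by positivity
    have h6 : (1 - σ) * (1 - D / ρ) ≤ 1 - σ := mul_le_of_le_one_right (by linarith) (by linarith)
    have h7 : 0 ≤ (1 - σ) * (1 - D / ρ) := mul_nonneg (by linarith) h
    calc u a * ((1 - σ) * (1 - D / ρ)) ≤ (η a + D) * ((1 - σ) * (1 - D / ρ)) := by gcongr
      _ ≤ (η a + D) * (1 - σ) := by gcongr; linarith [hη a]
      _ ≤ _ := by nlinarith

lemma perturbed_nonneg (hσ : 0 < σ) (hσ₁ : σ ≤ 1) (hη : ∀ a, 0 ≤ η a) (a : ℕ) :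
    0 ≤ perturbed Γ σ c u η a := by
  by_cases ha : a ≤ Γ
  · rw [perturbed, if_pos ha, sub_mul]
    have h1 := mul_cutoff_le (u := u) hσ hσ₁ ha hη
    have h2 : 0 ≤ cutoff σ (σ / (Γ + 1)) (l1Dist Γ u η) :=
      mul_nonneg (by linarith) (le_max_left _ _)
    have h3 : 0 ≤ (if c = a then (1 : ℝ) else 0) * cutoff σ (σ / (Γ + 1)) (l1Dist Γ u η) :=
      mul_nonneg (by split_ifs <;> norm_num) h2
    linarith
  · rw [perturbed, if_neg ha, smoothed, if_neg ha, add_zero]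

lemma perturbed_eq_zero (hσ : 0 < σ) (hσ₁ : σ ≤ 1) (hη : ∀ a, 0 ≤ η a) {a : ℕ}
    (h : smoothed Γ σ η a = 0) : perturbed Γ σ c u η a = 0 := by
  have ha : ¬ a ≤ Γ := fun ha => (smoothed_pos hσ hσ₁ hη ha).ne' h
  rw [perturbed, h, if_neg ha, add_zero]

lemma sum_ne_perturbed_le (hq : Γ < q) (hσ : 0 < σ) (hσ₁ : σ ≤ 1) (hη : ∀ a, 0 ≤ η a)
    (hc : c ≤ Γ) (hη₁ : ∑ a ∈ Finset.range (Γ + 1), η a = 1)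
    (hu₁ : ∑ a ∈ Finset.range (Γ + 1), u a = 1) :
    ∑ a : Fin q, (if (a : ℕ) = c then 0 else 1) * perturbed Γ σ c u η a ≤
      σ + l1Dist Γ u η / (σ / (Γ + 1)) := by
  have h1 : ∑ a : Fin q, (if (a : ℕ) = c then 0 else 1) * perturbed Γ σ c u η a =
      1 - perturbed Γ σ c u η c := by
    refine eq_sub_of_add_eq (Eq.trans ?_ (sum_perturbed (σ := σ) hq hc hη₁ hu₁))
    have : perturbed Γ σ c u η c =
        ∑ a : Fin q, if (⟨c, hc.trans_lt hq⟩ : Fin q) = a then perturbed Γ σ c u η a else 0 := by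
      simp
    rw [this, ← Finset.sum_add_distrib]
    refine Finset.sum_congr rfl fun a _ => ?_
    by_cases h : (a : ℕ) = c
    · have : (⟨c, hc.trans_lt hq⟩ : Fin q) = a := Fin.ext h.symm
      simp [h, this]
    · have : ¬ (⟨c, hc.trans_lt hq⟩ : Fin q) = a := fun h' => h (by rw [← h'])
      simp [h, this]
  rw [h1, perturbed, if_pos hc, if_pos rfl, sub_mul, one_mul]
  have h2 := mul_cutoff_le (u := u) hσ hσ₁ hc hη
  have hρ : 0 < σ / ((Γ : ℝ) + 1) := by positivity
  have h3 : 1 - σ - l1Dist Γ u η / (σ / (Γ + 1)) ≤ cutoff σ (σ / (Γ + 1)) (l1Dist Γ u η) := by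
    have h4 : 0 ≤ l1Dist Γ u η / (σ / (Γ + 1)) := div_nonneg (l1Dist_nonneg _ _ _) hρ.le
    have h5 : (1 - σ) * (1 - l1Dist Γ u η / (σ / (Γ + 1))) ≤
      cutoff σ (σ / (Γ + 1)) (l1Dist Γ u η) :=
      mul_le_mul_of_nonneg_left (le_max_right _ _) (by linarith)
    nlinarith
  linarith

end Perturbation

section Step

variable {ι : Type} [Fintype ι] [DecidableEq ι] {V : ℕ → Type} [∀ m, Fintype (V m)]
  {l : Filter ℕ} {μ : ∀ m, ι → V m → ℝ} {s q : ℕ}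
  {w w' : ∀ m, Finset ι → (Finset ι → Fin q) → (ι → V m) → ℝ}
  {p p' : Finset ι → (Finset ι → Fin q) → ℝ}

lemma LabelKernel.colourError_le (hμ : ∀ m, IsWeight (μ m)) (h : LabelKernel l μ s q w p)
    (h' : LabelKernel l μ (s + 1) q w' p') (hq : 0 < q)
    (hww : ∀ m g i x, g.card < s → w' m g i x = w m g i x) {e : Finset ι} (he : e.card = s)
    (m : ℕ) (c : (ι → V m) → ℕ) (Ψ : (ι → V m) → (Finset ι → Fin q) → ℝ)
    (hΨ : ∀ x i, ∑ a : Fin q, (if (a : ℕ) = c x then 0 else 1) *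
      w' m e (Function.update i e a) x ≤ Ψ x i) :
    LabelKernel.colourError μ w' m e c ≤ wE (μ m) fun x => ∑ i, Ψ x i * ∏ g, w m g i x := by
  refine wE_mono (hμ m) fun x => ?_
  set B : Finset (Finset ι) := Finset.univ.filter fun g => g.card < s with hB
  set S : Finset (Finset ι) := (Finset.univ.filter fun g => ¬ g.card < s).erase e with hS
  have heS : e ∈ Finset.univ.filter fun g : Finset ι => ¬ g.card < s := by simp [he]
  have hsplit : ∀ F : Finset ι → ℝ, ∏ g, F g = (∏ g ∈ B, F g) * (F e * ∏ g ∈ S, F g) :=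
    fun F => by
      rw [hS, Finset.mul_prod_erase _ _ heS, hB, Finset.prod_filter_mul_prod_filter_not]
  have hupd : ∀ (v : ∀ m, Finset ι → (Finset ι → Fin q) → (ι → V m) → ℝ)
      (hv : ∀ m g (i i' : Finset ι → Fin q), (∀ g' ⊆ g, i g' = i' g') → v m g i = v m g i')
      (g g' : Finset ι), ¬ g ⊆ g' → ∀ i a, v m g' (Function.update i g a) = v m g' i :=
    fun v hv g g' hg i a => hv m g' _ _ fun g'' hg'' => Function.update_of_ne (by
      rintro rfl; exact hg hg'') _ _
  have hBw : ∀ (g : Finset ι), s ≤ g.card → ∀ i a,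
      ∏ g' ∈ B, w m g' (Function.update i g a) x = ∏ g' ∈ B, w m g' i x := fun g hg i a => by
    refine Finset.prod_congr rfl fun g' hg' => ?_
    rw [hupd w h.congr g g' fun hsub => ?_]
    have h1 := Finset.card_le_card hsub
    have h2 : g'.card < s := by simpa [hB] using hg'
    omega
  set Φ : (Finset ι → Fin q) → ℝ := fun i =>
    (if (i e : ℕ) = c x then 0 else 1) * w' m e i x * ∏ g ∈ B, w m g i x with hΦ
  have h1 : ∑ i, (if (i e : ℕ) = c x then 0 else 1) * ∏ g, w' m g i x =
      (q : ℝ)⁻¹ ^ S.card * ∑ i, Φ i := by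
    rw [← h'.sum_mul_prod hq m x S Φ fun g hg i a => ?_]
    · refine Finset.sum_congr rfl fun i _ => ?_
      have hB' : ∏ g ∈ B, w' m g i x = ∏ g ∈ B, w m g i x :=
        Finset.prod_congr rfl fun g hg => hww m g i x (by simpa [hB] using hg)
      rw [hsplit, hB', hΦ]
      ring
    · have hge : g ≠ e := Finset.ne_of_mem_erase hg
      have hgs : s ≤ g.card := by simpa using Finset.mem_of_mem_erase hg
      simp only [hΦ]
      rw [hBw g hgs, hupd w' h'.congr g e fun hsub =>
        hge (Finset.eq_of_subset_of_card_le hsub (by omega)), Function.update_of_ne hge.symm]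
  have h2 : q * ∑ i, Φ i ≤ ∑ i, Ψ x i * ∏ g ∈ B, w m g i x := by
    rw [← sum_update e Φ]
    refine Finset.sum_le_sum fun i _ => ?_
    simp only [hΦ, hBw e he.ge, ← Finset.sum_mul, Function.update_self]
    exact mul_le_mul_of_nonneg_right (hΨ x i) (h.prod_nonneg m B i x)
  have h3 : ∑ i, Ψ x i * ∏ g, w m g i x =
      (q : ℝ)⁻¹ ^ (S.card + 1) * ∑ i, Ψ x i * ∏ g ∈ B, w m g i x := by
    rw [Finset.mul_sum]
    refine Finset.sum_congr rfl fun i _ => ?_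
    have hS' : ∏ g ∈ S, w m g i x = (q : ℝ)⁻¹ ^ S.card := by
      rw [Finset.prod_congr rfl fun g hg => h.high m g i x (by
        simpa using Finset.mem_of_mem_erase hg), Finset.prod_const]
    rw [hsplit, h.high m e i x he.ge, hS']
    ring
  rw [h1, h3, pow_succ, mul_assoc]
  have hq' : (0 : ℝ) < q := by exact_mod_cast hq
  gcongr
  rw [inv_mul_eq_div, le_div_iff₀ hq', mul_comm]
  exact h2

end Step

section Extension

variable {ι : Type} [Fintype ι] [DecidableEq ι] {V : ℕ → Type} [∀ m, Fintype (V m)]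
  {μ : ∀ m, ι → V m → ℝ} {s q : ℕ}
  {w : ∀ m, Finset ι → (Finset ι → Fin q) → (ι → V m) → ℝ}
  {p : Finset ι → (Finset ι → Fin q) → ℝ}

lemma LabelKernel.extend {l : Filter ℕ} (hμ : ∀ m, IsWeight (μ m))
    (h : LabelKernel l μ s q w p) {Γ : ℕ} (hq : Γ < q) {σ : ℝ} (hσ : 0 < σ) (hσ₁ : σ ≤ 1)
    (enc : (ι → ℕ) → ℕ) {c : ∀ m, Finset ι → (ι → V m) → ℕ} (hc : ∀ m e x, c m e x ≤ Γ)
    (hd : ∀ m e, DependsOn (c m e) e) {u : ∀ m, Finset ι → ℕ → (ι → V m) → ℝ}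
    (hud : ∀ m e a, DependsOn (u m e a) e) (hu : ∀ m e a x, 0 ≤ u m e a x)
    (hu₁ : ∀ m e x, ∑ a ∈ Finset.range (Γ + 1), u m e a x = 1)
    (horth : ∀ e, ∀ a ≤ Γ, OrthLocal l μ e fun m x => (if c m e x = a then 1 else 0) - u m e a x)
    (happ : ∀ e, ∀ τ : ℝ, 0 < τ → ∃ (C : Colouring e V) (η : ℕ → (ι → ℕ) → ℝ),
      ∀ᶠ m in l, wE (μ m) (fun x =>
        l1Dist Γ (fun a => u m e a x) (fun a => η a (C.col m x))) ≤ τ)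
    {η : Finset ι → ℕ → (ι → ℕ) → ℝ} (hη : ∀ e a b, 0 ≤ η e a b)
    (hη₁ : ∀ e b, ∑ a ∈ Finset.range (Γ + 1), η e a b = 1) :
    LabelKernel l μ (s + 1) q
      (fun m g i x => if g.card = s then perturbed Γ σ (c m g x) (fun a => u m g a x)
        (fun a => η g a (decode enc g i)) (i g) else w m g i x)
      (fun g i => if g.card = s then smoothed Γ σ (fun a => η g a (decode enc g i)) (i g)
        else p g i) where
  dep m g i := by
    by_cases hg : g.card = s
    · simp only [hg, if_true]
      intro x y hxy
      simp only [hd m g hxy, fun a => hud m g a hxy]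
    · simp only [hg, if_false]; exact h.dep m g i
  congr m g i i' hi := by
    by_cases hg : g.card = s
    · simp only [hg, if_true]
      rw [decode_congr enc g fun g' hg' => hi g' hg'.1, hi g subset_rfl]
    · simp only [hg, if_false]; exact h.congr m g i i' hi
  pcongr g i i' hi := by
    by_cases hg : g.card = s
    · simp only [hg, if_true]
      rw [decode_congr enc g fun g' hg' => hi g' hg'.1, hi g subset_rfl]
    · simp only [hg, if_false]; exact h.pcongr g i i' hi
  nonneg m g i x := by
    by_cases hg : g.card = s
    · simp only [hg, if_true]; exact perturbed_nonneg hσ hσ₁ (fun a => hη g a _) _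
    · simp only [hg, if_false]; exact h.nonneg m g i x
  sum_one m g i x := by
    by_cases hg : g.card = s
    · simp only [hg, if_true, Function.update_self]
      have : ∀ a : Fin q, decode enc g (Function.update i g a) = decode enc g i := fun a =>
        decode_congr enc g fun g' hg' => Function.update_of_ne hg'.ne _ _
      simp only [this]
      exact sum_perturbed hq (hc m g x) (hη₁ g _) (hu₁ m g x)
    · simp only [hg, if_false]; exact h.sum_one m g i x
  pnonneg g i := by
    by_cases hg : g.card = s
    · simp only [hg, if_true]; exact smoothed_nonneg hσ hσ₁ (fun a => hη g a _) _
    · simp only [hg, if_false]; exact h.pnonneg g i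
  psum_one g i := by
    by_cases hg : g.card = s
    · simp only [hg, if_true, Function.update_self]
      have : ∀ a : Fin q, decode enc g (Function.update i g a) = decode enc g i := fun a =>
        decode_congr enc g fun g' hg' => Function.update_of_ne hg'.ne _ _
      simp only [this]
      exact sum_smoothed hq (hη₁ g _)
    · simp only [hg, if_false]; exact h.psum_one g i
  pzero g i h0 m x := by
    by_cases hg : g.card = s
    · simp only [hg, if_true] at h0 ⊢
      exact perturbed_eq_zero hσ hσ₁ (fun a => hη g a _) h0
    · simp only [hg, if_false] at h0 ⊢; exact h.pzero g i h0 m x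
  orth g i := by
    by_cases hg : g.card = s
    · simp only [hg, if_true]
      by_cases ha : (i g : ℕ) ≤ Γ
      · simp only [perturbed, ha, if_true, add_sub_cancel_left]
        refine OrthLocal.mul_approx hμ (horth g _ ha) (fun m x => ?_) fun τ hτ => ?_
        · have h1 : u m g (i g) x ≤ 1 := by
            rw [← hu₁ m g x]
            exact Finset.single_le_sum (f := fun a => u m g a x) (fun a _ => hu m g a x)
              (Finset.mem_range.2 (by omega))
          have h0 := hu m g (i g) x
          rw [abs_le]
          split_ifs <;> constructor <;> linarith
        · have hρ : 0 < σ / ((Γ : ℝ) + 1) := by positivity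
          obtain ⟨C, η', hη'⟩ := happ g (τ * (σ / ((Γ : ℝ) + 1))) (mul_pos hτ hρ)
          refine ⟨C, fun b => cutoff σ (σ / (Γ + 1)) (l1Dist Γ (fun a => η' a b)
            (fun a => η g a (decode enc g i))), ?_⟩
          filter_upwards [hη'] with m hm
          calc _ ≤ wE (μ m) (fun x => (σ / ((Γ : ℝ) + 1))⁻¹ *
                l1Dist Γ (fun a => u m g a x) (fun a => η' a (C.col m x))) := by
                refine wE_mono (hμ m) fun x => ?_
                refine (abs_cutoff_sub_le hσ.le hσ₁ hρ _ _).trans ?_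
                rw [inv_mul_eq_div]
                exact div_le_div_of_nonneg_right (abs_l1Dist_sub_le _ _ _ _) hρ.le
            _ ≤ (σ / ((Γ : ℝ) + 1))⁻¹ * (τ * (σ / ((Γ : ℝ) + 1))) := by
                rw [wE_const_mul]
                exact mul_le_mul_of_nonneg_left hm (inv_nonneg.2 hρ.le)
            _ = τ := by field_simp
      · simp only [perturbed, ha, if_false, add_zero, sub_self]; exact OrthLocal.zero
    · simp only [hg, if_false]; exact h.orth g i
  high m g i x hs := by
    rw [if_neg (by omega)]; exact h.high m g i x (by omega)
  phigh g i hs := by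
    rw [if_neg (by omega)]; exact h.phigh g i (by omega)

/-- Colours of the sets with `s - 1` elements can be simulated by random labels. -/
theorem exists_labelKernel (U : Ultrafilter ℕ) (hU : (U : Filter ℕ) ≤ atTop)
    (hμ : ∀ m, IsWeight (μ m)) (s : ℕ) :
    ∀ (c : ∀ m, Finset ι → (ι → V m) → ℕ) (Γ : ℕ), (∀ m e x, c m e x ≤ Γ) →
      (∀ m e, DependsOn (c m e) e) → ∀ θ : ℝ, 0 < θ → ∀ Q : ℕ,
      ∃ (q : ℕ) (w : ∀ m, Finset ι → (Finset ι → Fin q) → (ι → V m) → ℝ)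
        (p : Finset ι → (Finset ι → Fin q) → ℝ), Q ≤ q ∧ Γ < q ∧
        LabelKernel (U : Filter ℕ) μ s q w p ∧ ∀ e : Finset ι, e.card + 1 = s →
          ∀ᶠ m in (U : Filter ℕ), LabelKernel.colourError μ w m e (c m e) ≤ θ := by
  induction s with
  | zero =>
    intro c Γ hc hd θ hθ Q
    exact ⟨max Q (Γ + 1), _, _, le_max_left _ _, Nat.lt_of_succ_le (le_max_right _ _),
      LabelKernel.uniform (lt_max_of_lt_right (Nat.succ_pos Γ)), fun e he => by omega⟩
  | succ s ih =>
    intro c Γ hc hd θ hθ Q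
    obtain ⟨enc, henc⟩ := exists_injective_nat (ι → ℕ)
    set σ : ℝ := min (θ / 3) 1 with hσd
    have hσ : 0 < σ := lt_min (by positivity) one_pos
    have hσ₁ : σ ≤ 1 := min_le_right _ _
    have hσθ : σ ≤ θ / 3 := min_le_left _ _
    set ρ : ℝ := σ / ((Γ : ℝ) + 1) with hρd
    have hρ : 0 < ρ := by positivity
    choose u hud hu hu₁ horth happ using fun e : Finset ι =>
      exists_colour_projection (e := e) U hU hμ (fun m x => hc m e x) (fun m => hd m e)
    choose C η hη hη₁ hCη using fun e => happ e (ρ * θ / 3) (by positivity)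
    obtain ⟨Γ', hΓ'⟩ := exists_facetCode_le enc C
    set θ' : ℝ := ρ * θ / (6 * (Fintype.card ι + 1)) with hθ'
    obtain ⟨q, w, p, hQ, hΓq, hk, herr⟩ := ih (facetCode enc C) Γ' hΓ'
      (fun m e => facetCode_dependsOn enc C m e) θ' (by positivity) (max Q (Γ + 1))
    have hq : Γ < q := (le_max_right Q (Γ + 1)).trans hQ
    have hq0 : 0 < q := by omega
    have hk' := hk.extend hμ hq hσ hσ₁ enc hc hd (u := fun m e => u e m)
      (fun m e a => hud e m a) (fun m e a x => hu e m a x) (fun m e x => hu₁ e m x) horth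
      (fun e τ hτ => by
        obtain ⟨C', η', _, _, h3⟩ := happ e τ hτ
        exact ⟨C', η', h3⟩) hη hη₁
    refine ⟨q, _, _, (le_max_left _ _).trans hQ, hq, hk', fun e he => ?_⟩
    have hes : e.card = s := by omega
    have hfac : ∀ᶠ m in (U : Filter ℕ), ∀ k ∈ e, LabelKernel.colourError μ w m (e.erase k)
        (facetCode enc C m (e.erase k)) ≤ θ' :=
      (Finset.eventually_all e).2 fun k hk => herr _ (by
        rw [Finset.card_erase_of_mem hk, hes]
        have : 0 < e.card := Finset.card_pos.2 ⟨k, hk⟩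
        omega)
    filter_upwards [hfac, hCη e] with m hm1 hm2
    set D : (ι → V m) → (ι → ℕ) → ℝ := fun x b =>
      l1Dist Γ (fun a => u e m a x) (fun a => η e a b) with hDd
    have h1 := LabelKernel.colourError_le hμ hk hk' hq0
      (fun m g i x hg => if_neg (by omega)) hes m (c m e)
      (fun x i => σ + D x (decode enc e i) / ρ) (fun x i => by
        have : ∀ a : Fin q, decode enc e (Function.update i e a) = decode enc e i := fun a =>
          decode_congr enc e fun g' hg' => Function.update_of_ne hg'.ne _ _
        simp only [hes, if_true, Function.update_self, this]
        exact sum_ne_perturbed_le hq hσ hσ₁ (fun a => hη e a _) (hc m e x) (hη₁ e _)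
          (hu₁ e m x))
    refine h1.trans ?_
    have h2 := wE_table_le hμ hk hq0 henc C m e D (b := 2)
      (fun x b => l1Dist_le_two (fun a => hu e m a x) (fun a => hη e a b) (hu₁ e m x) (hη₁ e b))
      (fun x b => l1Dist_nonneg _ _ _)
    have h3 : wE (μ m) (fun x => D x ((C e).col m x)) ≤ ρ * θ / 3 := hm2
    have h4 : ∑ k ∈ e, LabelKernel.colourError μ w m (e.erase k)
        (facetCode enc C m (e.erase k)) ≤ (Fintype.card ι + 1) * θ' := by
      calc _ ≤ ∑ k ∈ e, θ' := Finset.sum_le_sum fun k hk => hm1 k hk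
        _ = e.card * θ' := by rw [Finset.sum_const, nsmul_eq_mul]
        _ ≤ _ := by
          have : (e.card : ℝ) ≤ Fintype.card ι := by exact_mod_cast Finset.card_le_univ e
          have : 0 < θ' := by positivity
          nlinarith
    have h5 : ((Fintype.card ι : ℝ) + 1) * θ' = ρ * θ / 6 := by
      rw [hθ']; field_simp
    have h6 : wE (μ m) (fun x => ∑ i, (σ + D x (decode enc e i) / ρ) * ∏ g, w m g i x) =
        σ + ρ⁻¹ * wE (μ m) (fun x => ∑ i, D x (decode enc e i) * ∏ g, w m g i x) := by
      rw [← wE_const_mul, ← wE_const (hμ m) σ, ← wE_add]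
      congr 1
      funext x
      rw [wE_const (hμ m) σ]
      simp only [add_mul, Finset.sum_add_distrib, ← Finset.mul_sum, hk.sum_prod_eq_one hq0 m x,
        mul_one, div_mul_eq_mul_div, ← Finset.sum_div]
      rw [inv_mul_eq_div]
    rw [h6]
    have h7 : wE (μ m) (fun x => ∑ i, D x (decode enc e i) * ∏ g, w m g i x) ≤
        ρ * (2 * θ / 3) := by linarith
    have h8 : ρ⁻¹ * wE (μ m) (fun x => ∑ i, D x (decode enc e i) * ∏ g, w m g i x) ≤
        2 * θ / 3 := by
      rw [inv_mul_le_iff₀ hρ]; exact h7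
    linarith

end Extension

section Global

variable {ι : Type} [Fintype ι] [DecidableEq ι] {V : ℕ → Type} [∀ m, Fintype (V m)]
  {μ : ∀ m, ι → V m → ℝ} {l : Filter ℕ}

lemma DependsOn.prod' {X κ : Type} (T : Finset κ) {s : Set ι} {F : κ → (ι → X) → ℝ}
    (hF : ∀ k ∈ T, DependsOn (F k) s) : DependsOn (fun x => ∏ k ∈ T, F k x) s :=
  fun _ _ h => Finset.prod_congr rfl fun k hk => hF k hk h

/-- Local orthogonality implies orthogonality to functions which miss a coordinate of `e`. -/
lemma OrthLocal.tendsto_global (hμ : ∀ m, IsWeight (μ m)) {e : Finset ι}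
    {s : ∀ m, (ι → V m) → ℝ} (hs : OrthLocal l μ e s) (hd : ∀ m, DependsOn (s m) e)
    {κ : Type} (T : Finset κ) (a : κ → ι) (ha : ∀ k ∈ T, a k ∈ e)
    (u : ∀ m, κ → (ι → V m) → ℝ) (hu : ∀ m, ∀ k ∈ T, DependsOn (u m k) {a k}ᶜ)
    (hu₁ : ∀ m k x, |u m k x| ≤ 1) :
    Tendsto (fun m => wE (μ m) fun x => s m x * ∏ k ∈ T, u m k x) l (𝓝 0) := by
  have h1 : ∀ m, ∃ y : ι → V m, |wE (μ m) fun x => s m x * ∏ k ∈ T, u m k x| ≤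
      |wE (μ m) fun x => s m (e.piecewise x y) * ∏ k ∈ T, u m k (e.piecewise x y)| := fun m => by
    obtain ⟨y, hy⟩ := exists_wE_le (hμ m)
      (fun y => |wE (μ m) fun x => s m (e.piecewise x y) * ∏ k ∈ T, u m k (e.piecewise x y)|)
    refine ⟨y, le_trans ?_ hy⟩
    rw [← wE_piecewise (hμ m) e]
    exact abs_wE_le (hμ m) _
  choose y hy using h1
  refine squeeze_zero_norm hy ?_
  have hfib : ∀ m x, ∏ k ∈ T, u m k (e.piecewise x (y m)) =
      ∏ j ∈ e, ∏ k ∈ T with a k = j, u m k (e.piecewise x (y m)) := fun m x =>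
    (Finset.prod_fiberwise_of_maps_to ha _).symm
  have h2 := hs (fun m j x => ∏ k ∈ T with a k = j, u m k (e.piecewise x (y m)))
    (fun m j hj => DependsOn.prod' _ fun k hk x x' hx => by
      rw [Finset.mem_filter] at hk
      refine hu m k hk.1 fun i hi => ?_
      rw [hk.2] at hi
      by_cases hie : i ∈ e
      · simp only [Finset.piecewise_eq_of_mem _ _ _ hie]
        exact hx i (by simpa [hie] using hi)
      · simp only [Finset.piecewise_eq_of_notMem _ _ _ hie])
    (fun m j x => abs_prod_le_one _ fun k _ => hu₁ m k _)
  have h3 := h2.abs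
  rw [abs_zero] at h3
  refine h3.congr fun m => ?_
  congr 2
  funext x
  have h4 : s m (e.piecewise x (y m)) = s m x :=
    hd m fun i hi => Finset.piecewise_eq_of_mem _ _ _ hi
  rw [hfib, h4]

/-- In a bounded product one may replace the label distributions by their limits, as long as the
remaining factors do not see all the coordinates of the corresponding sets. -/
lemma LabelKernel.tendsto_replace [Nonempty ι] (hμ : ∀ m, IsWeight (μ m)) {s q : ℕ}
    {w : ∀ m, Finset ι → (Finset ι → Fin q) → (ι → V m) → ℝ}
    {p : Finset ι → (Finset ι → Fin q) → ℝ} (h : LabelKernel l μ s q w p)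
    (i : Finset ι → Fin q) {κ : Type} (T : Finset κ) (A : κ → Finset ι)
    (u : ∀ m, κ → (ι → V m) → ℝ) (hu : ∀ m, ∀ k ∈ T, DependsOn (u m k) (A k))
    (hu₁ : ∀ m k x, |u m k x| ≤ 1) (S : Finset (Finset ι)) (hS : ∀ g ∈ S, ∀ k ∈ T, ¬ g ⊆ A k) :
    Tendsto (fun m => (wE (μ m) fun x => (∏ k ∈ T, u m k x) * ∏ g ∈ S, w m g i x) -
      (wE (μ m) fun x => ∏ k ∈ T, u m k x) * ∏ g ∈ S, p g i) l (𝓝 0) := by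
  revert hS
  refine Finset.induction_on_max_value Finset.card S (fun _ => by simp [tendsto_const_nhds]) ?_
  intro g S hgS hmax ih hS
  have hgT : ∀ k ∈ T, ∃ j ∈ g, j ∉ A k := fun k hk =>
    Finset.not_subset.1 (hS g (Finset.mem_insert_self _ _) k hk)
  have hgg : ∀ g' ∈ S, ∃ j ∈ g, j ∉ g' := fun g' hg' => Finset.not_subset.1 fun hsub => by
    have := Finset.eq_of_subset_of_card_le hsub (hmax g' hg')
    exact hgS (this ▸ hg')
  choose! a ha ha' using hgT
  choose! b hb hb' using hgg
  have h1 := (h.orth g i).tendsto_global hμ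
    (fun m x y hxy => by simp only [h.dep m g i hxy]) (T.disjSum S) (Sum.elim a b)
    (fun k hk => by
      rcases k with k | g'
      · exact ha k (by simpa using hk)
      · exact hb g' (by simpa using hk))
    (fun m k x => Sum.elim (fun k => u m k x) (fun g' => w m g' i x) k)
    (fun m k hk => by
      rcases k with k | g'
      · have hk' : k ∈ T := by simpa using hk
        exact (hu m k hk').mono fun j hj hj' => ha' k hk' (by
          rw [Set.mem_singleton_iff] at hj'
          rw [← Sum.elim_inl a b, ← hj']; exact hj)
      · have hk' : g' ∈ S := by simpa using hk
        exact (h.dep m g' i).mono fun j hj hj' => hb' g' hk' (by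
          rw [Set.mem_singleton_iff] at hj'
          rw [← Sum.elim_inr a b, ← hj']; exact hj))
    (fun m k x => by
      rcases k with k | g'
      · exact hu₁ m k x
      · exact h.abs_le_one m g' i x)
  have h2 := (ih fun g' hg' => hS g' (Finset.mem_insert_of_mem hg')).mul_const (p g i)
  rw [zero_mul] at h2
  have h3 := h1.add h2
  rw [add_zero] at h3
  refine h3.congr fun m => ?_
  rw [Finset.prod_insert hgS, sub_mul, ← wE_mul_const, add_sub_assoc', ← wE_add]
  congr 1
  · congr 1
    funext x
    rw [Finset.prod_disjSum, Finset.prod_insert hgS]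
    simp only [Sum.elim_inl, Sum.elim_inr]
    ring
  · ring

lemma LinearForms.orthLocal {ν : ∀ m, ι → (ι → V m) → ℝ} (hμ : ∀ m, IsWeight (μ m))
    (hν : LinearForms l μ ν) (hd : ∀ m i, DependsOn (ν m i) {i}ᶜ) (hν₀ : ∀ m i x, 0 ≤ ν m i x)
    (j : ι) : OrthLocal l μ (Finset.univ.erase j) fun m x => ν m j x - 1 := by
  intro u hu hu₁
  have h1 := tendsto_weight_sub_one_mul hμ hν hd j
    (fun m k => if k = j then fun _ => 1 else u m k) (fun _ _ _ => 1)
    (fun m k => by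
      split_ifs with hk
      · exact fun _ _ _ => rfl
      · exact (hu m k (by simpa using hk)).mono fun i hi => by
          simp at hi; simpa using hi.2)
    (fun _ _ _ _ _ => rfl)
    (fun m k x => by
      split_ifs with hk
      · simp [hν₀]
      · linarith [hu₁ m k x, hν₀ m k x])
    (fun m k x => by simp [hν₀])
  refine h1.congr fun m => ?_
  simp only [Finset.prod_const_one, mul_one, wE_const (hμ m)]
  congr 1
  funext x
  congr 1
  exact Finset.prod_congr rfl fun k hk => by rw [if_neg (Finset.ne_of_mem_erase hk)]

end Global

section Transference

variable {ι : Type} [Fintype ι] [DecidableEq ι] {V : ℕ → Type} [∀ m, Fintype (V m)]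
  {μ : ∀ m, ι → V m → ℝ} {l : Filter ℕ} {ν : ∀ m, ι → (ι → V m) → ℝ}

/-- If the functions `f j` have vanishing product, so do their bounded projections `h j`, also in
the presence of factors of few coordinates. -/
lemma tendsto_bounded_count (hμ : ∀ m, IsWeight (μ m)) (hν : LinearForms l μ ν)
    (hd : ∀ m i, DependsOn (ν m i) {i}ᶜ) (hν₀ : ∀ m i x, 0 ≤ ν m i x)
    {f h : ∀ m, ι → (ι → V m) → ℝ} (hfd : ∀ m i, DependsOn (f m i) {i}ᶜ)
    (hf : ∀ m i x, 0 ≤ f m i x) (hfν : ∀ m i x, f m i x ≤ ν m i x)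
    (hhd : ∀ m i, DependsOn (h m i) {i}ᶜ) (hh : ∀ m i x, 0 ≤ h m i x) (hh₁ : ∀ m i x, h m i x ≤ 1)
    (horth : ∀ i, OrthLocal l μ (Finset.univ.erase i) fun m x => f m i x - h m i x)
    (S : Finset (Finset ι)) (hS : ∀ g ∈ S, g.card + 1 < Fintype.card ι)
    (w : ∀ m, Finset ι → (ι → V m) → ℝ) (hwd : ∀ m g, DependsOn (w m g) g)
    (hw : ∀ m g x, 0 ≤ w m g x) (hw₁ : ∀ m g x, w m g x ≤ 1)
    (hE : Tendsto (fun m => wE (μ m) fun x => ∏ i, f m i x) l (𝓝 0)) :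
    Tendsto (fun m => wE (μ m) fun x => (∏ i, h m i x) * ∏ g ∈ S, w m g x) l (𝓝 0) := by
  have key : ∀ T : Finset ι, Tendsto (fun m => wE (μ m) fun x =>
      (∏ i, if i ∈ T then h m i x else f m i x) * ∏ g ∈ S, w m g x) l (𝓝 0) := by
    intro T
    induction T using Finset.induction_on with
    | empty =>
      refine squeeze_zero (fun m => wE_nonneg (hμ m) fun x => mul_nonneg
        (Finset.prod_nonneg fun i _ => by simpa using hf m i x)
        (Finset.prod_nonneg fun g _ => hw m g x)) (fun m => wE_mono (hμ m) fun x => ?_) hE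
      simp only [Finset.notMem_empty, if_false]
      exact mul_le_of_le_one_right (Finset.prod_nonneg fun i _ => hf m i x)
        (Finset.prod_le_one (fun g _ => hw m g x) fun g _ => hw₁ m g x)
    | insert j₀ T hj₀ ih =>
      have hmiss : ∀ g ∈ S, ∃ k, k ∉ insert j₀ g := fun g hg => by
        by_contra! hall
        have h1 := Finset.card_insert_le j₀ g
        rw [Finset.eq_univ_of_forall hall, Finset.card_univ] at h1
        have := hS g hg
        omega
      have : Nonempty ι := ⟨j₀⟩
      choose! a ha using hmiss
      set c : ∀ m, ι → (ι → V m) → ℝ := fun m i x => if i ∈ T then h m i x else f m i x with hc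
      have hcd : ∀ m i, DependsOn (c m i) {i}ᶜ := fun m i x y hxy => by
        simp only [hc, hhd m i hxy, hfd m i hxy]
      have hc0 : ∀ m i x, 0 ≤ c m i x := fun m i x => by
        simp only [hc]; split_ifs; exacts [hh m i x, hf m i x]
      have hcν : ∀ m i x, c m i x ≤ ν m i x + 1 := fun m i x => by
        simp only [hc]; split_ifs
        · linarith [hh₁ m i x, hν₀ m i x]
        · linarith [hfν m i x]
      have hw01 : ∀ m i x, 0 ≤ ∏ g ∈ S with a g = i, w m g x ∧
          ∏ g ∈ S with a g = i, w m g x ≤ 1 := fun m i x =>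
        ⟨Finset.prod_nonneg fun g _ => hw m g x,
          Finset.prod_le_one (fun g _ => hw m g x) fun g _ => hw₁ m g x⟩
      have h1 := relative_counting hμ hν hd hν₀ j₀ (fun m x => f m j₀ x - h m j₀ x)
        (fun u hu hu₁ => (horth j₀).tendsto_global hμ (fun m x y hxy => by
          have hxy' : ∀ i ∈ ({j₀}ᶜ : Set ι), x i = y i := fun i hi => hxy i (by
            simpa using hi)
          simp only [hfd m j₀ hxy', hhd m j₀ hxy']) _ id (fun k hk => hk) u
          (fun m k _ => hu m k) hu₁) Finset.univ
        (fun m i x => if i = j₀ then f m j₀ x - h m j₀ x else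
          c m i x * ∏ g ∈ S with a g = i, w m g x)
        (fun m i x y hxy => by
          by_cases hi : i = j₀
          · subst hi; simp only [if_true, hfd m i hxy, hhd m i hxy]
          · simp only [hi, if_false, hcd m i hxy]
            congr 1
            refine Finset.prod_congr rfl fun g hg => ?_
            rw [Finset.mem_filter] at hg
            refine hwd m g fun k hk => hxy k fun hki => ?_
            rw [Set.mem_singleton_iff] at hki
            refine ha g hg.1 (Finset.mem_insert_of_mem ?_)
            rw [hg.2, ← hki]; exact hk)
        (fun m => by simp) (fun m i x => by
          by_cases hi : i = j₀
          · subst hi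
            simp only [if_true]
            rw [abs_le]
            constructor <;> linarith [hf m i x, hh m i x, hh₁ m i x, hfν m i x, hν₀ m i x]
          · simp only [hi, if_false]
            rw [abs_of_nonneg (mul_nonneg (hc0 m i x) (hw01 m i x).1)]
            exact (mul_le_of_le_one_right (hc0 m i x) (hw01 m i x).2).trans (hcν m i x))
        (fun m i x _ hi => (hi (Finset.mem_univ i)).elim)
      have h2 := ih.sub h1
      rw [sub_zero] at h2
      refine h2.congr fun m => ?_
      rw [sub_eq_add_neg, ← wE_neg, ← wE_add]
      congr 1
      funext x
      rw [← Finset.mul_prod_erase _ _ (Finset.mem_univ j₀),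
        ← Finset.mul_prod_erase _ (fun i => if i = j₀ then _ else _) (Finset.mem_univ j₀),
        ← Finset.mul_prod_erase _ (fun i => if i ∈ insert j₀ T then _ else _)
          (Finset.mem_univ j₀)]
      have e1 : ∏ i ∈ Finset.univ.erase j₀, (if i = j₀ then f m j₀ x - h m j₀ x else
          c m i x * ∏ g ∈ S with a g = i, w m g x) =
          (∏ i ∈ Finset.univ.erase j₀, c m i x) * ∏ g ∈ S, w m g x := by
        rw [← Finset.prod_fiberwise_of_maps_to (s := S) (t := Finset.univ.erase j₀) (g := a)
          (fun g hg => Finset.mem_erase.2 ⟨fun hag => ha g hg (by rw [hag]; simp), by simp⟩),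
          ← Finset.prod_mul_distrib]
        exact Finset.prod_congr rfl fun i hi => by rw [if_neg (Finset.ne_of_mem_erase hi)]
      have e2 : ∏ i ∈ Finset.univ.erase j₀, (if i ∈ insert j₀ T then h m i x else f m i x) =
          ∏ i ∈ Finset.univ.erase j₀, c m i x :=
        Finset.prod_congr rfl fun i hi => by
          simp only [hc, Finset.mem_insert, Finset.ne_of_mem_erase hi, false_or]
      rw [e1, e2]
      simp only [if_true, hj₀, if_false, Finset.mem_insert_self, hc]
      ring
  simpa using key Finset.univ

end Transference

section Cover

variable {ι : Type} [Fintype ι] [DecidableEq ι] {V : ℕ → Type} [∀ m, Fintype (V m)]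
  {μ : ∀ m, ι → V m → ℝ} {l : Filter ℕ} {s q : ℕ}
  {w : ∀ m, Finset ι → (Finset ι → Fin q) → (ι → V m) → ℝ}
  {p : Finset ι → (Finset ι → Fin q) → ℝ}

lemma LabelKernel.update_prod_ssubsets (h : LabelKernel l μ s q w p) (m : ℕ) (e : Finset ι)
    (x : ι → V m) {g : Finset ι} (hg : g ∉ e.ssubsets) (i : Finset ι → Fin q) (a : Fin q) :
    ∏ g' ∈ e.ssubsets, w m g' (Function.update i g a) x = ∏ g' ∈ e.ssubsets, w m g' i x :=
  Finset.prod_congr rfl fun g' hg' => by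
    rw [h.congr m g' (Function.update i g a) i fun g'' hg'' => Function.update_of_ne (by
      rintro rfl
      exact hg (Finset.mem_ssubsets.2 (hg''.trans_ssubset (Finset.mem_ssubsets.1 hg')))) _ _]

lemma LabelKernel.update_pprod_ssubsets (h : LabelKernel l μ s q w p) (e : Finset ι)
    {g : Finset ι} (hg : g ∉ e.ssubsets) (i : Finset ι → Fin q) (a : Fin q) :
    ∏ g' ∈ e.ssubsets, p g' (Function.update i g a) = ∏ g' ∈ e.ssubsets, p g' i :=
  Finset.prod_congr rfl fun g' hg' => by
    rw [h.pcongr g' (Function.update i g a) i fun g'' hg'' => Function.update_of_ne (by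
      rintro rfl
      exact hg (Finset.mem_ssubsets.2 (hg''.trans_ssubset (Finset.mem_ssubsets.1 hg')))) _ _]

/-- Summing out the labels of the sets that are not proper subsets of `e`. -/
lemma LabelKernel.sum_mul_ssubsets (h : LabelKernel l μ s q w p) (hq : 0 < q) (m : ℕ)
    (e : Finset ι) (x : ι → V m) (Φ : (Finset ι → Fin q) → ℝ)
    (hΦ : ∀ g ∉ e.ssubsets, ∀ i a, Φ (Function.update i g a) = Φ i) :
    ∑ i, Φ i * ∏ g, w m g i x =
      (q : ℝ)⁻¹ ^ (e.ssubsets)ᶜ.card * ∑ i, Φ i * ∏ g ∈ e.ssubsets, w m g i x := by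
  rw [← h.sum_mul_prod hq m x (e.ssubsets)ᶜ _ fun g hg i a => by
    rw [Finset.mem_compl] at hg
    rw [hΦ g hg, h.update_prod_ssubsets m e x hg]]
  refine Finset.sum_congr rfl fun i _ => ?_
  rw [mul_assoc, Finset.prod_mul_prod_compl]

/-- The main counting argument: if the expected product vanishes, then each vector of labels of
positive probability is bad with respect to one of the coordinates. -/
lemma LabelKernel.exists_bad [Nonempty ι] [l.NeBot] (hμ : ∀ m, IsWeight (μ m))
    (hk : LabelKernel l μ s q w p) (hs : s + 1 = Fintype.card ι)
    {h : ∀ m, ι → (ι → V m) → ℝ}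
    (hhd : ∀ m j, DependsOn (h m j) (Finset.univ.erase j : Finset ι))
    (hh : ∀ m j x, 0 ≤ h m j x) (hh₁ : ∀ m j x, h m j x ≤ 1) (i : Finset ι → Fin q)
    (hE : Tendsto (fun m => wE (μ m) fun x => (∏ j, h m j x) *
      ∏ g ∈ Finset.univ.filter (fun g : Finset ι => g.card < s), w m g i x) l (𝓝 0))
    {a b : ι → ℝ} (ha : ∀ j, 0 ≤ a j) (ha₁ : ∀ j, a j ≤ 1)
    (hb : ∀ j, Tendsto (fun m => wE (μ m) fun x =>
      |h m j x - a j| * ∏ g ∈ (Finset.univ.erase j).ssubsets, w m g i x) l (𝓝 (b j)))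
    {δ : ℝ} (hδ : 0 < δ) (hp : ∀ g : Finset ι, g.card < s → p g i ≠ 0) :
    ∃ j, a j < δ ∨ δ ^ Fintype.card ι / Fintype.card ι *
      ∏ g ∈ (Finset.univ.erase j).ssubsets, p g i ≤ b j := by
  set S : Finset (Finset ι) := Finset.univ.filter fun g : Finset ι => g.card < s with hS
  have hcard : ∀ j : ι, (Finset.univ.erase j : Finset ι).card = s := fun j => by
    rw [Finset.card_erase_of_mem (Finset.mem_univ j), Finset.card_univ]; omega
  have hsub : ∀ j : ι, (Finset.univ.erase j).ssubsets ⊆ S := fun j g hg => by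
    have := Finset.card_lt_card (Finset.mem_ssubsets.1 hg)
    rw [hcard] at this
    simpa [hS] using this
  have hns : ∀ j, ∀ g ∈ S \ (Finset.univ.erase j).ssubsets, ¬ g ⊆ Finset.univ.erase j :=
    fun j g hg hsub => by
      rw [Finset.mem_sdiff, Finset.mem_ssubsets] at hg
      refine hg.2 (hsub.ssubset_of_ne ?_)
      rintro rfl
      have : (Finset.univ.erase j : Finset ι).card < s := by simpa [hS] using hg.1
      rw [hcard] at this
      omega
  have hP : Tendsto (fun m => wE (μ m) fun x => ∏ g ∈ S, w m g i x) l (𝓝 (∏ g ∈ S, p g i)) := by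
    have := hk.tendsto_replace hμ i (∅ : Finset Unit) (fun _ => ∅) (fun _ _ _ => 1)
      (by simp) (by simp) S (by simp)
    have h2 := this.add_const (∏ g ∈ S, p g i)
    simpa [wE_const (hμ _)] using h2
  have hD : ∀ j, Tendsto (fun m => wE (μ m) fun x => |h m j x - a j| * ∏ g ∈ S, w m g i x) l
      (𝓝 (b j * ∏ g ∈ S \ (Finset.univ.erase j).ssubsets, p g i)) := fun j => by
    have h1 := hk.tendsto_replace hμ i (Finset.univ : Finset Unit)
      (fun _ => Finset.univ.erase j)
      (fun m _ x => |h m j x - a j| * ∏ g ∈ (Finset.univ.erase j).ssubsets, w m g i x)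
      (fun m _ _ x y hxy => by
        simp only [hhd m j hxy]
        congr 1
        refine Finset.prod_congr rfl fun g hg => hk.dep m g i fun t ht => hxy t ?_
        exact (Finset.mem_ssubsets.1 hg).1 ht)
      (fun m _ x => by
        rw [abs_mul, abs_abs]
        refine mul_le_one₀ ?_ (abs_nonneg _) (abs_prod_le_one _ fun g _ => hk.abs_le_one m g i x)
        rw [abs_le]
        constructor <;> linarith [hh m j x, hh₁ m j x, ha j, ha₁ j])
      (S \ (Finset.univ.erase j).ssubsets) (fun g hg _ _ => hns j g hg)
    have h2 := h1.add ((hb j).mul_const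
      (∏ g ∈ S \ (Finset.univ.erase j).ssubsets, p g i))
    rw [zero_add] at h2
    refine h2.congr fun m => ?_
    simp only [Finset.univ_unique, Finset.prod_singleton, sub_add_cancel]
    congr 1
    funext x
    rw [mul_assoc, mul_comm (∏ g ∈ (Finset.univ.erase j).ssubsets, w m g i x),
      Finset.prod_sdiff (hsub j)]
  have hmain : (∏ j, a j) * ∏ g ∈ S, p g i ≤
      0 + ∑ j, b j * ∏ g ∈ S \ (Finset.univ.erase j).ssubsets, p g i := by
    refine le_of_tendsto_of_tendsto' (hP.const_mul (∏ j, a j))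
      (hE.add (tendsto_finsetSum Finset.univ fun j _ => hD j)) fun m => ?_
    rw [← wE_const_mul, ← wE_sum, ← wE_add]
    refine wE_mono (hμ m) fun x => ?_
    rw [← Finset.sum_mul, ← add_mul]
    refine mul_le_mul_of_nonneg_right ?_ (hk.prod_nonneg m S i x)
    have h3 := abs_prod_sub_prod_le Finset.univ (u := fun j => h m j x) (v := a)
      (fun j _ => by rw [abs_of_nonneg (hh m j x)]; exact hh₁ m j x)
      (fun j _ => by rw [abs_of_nonneg (ha j)]; exact ha₁ j)
    linarith [(abs_le.1 h3).1]
  rw [zero_add] at hmain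
  by_contra! hcon
  have hpos : ∀ T ⊆ S, 0 < ∏ g ∈ T, p g i := fun T hT => Finset.prod_pos fun g hg =>
    lt_of_le_of_ne (hk.pnonneg g i) (hp g (by simpa [hS] using hT hg)).symm
  have hn : (0 : ℝ) < Fintype.card ι := by exact_mod_cast Fintype.card_pos
  have h4 : ∑ j, b j * ∏ g ∈ S \ (Finset.univ.erase j).ssubsets, p g i <
      ∑ _j : ι, δ ^ Fintype.card ι / Fintype.card ι * ∏ g ∈ S, p g i := by
    refine Finset.sum_lt_sum_of_nonempty Finset.univ_nonempty fun j _ => ?_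
    rw [← Finset.prod_sdiff (hsub j), mul_comm (∏ g ∈ S \ _, p g i), ← mul_assoc]
    exact mul_lt_mul_of_pos_right (hcon j).2 (hpos _ Finset.sdiff_subset)
  have h5 : δ ^ Fintype.card ι ≤ ∏ j, a j := by
    rw [← Finset.card_univ, ← Finset.prod_const]
    exact Finset.prod_le_prod (fun _ _ => hδ.le) fun j _ => (hcon j).1
  rw [Finset.sum_const, Finset.card_univ, nsmul_eq_mul, ← mul_assoc,
    mul_div_cancel₀ _ hn.ne'] at h4
  have h6 := mul_le_mul_of_nonneg_right h5 (hpos S subset_rfl).le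
  linarith

end Cover

section Mass

variable {ι : Type} [Fintype ι] [DecidableEq ι] {V : ℕ → Type} [∀ m, Fintype (V m)]
  {μ : ∀ m, ι → V m → ℝ} {l : Filter ℕ} {s q : ℕ}
  {w : ∀ m, Finset ι → (Finset ι → Fin q) → (ι → V m) → ℝ}
  {p : Finset ι → (Finset ι → Fin q) → ℝ}

/-- The total weight of the label vectors in `bad`, as a function of the coordinates in `e`. -/
noncomputable def badWeight (w : ∀ m, Finset ι → (Finset ι → Fin q) → (ι → V m) → ℝ)
    (e : Finset ι) (bad : Finset (Finset ι → Fin q)) (m : ℕ) (x : ι → V m) : ℝ :=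
  (q : ℝ)⁻¹ ^ (e.ssubsets)ᶜ.card * ∑ i ∈ bad, ∏ g ∈ e.ssubsets, w m g i x

lemma badWeight_dependsOn (hk : LabelKernel l μ s q w p) (e : Finset ι)
    (bad : Finset (Finset ι → Fin q)) (m : ℕ) : DependsOn (badWeight w e bad m) e :=
  fun x y hxy => by
    unfold badWeight
    congr 1
    refine Finset.sum_congr rfl fun i _ => Finset.prod_congr rfl fun g hg => hk.dep m g i
      fun t ht => hxy t ((Finset.mem_ssubsets.1 hg).1 ht)

lemma badWeight_nonneg (hk : LabelKernel l μ s q w p) (e : Finset ι)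
    (bad : Finset (Finset ι → Fin q)) (m : ℕ) (x : ι → V m) : 0 ≤ badWeight w e bad m x :=
  mul_nonneg (by positivity) (Finset.sum_nonneg fun i _ => hk.prod_nonneg m _ i x)

/-- A function that is well approximated by `a i` given the labels has small mass on bad labels. -/
lemma LabelKernel.eventually_mass_le [Nonempty ι] [l.NeBot] (hμ : ∀ m, IsWeight (μ m))
    (hk : LabelKernel l μ s q w p) (hq : 0 < q) (e : Finset ι) {h : ∀ m, (ι → V m) → ℝ}
    (hh₁ : ∀ m x, h m x ≤ 1) {a b : (Finset ι → Fin q) → ℝ}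
    (hb : ∀ i, Tendsto (fun m => wE (μ m) fun x =>
      |h m x - a i| * ∏ g ∈ e.ssubsets, w m g i x) l (𝓝 (b i)))
    {δ κ β ε : ℝ} (hδ : 0 ≤ δ) (hκ : 0 < κ) (hε : 0 < ε) (bad : Finset (Finset ι → Fin q))
    (hbad : ∀ i ∈ bad, a i < δ ∨ κ * ∏ g ∈ e.ssubsets, p g i ≤ b i)
    (hβ : ∀ᶠ m in l, (q : ℝ)⁻¹ ^ (e.ssubsets)ᶜ.card * ∑ i, (wE (μ m) fun x =>
      |h m x - a i| * ∏ g ∈ e.ssubsets, w m g i x) ≤ β) :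
    ∀ᶠ m in l, wE (μ m) (fun x => h m x * badWeight w e bad m x) ≤ δ + β + β / κ + ε := by
  classical
  set c : ℝ := (q : ℝ)⁻¹ ^ (e.ssubsets)ᶜ.card with hc
  have hc0 : 0 ≤ c := by positivity
  set T : Finset (Finset ι → Fin q) :=
    Finset.univ.filter fun i => κ * ∏ g ∈ e.ssubsets, p g i ≤ b i with hT
  have hb0 : ∀ i, 0 ≤ b i := fun i => ge_of_tendsto' (hb i) fun m =>
    wE_nonneg (hμ m) fun x => mul_nonneg (abs_nonneg _) (hk.prod_nonneg m _ i x)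
  have hW : ∀ i, Tendsto (fun m => wE (μ m) fun x => ∏ g ∈ e.ssubsets, w m g i x) l
      (𝓝 (∏ g ∈ e.ssubsets, p g i)) := fun i => by
    have := hk.tendsto_replace hμ i (∅ : Finset Unit) (fun _ => ∅) (fun _ _ _ => 1)
      (by simp) (by simp) e.ssubsets (by simp)
    have h2 := this.add_const (∏ g ∈ e.ssubsets, p g i)
    simpa [wE_const (hμ _)] using h2
  have hone : ∀ m x, c * ∑ i, ∏ g ∈ e.ssubsets, w m g i x = 1 := fun m x => by
    have := hk.sum_mul_ssubsets hq m e x (fun _ => 1) (fun _ _ _ _ => rfl)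
    simp only [one_mul] at this
    rw [← this, hk.sum_prod_eq_one hq m x]
  have hsum : c * ∑ i, b i ≤ β :=
    le_of_tendsto ((tendsto_finsetSum Finset.univ fun i _ => hb i).const_mul c) hβ
  have hlim : Tendsto (fun m => c * ∑ i ∈ T, wE (μ m) fun x => ∏ g ∈ e.ssubsets, w m g i x) l
      (𝓝 (c * ∑ i ∈ T, ∏ g ∈ e.ssubsets, p g i)) :=
    (tendsto_finsetSum T fun i _ => hW i).const_mul c
  have hTb : c * ∑ i ∈ T, ∏ g ∈ e.ssubsets, p g i ≤ β / κ := by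
    rw [le_div_iff₀ hκ]
    refine le_trans ?_ hsum
    rw [mul_assoc, Finset.sum_mul]
    refine mul_le_mul_of_nonneg_left ?_ hc0
    calc _ ≤ ∑ i ∈ T, b i := Finset.sum_le_sum fun i hi => by
            rw [mul_comm]; exact (Finset.mem_filter.1 hi).2
      _ ≤ ∑ i, b i := Finset.sum_le_univ_sum_of_nonneg hb0
  filter_upwards [hβ, hlim.eventually_le_const (hTb.trans_lt (lt_add_of_pos_right _ hε))]
    with m h1 h2
  have h3 : wE (μ m) (fun x => h m x * badWeight w e bad m x) ≤
      wE (μ m) fun x => (c * ∑ i, |h m x - a i| * ∏ g ∈ e.ssubsets, w m g i x) +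
        (δ * (c * ∑ i, ∏ g ∈ e.ssubsets, w m g i x) +
        c * ∑ i ∈ T, ∏ g ∈ e.ssubsets, w m g i x) := by
    refine wE_mono (hμ m) fun x => ?_
    have hw := fun i => hk.prod_nonneg m e.ssubsets i x
    have h4 : h m x * ∑ i ∈ bad, ∏ g ∈ e.ssubsets, w m g i x ≤
        ∑ i, ((|h m x - a i| + δ) * (∏ g ∈ e.ssubsets, w m g i x) +
          if i ∈ T then ∏ g ∈ e.ssubsets, w m g i x else 0) := by
      rw [Finset.mul_sum]
      refine (Finset.sum_le_sum fun i hi => ?_).trans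
        (Finset.sum_le_univ_sum_of_nonneg (s := bad) fun i => ?_)
      · by_cases hiT : i ∈ T
        · rw [if_pos hiT]
          nlinarith [hw i, hh₁ m x, abs_nonneg (h m x - a i),
            mul_nonneg (add_nonneg (abs_nonneg (h m x - a i)) hδ) (hw i),
            mul_nonneg (sub_nonneg.2 (hh₁ m x)) (hw i)]
        · rw [if_neg hiT, add_zero]
          refine mul_le_mul_of_nonneg_right ?_ (hw i)
          have : a i < δ := (hbad i hi).resolve_right fun h' => hiT (by simpa [hT] using h')
          linarith [le_abs_self (h m x - a i)]
      · refine add_nonneg (mul_nonneg (by positivity) (hw i)) ?_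
        split_ifs
        exacts [hw i, le_rfl]
    unfold badWeight
    rw [← hc, mul_left_comm]
    refine (mul_le_mul_of_nonneg_left h4 hc0).trans_eq ?_
    rw [Finset.sum_add_distrib, Finset.sum_ite_mem, Finset.univ_inter]
    simp only [add_mul, Finset.sum_add_distrib, ← Finset.mul_sum]
    ring
  refine h3.trans ?_
  simp only [hone, mul_one]
  rw [wE_add, wE_add, wE_const (hμ m), wE_const_mul, wE_sum, wE_const_mul, wE_sum]
  linarith

end Mass

section Asymptotic

variable {ι : Type} [Fintype ι] [DecidableEq ι] {V : ℕ → Type} [∀ m, Fintype (V m)]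
  {μ : ∀ m, ι → V m → ℝ} {ν : ∀ m, ι → (ι → V m) → ℝ}

lemma coe_univ_erase (j : ι) : ((Finset.univ.erase j : Finset ι) : Set ι) = {j}ᶜ := by
  ext; simp

/-- The relative hypergraph removal lemma, in the form of a fractional cover, along an
ultrafilter. -/
theorem exists_cover_ultrafilter [Nonempty ι] (U : Ultrafilter ℕ) (hU : (U : Filter ℕ) ≤ atTop)
    (hμ : ∀ m, IsWeight (μ m)) (hν : LinearForms (U : Filter ℕ) μ ν)
    (hd : ∀ m i, DependsOn (ν m i) {i}ᶜ) (hν₀ : ∀ m i x, 0 ≤ ν m i x)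
    {f : ∀ m, ι → (ι → V m) → ℝ} (hfd : ∀ m i, DependsOn (f m i) {i}ᶜ)
    (hf : ∀ m i x, 0 ≤ f m i x) (hfν : ∀ m i x, f m i x ≤ ν m i x)
    (hE : Tendsto (fun m => wE (μ m) fun x => ∏ i, f m i x) U (𝓝 0)) {δ : ℝ} (hδ : 0 < δ) :
    ∃ r : ∀ m, ι → (ι → V m) → ℝ, (∀ m i, DependsOn (r m i) {i}ᶜ) ∧ (∀ m i x, 0 ≤ r m i x) ∧
      (∀ m x, 1 ≤ ∑ i, r m i x) ∧
      ∀ᶠ m in (U : Filter ℕ), ∀ i, wE (μ m) (fun x => f m i x * r m i x) ≤ δ := by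
  classical
  set n := Fintype.card ι with hn
  have hn0 : 0 < n := Fintype.card_pos
  obtain ⟨s, hs⟩ : ∃ s, s + 1 = n := ⟨n - 1, by omega⟩
  have hcard : ∀ j : ι, (Finset.univ.erase j : Finset ι).card = s := fun j => by
    rw [Finset.card_erase_of_mem (Finset.mem_univ j), Finset.card_univ]; omega
  set δ' := δ / 8 with hδ'
  set κ := δ' ^ n / n with hκd
  have hκ : 0 < κ := by positivity
  set β := (δ / 8) / (1 + 1 / κ) with hβd
  have hβ : 0 < β := by positivity
  have hββ : β + β / κ = δ / 8 := by
    rw [hβd]; field_simp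
  choose h₀ hhd₀ hh₀ hh₁₀ _ horth₀ happ₀ using fun e : Finset ι =>
    exists_bounded_projection (e := e) (L := {j : ι // Finset.univ.erase j = e}) U hU hμ
      (f := fun m j => f m j) (ν := fun m j => ν m j) (fun m j => hf m j) (fun m j => hfν m j)
      (fun ⟨j, hj⟩ => hj ▸ hν.orthLocal hμ hd hν₀ j)
  choose C η hη hη₁ _ hC using fun e => happ₀ e (β / 2) (by positivity)
  set h : ∀ m, ι → (ι → V m) → ℝ := fun m j => h₀ (Finset.univ.erase j) m ⟨j, rfl⟩ with hh
  have hhd : ∀ m j, DependsOn (h m j) (Finset.univ.erase j : Finset ι) := fun m j => hhd₀ _ m _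
  have hhd' : ∀ m j, DependsOn (h m j) {j}ᶜ := fun m j => by
    rw [← coe_univ_erase]; exact hhd m j
  have hh0 : ∀ m j x, 0 ≤ h m j x := fun m j => hh₀ _ m _
  have hh1 : ∀ m j x, h m j x ≤ 1 := fun m j => hh₁₀ _ m _
  have horth : ∀ j, OrthLocal (U : Filter ℕ) μ (Finset.univ.erase j)
    fun m x => f m j x - h m j x := fun j => horth₀ _ ⟨j, rfl⟩
  obtain ⟨enc, henc⟩ := exists_injective_nat (ι → ℕ)
  obtain ⟨Γ, hΓ⟩ := exists_facetCode_le enc C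
  obtain ⟨q, w, p, -, hΓq, hk, herr⟩ := exists_labelKernel U hU hμ s (facetCode enc C) Γ hΓ
    (fun m e => facetCode_dependsOn enc C m e) (β / (2 * n)) (by positivity) 0
  have hq : 0 < q := by omega
  set a : ι → (Finset ι → Fin q) → ℝ := fun j i =>
    η (Finset.univ.erase j) ⟨j, rfl⟩ (decode enc (Finset.univ.erase j) i) with ha
  have ha0 : ∀ j i, 0 ≤ a j i := fun j i => hη _ _ _
  have ha1 : ∀ j i, a j i ≤ 1 := fun j i => hη₁ _ _ _
  have haupd : ∀ j, ∀ g ∉ (Finset.univ.erase j).ssubsets, ∀ i c,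
      a j (Function.update i g c) = a j i := fun j g hg i c => by
    have h1 : decode enc (Finset.univ.erase j) (Function.update i g c) =
        decode enc (Finset.univ.erase j) i := decode_congr enc _ fun g' hg' =>
      Function.update_of_ne (by rintro rfl; exact hg (Finset.mem_ssubsets.2 hg')) _ _
    simp only [ha]
    rw [h1]
  have habs : ∀ m j i x, |h m j x - a j i| ≤ 1 := fun m j i x => by
    rw [abs_le]
    constructor <;> linarith [hh0 m j x, hh1 m j x, ha0 j i, ha1 j i]
  have hlim : ∀ j i, ∃ b, Tendsto (fun m => wE (μ m) fun x => |h m j x - a j i| *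
      ∏ g ∈ (Finset.univ.erase j).ssubsets, w m g i x) U (𝓝 b) := fun j i => by
    obtain ⟨b, -, hb⟩ := exists_tendsto_of_mem_Icc U (p := 0) (q := 1)
      (a := fun m => wE (μ m) fun x => |h m j x - a j i| *
        ∏ g ∈ (Finset.univ.erase j).ssubsets, w m g i x)
      (fun m => ⟨wE_nonneg (hμ m) fun x => mul_nonneg (abs_nonneg _) (hk.prod_nonneg m _ i x),
        wE_le_const (hμ m) fun x => mul_le_one₀ (habs m j i x) (hk.prod_nonneg m _ i x)
          (Finset.prod_le_one (fun g _ => hk.nonneg m g i x) fun g _ => hk.le_one m g i x)⟩)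
    exact ⟨b, hb⟩
  choose b hb using hlim
  have hbupd : ∀ j, ∀ g ∉ (Finset.univ.erase j).ssubsets, ∀ i c,
      b j (Function.update i g c) = b j i := fun j g hg i c => by
    refine tendsto_nhds_unique (hb j (Function.update i g c)) ((hb j i).congr fun m => ?_)
    congr 1
    funext x
    rw [haupd j g hg, hk.update_prod_ssubsets m _ x hg]
  set bad : ι → Finset (Finset ι → Fin q) := fun j => Finset.univ.filter fun i =>
    a j i < δ' ∨ κ * ∏ g ∈ (Finset.univ.erase j).ssubsets, p g i ≤ b j i with hbad
  have hbadupd : ∀ j, ∀ g ∉ (Finset.univ.erase j).ssubsets, ∀ i c,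
      (Function.update i g c ∈ bad j ↔ i ∈ bad j) := fun j g hg i c => by
    simp only [hbad, Finset.mem_filter, Finset.mem_univ, true_and]
    rw [haupd j g hg, hbupd j g hg, hk.update_pprod_ssubsets _ hg]
  refine ⟨fun m j => badWeight w (Finset.univ.erase j) (bad j) m, fun m j => ?_,
    fun m j => badWeight_nonneg hk _ _ m, fun m x => ?_, ?_⟩
  · rw [← coe_univ_erase]; exact badWeight_dependsOn hk _ _ m
  · have hr : ∀ j, badWeight w (Finset.univ.erase j) (bad j) m x =
        ∑ i, (if i ∈ bad j then 1 else 0) * ∏ g, w m g i x := fun j => by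
      rw [hk.sum_mul_ssubsets hq m (Finset.univ.erase j) x _ fun g hg i c => by
        simp only [hbadupd j g hg i c]]
      unfold badWeight
      simp only [ite_mul, one_mul, zero_mul, Finset.sum_ite_mem, Finset.univ_inter]
    simp only [hr]
    rw [Finset.sum_comm]
    refine (hk.sum_prod_eq_one hq m x).symm.le.trans ?_
    refine Finset.sum_le_sum fun i _ => ?_
    rw [← Finset.sum_mul]
    by_cases hp : ∀ g : Finset ι, g.card < s → p g i ≠ 0
    · obtain ⟨j, hj⟩ := hk.exists_bad hμ hs hhd hh0 hh1 i
        (tendsto_bounded_count hμ hν hd hν₀ hfd hf hfν hhd' hh0 hh1 horth _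
          (fun g hg => by
            have : g.card < s := by simpa using hg
            omega) (fun m g => w m g i) (fun m g => hk.dep m g i) (fun m g => hk.nonneg m g i)
          (fun m g => hk.le_one m g i) hE) (fun j => ha0 j i) (fun j => ha1 j i)
        (fun j => hb j i) (δ := δ') (by positivity) hp
      have hj' : i ∈ bad j := by simpa [hbad] using hj
      have h1 : (1 : ℝ) ≤ ∑ j, if i ∈ bad j then 1 else 0 := by
        have := Finset.single_le_sum (f := fun j => if i ∈ bad j then (1 : ℝ) else 0)
          (fun j _ => by split_ifs <;> norm_num) (Finset.mem_univ j)
        simpa [hj'] using this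
      exact le_mul_of_one_le_left (hk.prod_nonneg m _ i x) h1
    · push Not at hp
      obtain ⟨g, -, hg⟩ := hp
      rw [Finset.prod_eq_zero (Finset.mem_univ g) (hk.pzero g i hg m x), mul_zero]
  · rw [Filter.eventually_all]
    intro j
    have hdiff : Tendsto (fun m => wE (μ m) fun x => (f m j x - h m j x) *
        badWeight w (Finset.univ.erase j) (bad j) m x) U (𝓝 0) := by
      have h1 : ∀ i, Tendsto (fun m => wE (μ m) fun x => (f m j x - h m j x) *
          ∏ g ∈ (Finset.univ.erase j).ssubsets, w m g i x) U (𝓝 0) := fun i => by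
        have h2 : ∀ g ∈ (Finset.univ.erase j).ssubsets, ∃ k ∈ Finset.univ.erase j, k ∉ g :=
          fun g hg => (Finset.ssubset_iff_exists_cons_subset.1 (Finset.mem_ssubsets.1 hg)).elim
            fun k hk => by
              obtain ⟨hkg, hks⟩ := hk
              exact ⟨k, hks (Finset.mem_cons_self k g), hkg⟩
        choose! c hc hc' using h2
        exact (horth j).tendsto_global hμ (fun m x y hxy => by
          have hxy' : ∀ i ∈ ({j}ᶜ : Set ι), x i = y i := fun i hi => hxy i (by simpa using hi)
          simp only [hfd m j hxy', hhd m j hxy]) _ c hc (fun m g => w m g i)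
          (fun m g hg => (hk.dep m g i).mono fun t ht htc => hc' g hg (by
            rw [Set.mem_singleton_iff] at htc
            rw [← htc]; exact ht)) (fun m g x => hk.abs_le_one m g i x)
      have h2 := (tendsto_finsetSum (bad j) fun i _ => h1 i).const_mul
        ((q : ℝ)⁻¹ ^ ((Finset.univ.erase j).ssubsets)ᶜ.card)
      rw [Finset.sum_const_zero, mul_zero] at h2
      refine h2.congr fun m => ?_
      rw [← wE_sum, ← wE_const_mul]
      congr 1
      funext x
      unfold badWeight
      rw [← Finset.mul_sum]; ring
    have hmass := hk.eventually_mass_le hμ hq (Finset.univ.erase j) (fun m x => hh1 m j x)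
      (fun i => hb j i) (δ := δ') (κ := κ) (β := β) (ε := δ / 8) (by positivity) hκ
      (by positivity) (bad j) (fun i hi => by simpa [hbad] using hi) (by
        have hfac : ∀ᶠ m in (U : Filter ℕ), ∀ k ∈ Finset.univ.erase j,
            LabelKernel.colourError μ w m ((Finset.univ.erase j).erase k)
            (facetCode enc C m ((Finset.univ.erase j).erase k)) ≤ β / (2 * n) :=
          (Finset.eventually_all _).2 fun k hk => herr _ (by
            rw [Finset.card_erase_of_mem hk, hcard]
            have : 0 < (Finset.univ.erase j).card := Finset.card_pos.2 ⟨k, hk⟩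
            rw [hcard] at this
            omega)
        filter_upwards [hfac, hC (Finset.univ.erase j)] with m hm1 hm2
        have h1 := wE_table_le hμ hk hq henc C m (Finset.univ.erase j) (b := 1)
          (fun x c => |h m j x - η (Finset.univ.erase j) ⟨j, rfl⟩ c|)
          (fun x c => by
            rw [abs_le]
            constructor <;> linarith [hh0 m j x, hh1 m j x, hη (Finset.univ.erase j) ⟨j, rfl⟩ c,
              hη₁ (Finset.univ.erase j) ⟨j, rfl⟩ c])
          (fun x c => abs_nonneg _)
        have h2 : (q : ℝ)⁻¹ ^ ((Finset.univ.erase j).ssubsets)ᶜ.card * ∑ i, (wE (μ m) fun x =>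
            |h m j x - a j i| * ∏ g ∈ (Finset.univ.erase j).ssubsets, w m g i x) =
            wE (μ m) fun x => ∑ i, |h m j x - a j i| * ∏ g, w m g i x := by
          rw [← wE_sum, ← wE_const_mul]
          congr 1
          funext x
          exact (hk.sum_mul_ssubsets hq m _ x _ fun g hg i c => by rw [haupd j g hg]).symm
        rw [h2]
        refine h1.trans ?_
        have h3 := hm2 ⟨j, rfl⟩
        have h4 : ∑ k ∈ Finset.univ.erase j,
            LabelKernel.colourError μ w m ((Finset.univ.erase j).erase k)
            (facetCode enc C m ((Finset.univ.erase j).erase k)) ≤ β / 2 := by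
          refine (Finset.sum_le_sum fun k hk => hm1 k hk).trans ?_
          rw [Finset.sum_const, hcard, nsmul_eq_mul]
          have hsn : (s : ℝ) ≤ n := by exact_mod_cast (by omega : s ≤ n)
          have hn' : (0 : ℝ) < n := by exact_mod_cast hn0
          calc (s : ℝ) * (β / (2 * n)) ≤ n * (β / (2 * n)) := by gcongr
            _ = β / 2 := by field_simp
        linarith)
    filter_upwards [hmass, hdiff.eventually_le_const (show (0 : ℝ) < δ / 8 by positivity)]
      with m h1 h2
    have h3 : wE (μ m) (fun x => f m j x * badWeight w (Finset.univ.erase j) (bad j) m x) =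
        wE (μ m) (fun x => (f m j x - h m j x) *
          badWeight w (Finset.univ.erase j) (bad j) m x) +
        wE (μ m) (fun x => h m j x * badWeight w (Finset.univ.erase j) (bad j) m x) := by
      rw [← wE_add]
      congr 1
      funext x
      ring
    rw [h3]
    linarith

end Asymptotic

/-- The relative hypergraph removal lemma in the form of a fractional cover. -/
theorem exists_cover (ι : Type) [Fintype ι] [DecidableEq ι] [Nonempty ι] {δ : ℝ} (hδ : 0 < δ) :
    ∃ ε : ℝ, 0 < ε ∧ ∀ (V : Type) [Fintype V] (μ : ι → V → ℝ) (ν f : ι → (ι → V) → ℝ),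
      IsWeight μ → (∀ i, DependsOn (ν i) {i}ᶜ) → (∀ i x, 0 ≤ ν i x) →
      (∀ 𝒜 : ι → Finset (Finset ι), (∀ i, ∀ A ∈ 𝒜 i, i ∉ A) →
        |(wE μ fun x => wE μ fun y => ∏ i, ∏ A ∈ 𝒜 i, ν i (A.piecewise y x)) - 1| ≤ ε) →
      (∀ i, DependsOn (f i) {i}ᶜ) → (∀ i x, 0 ≤ f i x) → (∀ i x, f i x ≤ ν i x) →
      (wE μ fun x => ∏ i, f i x) ≤ ε →
      ∃ r : ι → (ι → V) → ℝ, (∀ i, DependsOn (r i) {i}ᶜ) ∧ (∀ i x, 0 ≤ r i x) ∧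
        (∀ x, 1 ≤ ∑ i, r i x) ∧ ∀ i, wE μ (fun x => f i x * r i x) ≤ δ := by
  by_contra! hcon
  have h0 : ∀ m : ℕ, (0 : ℝ) < 1 / ((m : ℝ) + 1) := fun m => by positivity
  choose V hV μ ν f hμ hd hν₀ hν hfd hf hfν hE hr using fun m : ℕ => hcon _ (h0 m)
  have hlim := tendsto_one_div_add_atTop_nhds_zero_nat (𝕜 := ℝ)
  set U : Ultrafilter ℕ := Filter.hyperfilter ℕ
  have hU : (U : Filter ℕ) ≤ atTop := Nat.hyperfilter_le_atTop
  obtain ⟨r, hrd, hr0, hr1, hrδ⟩ := exists_cover_ultrafilter (V := V) (μ := μ) (ν := ν) U hU hμ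
    (fun 𝒜 h𝒜 => by
      rw [tendsto_iff_dist_tendsto_zero]
      exact squeeze_zero (fun _ => dist_nonneg) (fun m => hν m 𝒜 h𝒜) (hlim.mono_left hU))
    hd hν₀ hfd hf hfν
    (squeeze_zero (fun m => wE_nonneg (hμ m) fun x => Finset.prod_nonneg fun i _ => hf m i x)
      hE (hlim.mono_left hU)) hδ
  obtain ⟨m, hm⟩ := hrδ.exists
  obtain ⟨i, hi⟩ := hr m (r m) (hrd m) (hr0 m) (hr1 m)
  exact absurd (hm i) (not_le.2 hi)

section SelbergWeights

/-- The sets of elements of `P` whose product is at most `R`. -/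
def sieveLevel (P : Finset ℕ) (R : ℕ) : Finset (Finset ℕ) := P.powerset.filter fun m => ∏ p ∈ m, p ≤ R

/-- The Euler function of the product of a set of primes. -/
def eulerProd (m : Finset ℕ) : ℝ := ∏ p ∈ m, ((p : ℝ) - 1)

/-- The normalising constant of the Selberg sieve. -/
noncomputable def sieveMass (P : Finset ℕ) (R : ℕ) : ℝ := ∑ m ∈ sieveLevel P R, (eulerProd m)⁻¹

/-- The coefficients of the Selberg sieve. -/
noncomputable def sieveCoeff (P : Finset ℕ) (R : ℕ) (d : Finset ℕ) : ℝ :=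
  (-1) ^ d.card * (∏ p ∈ d, (p : ℝ)) *
    (∑ m ∈ sieveLevel P R, if d ⊆ m then (eulerProd m)⁻¹ else 0) / sieveMass P R

/-- The Selberg sieve weight of sifting set `P` and level `R`. -/
noncomputable def sieve (P : Finset ℕ) (R : ℕ) (n : ℤ) : ℝ :=
  sieveMass P R * (∑ d ∈ P.powerset, if ∀ p ∈ d, (p : ℤ) ∣ n then sieveCoeff P R d else 0) ^ 2

variable {P : Finset ℕ} {R : ℕ}

lemma mem_sieveLevel {m : Finset ℕ} : m ∈ sieveLevel P R ↔ m ⊆ P ∧ ∏ p ∈ m, p ≤ R := by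
  simp [sieveLevel]

lemma one_le_sub_one (hP : ∀ p ∈ P, 2 ≤ p) {p : ℕ} (hp : p ∈ P) : (1 : ℝ) ≤ (p : ℝ) - 1 := by
  have : (2 : ℝ) ≤ p := by exact_mod_cast hP p hp
  linarith

lemma one_le_eulerProd (hP : ∀ p ∈ P, 2 ≤ p) {m : Finset ℕ} (hm : m ⊆ P) : 1 ≤ eulerProd m :=
  Finset.one_le_prod fun p hp => one_le_sub_one hP (hm hp)

lemma eulerProd_pos (hP : ∀ p ∈ P, 2 ≤ p) {m : Finset ℕ} (hm : m ⊆ P) : 0 < eulerProd m :=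
  one_pos.trans_le (one_le_eulerProd hP hm)

lemma eulerProd_inv_nonneg (hP : ∀ p ∈ P, 2 ≤ p) {m : Finset ℕ} (hm : m ∈ sieveLevel P R) :
    0 ≤ (eulerProd m)⁻¹ :=
  inv_nonneg.2 (eulerProd_pos hP (mem_sieveLevel.1 hm).1).le

lemma subset_mem_sieveLevel (hP : ∀ p ∈ P, 2 ≤ p) {m h : Finset ℕ} (hm : m ∈ sieveLevel P R)
    (hh : h ⊆ m) : h ∈ sieveLevel P R := by
  rw [mem_sieveLevel] at hm ⊢
  refine ⟨hh.trans hm.1, le_trans ?_ hm.2⟩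
  exact Finset.prod_le_prod_of_subset_of_one_le' hh fun p hp _ => by
    have := hP p (hm.1 hp); omega

lemma empty_mem_sieveLevel (hR : 1 ≤ R) : ∅ ∈ sieveLevel P R := by
  simp [mem_sieveLevel, hR]

lemma one_le_sieveMass (hP : ∀ p ∈ P, 2 ≤ p) (hR : 1 ≤ R) : 1 ≤ sieveMass P R := by
  refine le_trans ?_ (Finset.single_le_sum (fun m hm => eulerProd_inv_nonneg hP hm)
    (empty_mem_sieveLevel hR))
  simp [eulerProd]

lemma sieveCoeff_empty (hP : ∀ p ∈ P, 2 ≤ p) (hR : 1 ≤ R) : sieveCoeff P R ∅ = 1 := by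
  have := one_le_sieveMass hP hR
  have h0 : sieveMass P R ≠ 0 := by positivity
  simp only [sieveCoeff, Finset.card_empty, pow_zero, Finset.prod_empty, one_mul,
    Finset.empty_subset, if_true]
  exact div_self h0

lemma sieve_nonneg (hP : ∀ p ∈ P, 2 ≤ p) (hR : 1 ≤ R) (n : ℤ) : 0 ≤ sieve P R n :=
  mul_nonneg (zero_le_one.trans (one_le_sieveMass hP hR)) (sq_nonneg _)

lemma sieve_of_coprime (hP : ∀ p ∈ P, 2 ≤ p) (hR : 1 ≤ R) {n : ℤ} (hn : ∀ p ∈ P, ¬ (p : ℤ) ∣ n) :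
    sieve P R n = sieveMass P R := by
  unfold sieve
  rw [Finset.sum_eq_single_of_mem ∅ (by simp)]
  · simp [sieveCoeff_empty hP hR]
  · intro d hd hd0
    obtain ⟨p, hp⟩ := Finset.nonempty_iff_ne_empty.2 hd0
    exact if_neg fun h => hn p (Finset.mem_powerset.1 hd hp) (h p hp)

lemma sieveCoeff_eq_zero (hP : ∀ p ∈ P, 2 ≤ p) {d : Finset ℕ} (hd : d ∉ sieveLevel P R) :
    sieveCoeff P R d = 0 := by
  have : (∑ m ∈ sieveLevel P R, if d ⊆ m then (eulerProd m)⁻¹ else 0) = 0 :=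
    Finset.sum_eq_zero fun m hm => if_neg fun h => hd (subset_mem_sieveLevel hP hm h)
  simp [sieveCoeff, this]

lemma abs_sieveCoeff_le (hP : ∀ p ∈ P, 2 ≤ p) (hR : 1 ≤ R) (d : Finset ℕ) :
    |sieveCoeff P R d| ≤ R := by
  by_cases hd : d ∈ sieveLevel P R
  · have h1 := one_le_sieveMass hP hR
    have h2 : 0 ≤ ∑ m ∈ sieveLevel P R, (if d ⊆ m then (eulerProd m)⁻¹ else 0) :=
      Finset.sum_nonneg fun m hm => by
        split_ifs
        exacts [eulerProd_inv_nonneg hP hm, le_rfl]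
    have h3 : ∑ m ∈ sieveLevel P R, (if d ⊆ m then (eulerProd m)⁻¹ else 0) ≤ sieveMass P R :=
      Finset.sum_le_sum fun m hm => by
        split_ifs
        exacts [le_rfl, eulerProd_inv_nonneg hP hm]
    have h4 : (∏ p ∈ d, (p : ℝ)) ≤ R := by
      rw [← Nat.cast_prod]; exact_mod_cast (mem_sieveLevel.1 hd).2
    have h5 : 0 ≤ ∏ p ∈ d, (p : ℝ) := Finset.prod_nonneg fun p _ => by positivity
    rw [sieveCoeff, abs_div, abs_mul, abs_mul, abs_pow, abs_neg, abs_one, one_pow, one_mul,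
      abs_of_nonneg h2, abs_of_nonneg h5, abs_of_pos (by linarith), div_le_iff₀ (by linarith)]
    exact mul_le_mul h4 h3 h2 (by positivity)
  · rw [sieveCoeff_eq_zero hP hd, abs_zero]; positivity

lemma sum_neg_one_pow_interval (S h m : Finset ℕ) (hh : h ⊆ S) :
    (∑ g ∈ S.powerset, if h ⊆ g ∧ g ⊆ m then (-1 : ℝ) ^ g.card else 0) =
      if m ∩ S = h then (-1 : ℝ) ^ h.card else 0 := by
  have key := Finset.prod_add (fun p => if p ∈ m then (-1 : ℝ) else 0)
    (fun p => if p ∈ h then (0 : ℝ) else 1) S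
  have h1 : ∀ g ∈ S.powerset, (∏ p ∈ g, if p ∈ m then (-1 : ℝ) else 0) *
      (∏ p ∈ S \ g, if p ∈ h then (0 : ℝ) else 1) =
      if h ⊆ g ∧ g ⊆ m then (-1 : ℝ) ^ g.card else 0 := fun g hg => by
    split_ifs with hc
    · rw [Finset.prod_congr rfl fun p hp => if_pos (hc.2 hp), Finset.prod_const,
        Finset.prod_congr rfl fun p hp => if_neg fun hph => (Finset.mem_sdiff.1 hp).2 (hc.1 hph),
        Finset.prod_const_one, mul_one]
    · rw [not_and_or, Finset.not_subset, Finset.not_subset] at hc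
      obtain ⟨p, hp, hpg⟩ | ⟨p, hp, hpm⟩ := hc
      · exact mul_eq_zero_of_right _
          (Finset.prod_eq_zero (Finset.mem_sdiff.2 ⟨hh hp, hpg⟩) (if_pos hp))
      · exact mul_eq_zero_of_left (Finset.prod_eq_zero hp (if_neg hpm)) _
  rw [← Finset.sum_congr rfl h1, ← key]
  split_ifs with hc
  · subst hc
    rw [← Finset.prod_const, ← Finset.prod_subset hh]
    · exact Finset.prod_congr rfl fun p hp => by
        rw [if_pos hp, if_pos (Finset.mem_inter.1 hp).1, add_zero]
    · intro p hp hpm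
      rw [if_neg hpm, if_neg fun h => hpm (Finset.mem_inter.2 ⟨h, hp⟩), zero_add]
  · have : ∃ p ∈ S, ¬ (p ∈ m ↔ p ∈ h) := by
      by_contra! hcon
      refine hc (Finset.ext fun p => ?_)
      rw [Finset.mem_inter]
      exact ⟨fun h => (hcon p h.2).1 h.1, fun h => ⟨(hcon p (hh h)).2 h, hh h⟩⟩
    obtain ⟨p, hp, hpn⟩ := this
    refine Finset.prod_eq_zero hp ?_
    by_cases h1 : p ∈ m <;> by_cases h2 : p ∈ h <;> simp_all

/-- The diagonalised sieve coefficients. -/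
noncomputable def sieveDiag (P : Finset ℕ) (R : ℕ) (S e h : Finset ℕ) : ℝ :=
  ∑ g ∈ S.powerset, if h ⊆ g then sieveCoeff P R (e ∪ g) * ∏ p ∈ g, (p : ℝ)⁻¹ else 0

lemma sieveDiag_eq (hP : ∀ p ∈ P, 2 ≤ p) {S e h : Finset ℕ} (hS : S ⊆ P) (he : Disjoint e S)
    (hh : h ⊆ S) :
    sieveDiag P R S e h = (-1) ^ e.card * (-1) ^ h.card * (∏ p ∈ e, (p : ℝ)) / sieveMass P R *
      ∑ m ∈ sieveLevel P R, if e ⊆ m ∧ m ∩ S = h then (eulerProd m)⁻¹ else 0 := by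
  have h1 : ∀ g ∈ S.powerset,
      (if h ⊆ g then sieveCoeff P R (e ∪ g) * ∏ p ∈ g, (p : ℝ)⁻¹ else 0) =
      ∑ m ∈ sieveLevel P R, (-1) ^ e.card * (∏ p ∈ e, (p : ℝ)) / sieveMass P R *
        (if e ⊆ m then (eulerProd m)⁻¹ else 0) *
        (if h ⊆ g ∧ g ⊆ m then (-1 : ℝ) ^ g.card else 0) := fun g hg => by
    have hdis : Disjoint e g := he.mono_right (Finset.mem_powerset.1 hg)
    have hg0 : (∏ p ∈ g, (p : ℝ)) ≠ 0 := Finset.prod_ne_zero_iff.2 fun p hp => by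
      have := hP p (hS (Finset.mem_powerset.1 hg hp))
      positivity
    split_ifs with hc
    · rw [sieveCoeff, Finset.card_union_of_disjoint hdis, Finset.prod_union hdis, pow_add,
        Finset.prod_inv_distrib, Finset.mul_sum, Finset.sum_div, Finset.sum_mul]
      refine Finset.sum_congr rfl fun m _ => ?_
      by_cases h2 : e ⊆ m <;> by_cases h3 : g ⊆ m <;>
        simp [h2, h3, hc, Finset.union_subset_iff]
      field_simp
    · simp [hc]
  rw [sieveDiag, Finset.sum_congr rfl h1, Finset.sum_comm, Finset.mul_sum]
  refine Finset.sum_congr rfl fun m _ => ?_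
  rw [← Finset.mul_sum, sum_neg_one_pow_interval S h m hh]
  by_cases h2 : e ⊆ m <;> by_cases h3 : m ∩ S = h <;> simp [h2, h3]
  ring

end SelbergWeights

section SelbergDiagonal

variable {P : Finset ℕ} {R : ℕ}

lemma prod_div_eulerProd_le (hP : ∀ p ∈ P, 2 ≤ p) {e k Q : Finset ℕ} (hek : e ⊆ k) (hkQ : k ⊆ Q)
    (hQ : Q ⊆ P) : (∏ p ∈ e, (p : ℝ)) * (eulerProd k)⁻¹ ≤ 2 ^ Q.card := by
  have hk := eulerProd_pos hP (hkQ.trans hQ)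
  rw [mul_inv_le_iff₀ hk]
  calc ∏ p ∈ e, (p : ℝ) ≤ ∏ p ∈ e, (2 * ((p : ℝ) - 1)) :=
        Finset.prod_le_prod (fun p _ => by positivity) fun p hp => by
          have := one_le_sub_one hP (hQ (hkQ (hek hp)))
          linarith
    _ ≤ ∏ p ∈ k, (2 * ((p : ℝ) - 1)) := by
        have h2 : ∀ p ∈ k, 1 ≤ 2 * ((p : ℝ) - 1) := fun p hp => by
          have := one_le_sub_one hP (hQ (hkQ hp))
          linarith
        rw [← Finset.prod_sdiff hek]
        exact le_mul_of_one_le_left (Finset.prod_nonneg fun p hp => zero_le_one.trans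
          (h2 p (hek hp))) (Finset.one_le_prod fun p hp => h2 p (Finset.sdiff_subset hp))
    _ = 2 ^ k.card * eulerProd k := by
        rw [Finset.prod_mul_distrib, Finset.prod_const, eulerProd]
    _ ≤ 2 ^ Q.card * eulerProd k := by
        gcongr
        norm_num

lemma abs_sieveDiag_le (hP : ∀ p ∈ P, 2 ≤ p) (hR : 1 ≤ R) {Q e h : Finset ℕ} (hQ : Q ⊆ P)
    (he : e ⊆ Q) (hh : h ⊆ P \ Q) :
    |sieveDiag P R (P \ Q) e h| ≤ 4 ^ Q.card / sieveMass P R *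
      (if h ∈ sieveLevel P R then (eulerProd h)⁻¹ else 0) := by
  have hV := one_le_sieveMass hP hR
  have hdis : Disjoint e (P \ Q) := Finset.disjoint_sdiff.mono_left he
  rw [sieveDiag_eq hP Finset.sdiff_subset hdis hh]
  have hnn : ∀ m ∈ sieveLevel P R,
      0 ≤ (if e ⊆ m ∧ m ∩ (P \ Q) = h then (eulerProd m)⁻¹ else 0) := fun m hm => by
    split_ifs
    exacts [eulerProd_inv_nonneg hP hm, le_rfl]
  have he0 : 0 ≤ ∏ p ∈ e, (p : ℝ) := Finset.prod_nonneg fun p _ => by positivity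
  rw [abs_mul, abs_div, abs_mul, abs_mul, abs_pow, abs_pow, abs_neg, abs_one, one_pow, one_pow,
    one_mul, one_mul, abs_of_nonneg he0, abs_of_pos (by linarith : 0 < sieveMass P R),
    abs_of_nonneg (Finset.sum_nonneg hnn), div_mul_eq_mul_div, div_mul_eq_mul_div]
  refine div_le_div_of_nonneg_right ?_ (by linarith)
  split_ifs with hhl
  · have h1 : ∑ m ∈ sieveLevel P R, (if e ⊆ m ∧ m ∩ (P \ Q) = h then (eulerProd m)⁻¹ else 0) ≤
        ∑ k ∈ Q.powerset, if e ⊆ k then (eulerProd h)⁻¹ * (eulerProd k)⁻¹ else 0 := by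
      rw [← Finset.sum_filter, ← Finset.sum_filter]
      have hdec : ∀ m ∈ (sieveLevel P R).filter fun m => e ⊆ m ∧ m ∩ (P \ Q) = h,
          h ∪ m ∩ Q = m := fun m hm => by
        obtain ⟨hm, -, hmh⟩ := Finset.mem_filter.1 hm
        have := (mem_sieveLevel.1 hm).1
        rw [← hmh]
        ext p
        have := @this p
        simp only [Finset.mem_union, Finset.mem_inter, Finset.mem_sdiff]
        tauto
      have hinj : Set.InjOn (fun m => m ∩ Q)
          ((sieveLevel P R).filter fun m => e ⊆ m ∧ m ∩ (P \ Q) = h) := fun m hm m' hm' hmm => by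
        rw [← hdec m hm, ← hdec m' hm']
        exact congrArg (h ∪ ·) hmm
      have heq : ∀ m ∈ (sieveLevel P R).filter fun m => e ⊆ m ∧ m ∩ (P \ Q) = h,
          (eulerProd m)⁻¹ = (eulerProd h)⁻¹ * (eulerProd (m ∩ Q))⁻¹ := fun m hm => by
        conv_lhs => rw [← hdec m hm]
        rw [eulerProd, Finset.prod_union, mul_inv, ← eulerProd, ← eulerProd]
        exact Finset.disjoint_of_subset_right Finset.inter_subset_right
          (Finset.disjoint_of_subset_left hh Finset.sdiff_disjoint)
      rw [Finset.sum_congr rfl heq,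
        ← Finset.sum_image (f := fun k => (eulerProd h)⁻¹ * (eulerProd k)⁻¹) hinj]
      refine Finset.sum_le_sum_of_subset_of_nonneg ?_ fun k hk _ => ?_
      · intro k hk
        obtain ⟨m, hm, rfl⟩ := Finset.mem_image.1 hk
        rw [Finset.mem_filter, Finset.mem_powerset]
        exact ⟨Finset.inter_subset_right, Finset.subset_inter (Finset.mem_filter.1 hm).2.1 he⟩
      · have h3 := eulerProd_pos hP (hh.trans Finset.sdiff_subset)
        have h4 := eulerProd_pos hP ((Finset.mem_powerset.1 (Finset.mem_filter.1 hk).1).trans hQ)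
        positivity
    have h5 := eulerProd_pos hP (hh.trans Finset.sdiff_subset)
    refine (mul_le_mul_of_nonneg_left h1 he0).trans ?_
    rw [Finset.mul_sum]
    refine (Finset.sum_le_card_nsmul _ _ (2 ^ Q.card * (eulerProd h)⁻¹) fun k hk => ?_).trans_eq ?_
    · split_ifs with hek
      · rw [mul_left_comm, mul_comm]
        exact mul_le_mul_of_nonneg_right
          (prod_div_eulerProd_le hP hek (Finset.mem_powerset.1 hk) hQ) (by positivity)
      · rw [mul_zero]; positivity
    · rw [Finset.card_powerset, nsmul_eq_mul, Nat.cast_pow, show (4 : ℝ) = 2 * 2 by norm_num,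
        mul_pow]
      push_cast; ring
  · rw [Finset.sum_eq_zero, mul_zero, mul_zero]
    intro m hm
    refine if_neg fun hc => hhl (subset_mem_sieveLevel hP hm ?_)
    rw [← hc.2]
    exact Finset.inter_subset_left

/-- The quadratic form of the sieve coefficients attached to `S`, twisted by `e` and `e'`. -/
noncomputable def sieveTwist (P : Finset ℕ) (R : ℕ) (S e e' : Finset ℕ) : ℝ :=
  ∑ g ∈ S.powerset, ∑ g' ∈ S.powerset,
    sieveCoeff P R (e ∪ g) * sieveCoeff P R (e' ∪ g') * ∏ p ∈ g ∪ g', (p : ℝ)⁻¹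

lemma prod_union_inv (hP : ∀ p ∈ P, 2 ≤ p) {S g g' : Finset ℕ} (hS : S ⊆ P) (hg : g ⊆ S)
    (hg' : g' ⊆ S) : ∏ p ∈ g ∪ g', (p : ℝ)⁻¹ = ∑ h ∈ S.powerset,
      (if h ⊆ g then ∏ p ∈ g, (p : ℝ)⁻¹ else 0) * (if h ⊆ g' then ∏ p ∈ g', (p : ℝ)⁻¹ else 0) *
        eulerProd h := by
  have h1 : ∏ p ∈ g ∩ g', (p : ℝ) = ∑ h ∈ (g ∩ g').powerset, eulerProd h := by
    have := Finset.prod_add_one (f := fun p : ℕ => (p : ℝ) - 1) (s := g ∩ g')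
    simpa [eulerProd] using this
  have h2 : ∑ h ∈ S.powerset,
      (if h ⊆ g then ∏ p ∈ g, (p : ℝ)⁻¹ else 0) * (if h ⊆ g' then ∏ p ∈ g', (p : ℝ)⁻¹ else 0) *
        eulerProd h =
      ∑ h ∈ (g ∩ g').powerset, (∏ p ∈ g, (p : ℝ)⁻¹) * (∏ p ∈ g', (p : ℝ)⁻¹) * eulerProd h := by
    symm
    refine Finset.sum_subset_zero_on_sdiff
      (Finset.powerset_mono.2 (Finset.inter_subset_left.trans hg)) ?_ ?_
    · intro h hh
      simp only [Finset.mem_sdiff, Finset.mem_powerset, Finset.subset_inter_iff, not_and_or] at hh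
      rcases hh.2 with h' | h' <;> simp [h']
    · intro h hh
      simp only [Finset.mem_powerset, Finset.subset_inter_iff] at hh
      simp [hh.1, hh.2]
  have h3 : (∏ p ∈ g ∩ g', (p : ℝ)) ≠ 0 := Finset.prod_ne_zero_iff.2 fun p hp => by
    have := hP p (hS (hg (Finset.mem_inter.1 hp).1))
    positivity
  rw [h2, ← Finset.mul_sum, ← h1, ← Finset.prod_union_inter (f := fun p : ℕ => (p : ℝ)⁻¹),
    mul_assoc, Finset.prod_inv_distrib (s := g ∩ g'), inv_mul_cancel₀ h3, mul_one]

lemma sieveTwist_eq (hP : ∀ p ∈ P, 2 ≤ p) {S e e' : Finset ℕ} (hS : S ⊆ P) :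
    sieveTwist P R S e e' =
      ∑ h ∈ S.powerset, eulerProd h * (sieveDiag P R S e h * sieveDiag P R S e' h) := by
  have h1 : ∀ g ∈ S.powerset, ∀ g' ∈ S.powerset,
      sieveCoeff P R (e ∪ g) * sieveCoeff P R (e' ∪ g') * ∏ p ∈ g ∪ g', (p : ℝ)⁻¹ =
      ∑ h ∈ S.powerset, eulerProd h *
        ((if h ⊆ g then sieveCoeff P R (e ∪ g) * ∏ p ∈ g, (p : ℝ)⁻¹ else 0) *
        (if h ⊆ g' then sieveCoeff P R (e' ∪ g') * ∏ p ∈ g', (p : ℝ)⁻¹ else 0)) :=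
    fun g hg g' hg' => by
      rw [prod_union_inv hP hS (Finset.mem_powerset.1 hg) (Finset.mem_powerset.1 hg'),
        Finset.mul_sum]
      refine Finset.sum_congr rfl fun h _ => ?_
      split_ifs <;> ring
  unfold sieveTwist sieveDiag
  rw [Finset.sum_congr rfl fun g hg => Finset.sum_congr rfl fun g' hg' => h1 g hg g' hg',
    Finset.sum_congr rfl fun g hg => Finset.sum_comm, Finset.sum_comm]
  refine Finset.sum_congr rfl fun h _ => ?_
  rw [Finset.sum_mul_sum, Finset.mul_sum]
  simp only [Finset.mul_sum]

lemma abs_sieveTwist_le (hP : ∀ p ∈ P, 2 ≤ p) (hR : 1 ≤ R) {Q e e' : Finset ℕ} (hQ : Q ⊆ P)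
    (he : e ⊆ Q) (he' : e' ⊆ Q) :
    |sieveTwist P R (P \ Q) e e'| ≤ 16 ^ Q.card / sieveMass P R := by
  have hV := one_le_sieveMass hP hR
  rw [sieveTwist_eq hP Finset.sdiff_subset]
  refine (Finset.abs_sum_le_sum_abs _ _).trans ?_
  have h1 : ∀ h ∈ (P \ Q).powerset,
      |eulerProd h * (sieveDiag P R (P \ Q) e h * sieveDiag P R (P \ Q) e' h)| ≤
      16 ^ Q.card / sieveMass P R ^ 2 * (if h ∈ sieveLevel P R then (eulerProd h)⁻¹ else 0) :=
    fun h hh => by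
      rw [Finset.mem_powerset] at hh
      have h0 := eulerProd_pos hP (hh.trans Finset.sdiff_subset)
      rw [abs_mul, abs_mul, abs_of_pos h0]
      have := mul_le_mul (abs_sieveDiag_le hP hR hQ he hh) (abs_sieveDiag_le hP hR hQ he' hh)
        (abs_nonneg _) ((abs_nonneg _).trans (abs_sieveDiag_le hP hR hQ he hh))
      refine (mul_le_mul_of_nonneg_left this h0.le).trans_eq ?_
      rw [show (16 : ℝ) = 4 * 4 by norm_num, mul_pow]
      split_ifs
      · field_simp
      · simp
  refine (Finset.sum_le_sum h1).trans ?_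
  rw [← Finset.mul_sum]
  have h2 : ∑ h ∈ (P \ Q).powerset, (if h ∈ sieveLevel P R then (eulerProd h)⁻¹ else 0) ≤
      sieveMass P R := by
    rw [← Finset.sum_filter]
    exact Finset.sum_le_sum_of_subset_of_nonneg (fun h hh => (Finset.mem_filter.1 hh).2)
      fun h hh _ => eulerProd_inv_nonneg hP hh
  refine (mul_le_mul_of_nonneg_left h2 (by positivity)).trans_eq ?_
  field_simp

lemma sieveTwist_empty (hP : ∀ p ∈ P, 2 ≤ p) (hR : 1 ≤ R) :
    sieveTwist P R P ∅ ∅ = (sieveMass P R)⁻¹ := by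
  have hV := one_le_sieveMass hP hR
  rw [sieveTwist_eq hP subset_rfl]
  have h1 : ∀ h ∈ P.powerset, eulerProd h * (sieveDiag P R P ∅ h * sieveDiag P R P ∅ h) =
      (sieveMass P R ^ 2)⁻¹ * (if h ∈ sieveLevel P R then (eulerProd h)⁻¹ else 0) := fun h hh => by
    rw [Finset.mem_powerset] at hh
    have h0 := eulerProd_pos hP hh
    have h2 : ∑ m ∈ sieveLevel P R, (if ∅ ⊆ m ∧ m ∩ P = h then (eulerProd m)⁻¹ else 0) =
        if h ∈ sieveLevel P R then (eulerProd h)⁻¹ else 0 := by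
      rw [← Finset.sum_ite_eq' (sieveLevel P R) h fun m => (eulerProd m)⁻¹]
      refine Finset.sum_congr rfl fun m hm => ?_
      rw [Finset.inter_eq_left.2 (mem_sieveLevel.1 hm).1]
      simp
    rw [sieveDiag_eq hP subset_rfl (Finset.disjoint_empty_left _) hh, h2]
    split_ifs
    · have h3 : ((-1 : ℝ) ^ h.card) ^ 2 = 1 := by rw [← pow_mul, mul_comm, pow_mul]; norm_num
      simp only [Finset.card_empty, pow_zero, one_mul, Finset.prod_empty, mul_one]
      field_simp
      exact h3
    · simp
  rw [Finset.sum_congr rfl h1, ← Finset.mul_sum, Finset.sum_ite_mem,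
    Finset.inter_eq_right.2 fun h hh => Finset.mem_powerset.2 (mem_sieveLevel.1 hh).1,
    ← sieveMass]
  field_simp

end SelbergDiagonal

section SieveMainTerm

variable {Λ : Type} [Fintype Λ] [DecidableEq Λ] {P : Finset ℕ} {R : ℕ}

/-- The indices at which the family of pairs `D` involves `p`. -/
def sieveHit (D : Λ → Finset ℕ × Finset ℕ) (p : ℕ) : Finset Λ :=
  Finset.univ.filter fun l => p ∈ (D l).1 ∪ (D l).2

/-- All families of pairs of subsets of `S`. -/
def subsetPairs (Λ : Type) [Fintype Λ] [DecidableEq Λ] (S : Finset ℕ) :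
    Finset (Λ → Finset ℕ × Finset ℕ) :=
  Fintype.piFinset fun _ => S.powerset ×ˢ S.powerset

lemma mem_subsetPairs {S : Finset ℕ} {D : Λ → Finset ℕ × Finset ℕ} :
    D ∈ subsetPairs Λ S ↔ ∀ l, (D l).1 ⊆ S ∧ (D l).2 ⊆ S := by
  simp [subsetPairs, Fintype.mem_piFinset, Finset.mem_product]

lemma card_subsetPairs (S : Finset ℕ) :
    (subsetPairs Λ S).card = 4 ^ (S.card * Fintype.card Λ) := by
  rw [subsetPairs, Fintype.card_piFinset, Finset.prod_const, Finset.card_product,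
    Finset.card_powerset, Finset.card_univ, pow_mul, ← mul_pow]
  norm_num

/-- The coordinatewise union of two families of pairs. -/
def pairUnion (E G : Λ → Finset ℕ × Finset ℕ) (l : Λ) : Finset ℕ × Finset ℕ :=
  ((E l).1 ∪ (G l).1, (E l).2 ∪ (G l).2)

lemma sum_subsetPairs_split {Q : Finset ℕ} (hQ : Q ⊆ P) (F : (Λ → Finset ℕ × Finset ℕ) → ℝ) :
    ∑ D ∈ subsetPairs Λ P, F D =
      ∑ E ∈ subsetPairs Λ Q, ∑ G ∈ subsetPairs Λ (P \ Q), F (pairUnion E G) := by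
  rw [← Finset.sum_product']
  have aux : ∀ e g : Finset ℕ, e ⊆ Q → g ⊆ P \ Q → (e ∪ g) ∩ Q = e ∧ (e ∪ g) \ Q = g :=
    fun e g he hg => by
      constructor
      · ext p
        have := @he p
        have := @hg p
        simp only [Finset.mem_union, Finset.mem_inter, Finset.mem_sdiff] at *
        tauto
      · ext p
        have := @he p
        have := @hg p
        simp only [Finset.mem_union, Finset.mem_sdiff] at *
        tauto
  refine Finset.sum_nbij' (fun D => (fun l => ((D l).1 ∩ Q, (D l).2 ∩ Q),
    fun l => ((D l).1 \ Q, (D l).2 \ Q))) (fun q => pairUnion q.1 q.2) ?_ ?_ ?_ ?_ ?_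
  · intro D hD
    rw [mem_subsetPairs] at hD
    simp only [Finset.mem_product, mem_subsetPairs]
    exact ⟨fun l => ⟨Finset.inter_subset_right, Finset.inter_subset_right⟩,
      fun l => ⟨Finset.sdiff_subset_sdiff (hD l).1 subset_rfl,
        Finset.sdiff_subset_sdiff (hD l).2 subset_rfl⟩⟩
  · rintro ⟨E, G⟩ hq
    simp only [Finset.mem_product, mem_subsetPairs] at hq
    rw [mem_subsetPairs]
    exact fun l => ⟨Finset.union_subset ((hq.1 l).1.trans hQ)
      ((hq.2 l).1.trans Finset.sdiff_subset), Finset.union_subset ((hq.1 l).2.trans hQ)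
      ((hq.2 l).2.trans Finset.sdiff_subset)⟩
  · intro D _
    funext l
    ext p <;> simp [pairUnion] <;> tauto
  · rintro ⟨E, G⟩ hq
    simp only [Finset.mem_product, mem_subsetPairs] at hq
    refine Prod.ext (funext fun l => ?_) (funext fun l => ?_)
    · exact Prod.ext (aux _ _ (hq.1 l).1 (hq.2 l).1).1 (aux _ _ (hq.1 l).2 (hq.2 l).2).1
    · exact Prod.ext (aux _ _ (hq.1 l).1 (hq.2 l).1).2 (aux _ _ (hq.1 l).2 (hq.2 l).2).2
  · intro D _
    congr 1
    funext l
    ext p <;> simp [pairUnion] <;> tauto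

lemma prod_pow_card_sieveHit {S : Finset ℕ} {G : Λ → Finset ℕ × Finset ℕ}
    (hG : G ∈ subsetPairs Λ S) (a : ℕ → ℝ) :
    ∏ p ∈ S, a p ^ (sieveHit G p).card = ∏ l, ∏ p ∈ (G l).1 ∪ (G l).2, a p := by
  rw [mem_subsetPairs] at hG
  have h1 : ∀ l, ∏ p ∈ (G l).1 ∪ (G l).2, a p =
      ∏ p ∈ S, if p ∈ (G l).1 ∪ (G l).2 then a p else 1 := fun l => by
    rw [Finset.prod_ite_mem, Finset.inter_eq_right.2 (Finset.union_subset (hG l).1 (hG l).2)]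
  simp only [h1]
  rw [Finset.prod_comm]
  refine Finset.prod_congr rfl fun p _ => ?_
  rw [← Finset.prod_filter, Finset.prod_const, sieveHit]

/-- The contribution of the families, weighted by the local factors `κ` on `Q` and by the
expected local factors outside `Q`. -/
lemma sieve_local_expansion {Q : Finset ℕ} (hQ : Q ⊆ P) (κ : ℕ → Finset Λ → ℝ) :
    ∑ D ∈ subsetPairs Λ P, (∏ l, sieveCoeff P R (D l).1 * sieveCoeff P R (D l).2) *
      ((∏ p ∈ Q, κ p (sieveHit D p)) * ∏ p ∈ P \ Q, ((p : ℝ)⁻¹) ^ (sieveHit D p).card) =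
    ∑ E ∈ subsetPairs Λ Q, (∏ p ∈ Q, κ p (sieveHit E p)) *
      ∏ l, sieveTwist P R (P \ Q) (E l).1 (E l).2 := by
  rw [sum_subsetPairs_split hQ]
  refine Finset.sum_congr rfl fun E hE => ?_
  have h1 : ∏ l, sieveTwist P R (P \ Q) (E l).1 (E l).2 =
      ∑ G ∈ subsetPairs Λ (P \ Q), ∏ l, (sieveCoeff P R ((E l).1 ∪ (G l).1) *
        sieveCoeff P R ((E l).2 ∪ (G l).2) * ∏ p ∈ (G l).1 ∪ (G l).2, (p : ℝ)⁻¹) := by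
    unfold sieveTwist subsetPairs
    simp only [← Finset.sum_product']
    rw [Finset.prod_univ_sum]
  rw [h1, Finset.mul_sum]
  refine Finset.sum_congr rfl fun G hG => ?_
  rw [mem_subsetPairs] at hE
  have hG' := mem_subsetPairs.1 hG
  have h2 : ∀ p ∈ Q, sieveHit (pairUnion E G) p = sieveHit E p := fun p hp => by
    ext l
    have ha := @(hG' l).1 p
    have hb := @(hG' l).2 p
    simp only [sieveHit, pairUnion, Finset.mem_filter, Finset.mem_union, Finset.mem_sdiff,
      Finset.mem_univ, true_and] at *
    tauto
  have h3 : ∀ p ∈ P \ Q, sieveHit (pairUnion E G) p = sieveHit G p := fun p hp => by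
    ext l
    have ha := @(hE l).1 p
    have hb := @(hE l).2 p
    simp only [sieveHit, pairUnion, Finset.mem_filter, Finset.mem_union, Finset.mem_sdiff,
      Finset.mem_univ, true_and] at *
    tauto
  have h4 : ∏ p ∈ Q, κ p (sieveHit (pairUnion E G) p) = ∏ p ∈ Q, κ p (sieveHit E p) :=
    Finset.prod_congr rfl fun p hp => by rw [h2 p hp]
  have h5 : ∏ p ∈ P \ Q, ((p : ℝ)⁻¹) ^ (sieveHit (pairUnion E G) p).card =
      ∏ p ∈ P \ Q, ((p : ℝ)⁻¹) ^ (sieveHit G p).card :=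
    Finset.prod_congr rfl fun p hp => by rw [h3 p hp]
  rw [h4, h5, prod_pow_card_sieveHit hG, Finset.prod_mul_distrib (f := fun l =>
      sieveCoeff P R ((E l).1 ∪ (G l).1) * sieveCoeff P R ((E l).2 ∪ (G l).2))]
  simp only [pairUnion]
  ring

/-- The main term in the linear forms estimate for the Selberg sieve. -/
lemma abs_sieve_main_sub_one_le (hP : ∀ p ∈ P, 2 ≤ p) (hR : 1 ≤ R) (ρ : ℕ → Finset Λ → ℝ)
    (hρ : ∀ p ∈ P, ∀ B, |ρ p B - (p : ℝ)⁻¹ ^ B.card| ≤ ((p : ℝ) ^ 2)⁻¹) :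
    |sieveMass P R ^ Fintype.card Λ *
      (∑ D ∈ subsetPairs Λ P, (∏ l, sieveCoeff P R (D l).1 * sieveCoeff P R (D l).2) *
        ∏ p ∈ P, ρ p (sieveHit D p)) - 1| ≤
      ∏ p ∈ P, (1 + 64 ^ Fintype.card Λ * ((p : ℝ) ^ 2)⁻¹) - 1 := by
  have hV := one_le_sieveMass hP hR
  set L := Fintype.card Λ with hL
  set κ : ℕ → Finset Λ → ℝ := fun p B => ρ p B - (p : ℝ)⁻¹ ^ B.card with hκ
  set Y : Finset ℕ → ℝ := fun Q => ∑ E ∈ subsetPairs Λ Q, (∏ p ∈ Q, κ p (sieveHit E p)) *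
      ∏ l, sieveTwist P R (P \ Q) (E l).1 (E l).2 with hY
  have h1 : (∑ D ∈ subsetPairs Λ P, (∏ l, sieveCoeff P R (D l).1 * sieveCoeff P R (D l).2) *
        ∏ p ∈ P, ρ p (sieveHit D p)) = ∑ Q ∈ P.powerset, Y Q := by
    have h2 : ∀ D : Λ → Finset ℕ × Finset ℕ, ∏ p ∈ P, ρ p (sieveHit D p) =
        ∑ Q ∈ P.powerset, (∏ p ∈ Q, κ p (sieveHit D p)) *
          ∏ p ∈ P \ Q, ((p : ℝ)⁻¹) ^ (sieveHit D p).card := fun D => by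
      rw [← Finset.prod_add]
      exact Finset.prod_congr rfl fun p _ => by simp only [hκ]; ring
    simp only [h2, Finset.mul_sum]
    rw [Finset.sum_comm]
    exact Finset.sum_congr rfl fun Q hQ => sieve_local_expansion (Finset.mem_powerset.1 hQ) κ
  have hY0 : sieveMass P R ^ L * Y ∅ = 1 := by
    have h2 : subsetPairs Λ ∅ = {fun _ => (∅, ∅)} := by
      ext D
      simp only [mem_subsetPairs, Finset.subset_empty, Finset.mem_singleton, funext_iff,
        Prod.ext_iff]
    simp only [hY, h2, Finset.sum_singleton, Finset.prod_empty, one_mul, Finset.sdiff_empty,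
      sieveTwist_empty hP hR, Finset.prod_const, Finset.card_univ]
    rw [← mul_pow, mul_inv_cancel₀ (by positivity), one_pow]
  have hYQ : ∀ Q ∈ P.powerset, |sieveMass P R ^ L * Y Q| ≤
      ∏ p ∈ Q, (64 ^ L * ((p : ℝ) ^ 2)⁻¹) := fun Q hQ => by
    rw [Finset.mem_powerset] at hQ
    have h2 : |Y Q| ≤ (4 ^ (Q.card * L) : ℕ) • ((∏ p ∈ Q, ((p : ℝ) ^ 2)⁻¹) *
        (16 ^ Q.card / sieveMass P R) ^ L) := by
      rw [← card_subsetPairs (Λ := Λ)]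
      refine (Finset.abs_sum_le_sum_abs _ _).trans (Finset.sum_le_card_nsmul _ _ _ fun E hE => ?_)
      rw [mem_subsetPairs] at hE
      rw [abs_mul, Finset.abs_prod, Finset.abs_prod]
      refine mul_le_mul (Finset.prod_le_prod (fun p _ => abs_nonneg _) fun p hp =>
        hρ p (hQ hp) _) ?_ (Finset.prod_nonneg fun _ _ => abs_nonneg _)
        (Finset.prod_nonneg fun p _ => by positivity)
      refine (Finset.prod_le_prod (fun l _ => abs_nonneg _) fun l _ =>
        abs_sieveTwist_le hP hR hQ (hE l).1 (hE l).2).trans_eq ?_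
      rw [Finset.prod_const, Finset.card_univ]
    rw [abs_mul, abs_of_nonneg (by positivity), Finset.prod_mul_distrib, Finset.prod_const]
    refine (mul_le_mul_of_nonneg_left h2 (by positivity)).trans_eq ?_
    rw [nsmul_eq_mul, show (64 : ℝ) = 4 * 16 by norm_num, div_pow, mul_pow, mul_pow]
    push_cast
    rw [← pow_mul, ← pow_mul, ← pow_mul, mul_comm L]
    field_simp
  rw [h1, Finset.mul_sum, Finset.prod_one_add,
    ← Finset.add_sum_erase _ _ (Finset.empty_mem_powerset P), hY0,
    ← Finset.add_sum_erase _ _ (Finset.empty_mem_powerset P), Finset.prod_empty,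
    add_sub_cancel_left, add_sub_cancel_left]
  exact (Finset.abs_sum_le_sum_abs _ _).trans
    (Finset.sum_le_sum fun Q hQ => hYQ Q (Finset.mem_of_mem_erase hQ))

end SieveMainTerm

section LocalDensity

lemma card_fiber_mul {G H : Type*} [AddCommGroup G] [AddCommGroup H] [Finite G] [Finite H]
    (T : G →+ H) (hT : Function.Surjective T) (y : H) :
    Nat.card {x // T x = y} * Nat.card H = Nat.card G := by
  classical
  have := Fintype.ofFinite G
  have := Fintype.ofFinite H
  have h1 : ∀ z : H, (Finset.univ.filter fun x => T x = z).card =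
      (Finset.univ.filter fun x => T x = y).card := fun z =>
    AddMonoidHom.card_fiber_eq_of_mem_range T (hT z) (hT y)
  have h2 := Finset.card_eq_sum_card_fiberwise (f := T) (s := Finset.univ) (t := Finset.univ)
    (fun _ _ => Finset.mem_coe.2 (Finset.mem_univ _))
  simp only [h1, Finset.sum_const, smul_eq_mul] at h2
  rw [Nat.card_eq_fintype_card, Nat.card_eq_fintype_card, Nat.card_eq_fintype_card,
    Fintype.card_subtype, ← Finset.card_univ (α := G), h2, Finset.card_univ, mul_comm]

variable {Λ ι : Type} [Fintype Λ] [DecidableEq Λ] [Fintype ι] [DecidableEq ι]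

/-- The density of the common zeros modulo `p` of the affine forms indexed by `B`. -/
noncomputable def localDensity (a : Λ → ι → ℤ) (b : Λ → ℤ) (p : ℕ) (B : Finset Λ) : ℝ :=
  (Nat.card {x : ι → ZMod p // ∀ l ∈ B, ∑ i, (a l i : ZMod p) * x i + (b l : ZMod p) = 0} : ℝ) /
    (p : ℝ) ^ Fintype.card ι

variable (a : Λ → ι → ℤ) (b : Λ → ℤ) (p : ℕ) [hp : Fact p.Prime]

lemma card_fun_zmod : Nat.card (ι → ZMod p) = p ^ Fintype.card ι := by
  rw [Nat.card_fun, Nat.card_zmod, Nat.card_eq_fintype_card]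

/-- The linear part of the `l`-th form modulo `p`. -/
def formHom (l : Λ) : (ι → ZMod p) →+ ZMod p where
  toFun x := ∑ i, (a l i : ZMod p) * x i
  map_zero' := by simp
  map_add' x y := by simp [mul_add, Finset.sum_add_distrib]

lemma formHom_single (l : Λ) (i : ι) (c : ZMod p) :
    formHom a p l (Pi.single i c) = (a l i : ZMod p) * c := by
  simp only [formHom, AddMonoidHom.coe_mk, ZeroHom.coe_mk]
  rw [Finset.sum_eq_single i (fun j _ hj => by rw [Pi.single_eq_of_ne hj, mul_zero]) (by simp),
    Pi.single_eq_same]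

lemma localDensity_empty : localDensity a b p ∅ = 1 := by
  have hp0 : (p : ℝ) ≠ 0 := by exact_mod_cast hp.out.ne_zero
  have h1 : Nat.card {x : ι → ZMod p // ∀ l ∈ (∅ : Finset Λ),
      ∑ i, (a l i : ZMod p) * x i + (b l : ZMod p) = 0} = p ^ Fintype.card ι := by
    rw [← card_fun_zmod p]
    exact Nat.card_congr (Equiv.subtypeUnivEquiv (by simp))
  rw [localDensity, h1, Nat.cast_pow, div_self (pow_ne_zero _ hp0)]

lemma localDensity_singleton {l : Λ} (hl : ∃ i, (a l i : ZMod p) ≠ 0) :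
    localDensity a b p {l} = (p : ℝ)⁻¹ := by
  obtain ⟨i, hi⟩ := hl
  have hp0 : (p : ℝ) ≠ 0 := by exact_mod_cast hp.out.ne_zero
  have hsurj : Function.Surjective (formHom a p l) := fun y =>
    ⟨Pi.single i ((a l i : ZMod p)⁻¹ * y), by rw [formHom_single, mul_inv_cancel_left₀ hi]⟩
  have h1 := card_fiber_mul _ hsurj (-(b l : ZMod p))
  rw [card_fun_zmod, Nat.card_zmod] at h1
  have h2 : Nat.card {x : ι → ZMod p // ∀ k ∈ ({l} : Finset Λ),
      ∑ i, (a k i : ZMod p) * x i + (b k : ZMod p) = 0} =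
      Nat.card {x // formHom a p l x = -(b l : ZMod p)} :=
    Nat.card_congr (Equiv.subtypeEquivRight fun x => by
      simp [formHom, eq_neg_iff_add_eq_zero])
  rw [localDensity, h2, ← Nat.cast_pow, ← h1]
  have : (Nat.card {x // formHom a p l x = -(b l : ZMod p)} : ℝ) ≠ 0 := by
    intro h0
    rw [Nat.cast_eq_zero] at h0
    rw [h0, zero_mul] at h1
    exact pow_ne_zero _ hp.out.ne_zero h1.symm
  push_cast
  field_simp

lemma localDensity_le {B : Finset Λ} {l l' : Λ} (hl : l ∈ B) (hl' : l' ∈ B)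
    (h : ∃ i j, (a l i * a l' j - a l j * a l' i : ZMod p) ≠ 0) :
    localDensity a b p B ≤ ((p : ℝ) ^ 2)⁻¹ := by
  obtain ⟨i, j, hij⟩ := h
  have hp0 : (p : ℝ) ≠ 0 := by exact_mod_cast hp.out.ne_zero
  set T : (ι → ZMod p) →+ ZMod p × ZMod p := (formHom a p l).prod (formHom a p l') with hT
  have hsurj : Function.Surjective T := fun y => by
    set u := (a l i * a l' j - a l j * a l' i : ZMod p) with hu
    have h1 : ∀ v : ZMod p, (a l i : ZMod p) * (v * (a l' j * y.1 - a l j * y.2)) +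
        a l j * (v * (a l i * y.2 - a l' i * y.1)) = v * u * y.1 := fun v => by rw [hu]; ring
    have h2 : ∀ v : ZMod p, (a l' i : ZMod p) * (v * (a l' j * y.1 - a l j * y.2)) +
        a l' j * (v * (a l i * y.2 - a l' i * y.1)) = v * u * y.2 := fun v => by rw [hu]; ring
    refine ⟨Pi.single i (u⁻¹ * (a l' j * y.1 - a l j * y.2)) +
      Pi.single j (u⁻¹ * (a l i * y.2 - a l' i * y.1)), Prod.ext ?_ ?_⟩
    · rw [hT, AddMonoidHom.prod_apply, map_add, formHom_single, formHom_single, h1,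
        inv_mul_cancel₀ hij, one_mul]
    · rw [hT, AddMonoidHom.prod_apply, map_add (formHom a p l'), formHom_single, formHom_single,
        h2, inv_mul_cancel₀ hij, one_mul]
  have h1 := card_fiber_mul T hsurj (-(b l : ZMod p), -(b l' : ZMod p))
  rw [card_fun_zmod, Nat.card_prod, Nat.card_zmod] at h1
  have h2 : Nat.card {x : ι → ZMod p // ∀ k ∈ B,
      ∑ i, (a k i : ZMod p) * x i + (b k : ZMod p) = 0} ≤
      Nat.card {x // T x = (-(b l : ZMod p), -(b l' : ZMod p))} := by
    refine Nat.card_le_card_of_injective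
      (fun x => ⟨x.1, Prod.ext (eq_neg_iff_add_eq_zero.2 (x.2 l hl))
        (eq_neg_iff_add_eq_zero.2 (x.2 l' hl'))⟩) fun x y hxy => ?_
    simpa [Subtype.ext_iff] using hxy
  rw [localDensity, div_le_iff₀ (by positivity), ← Nat.cast_pow p (Fintype.card ι), ← h1]
  push_cast
  rw [mul_comm, mul_assoc, ← sq, mul_inv_cancel₀ (by positivity), mul_one]
  exact_mod_cast h2

lemma abs_localDensity_sub_le (h₁ : ∀ l, ∃ i, (a l i : ZMod p) ≠ 0)
    (h₂ : ∀ l l', l ≠ l' → ∃ i j, (a l i * a l' j - a l j * a l' i : ZMod p) ≠ 0)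
    (B : Finset Λ) : |localDensity a b p B - (p : ℝ)⁻¹ ^ B.card| ≤ ((p : ℝ) ^ 2)⁻¹ := by
  have hp1 : (1 : ℝ) ≤ p := by exact_mod_cast hp.out.one_le
  obtain rfl | ⟨l, rfl⟩ | ⟨l, hl, l', hl', hne⟩ : B = ∅ ∨ (∃ l, B = {l}) ∨
      ∃ l ∈ B, ∃ l' ∈ B, l ≠ l' := by
    rcases Nat.lt_or_ge 1 B.card with h | h
    · obtain ⟨l, hl, l', hl', h⟩ := Finset.one_lt_card.1 h
      exact Or.inr (Or.inr ⟨l, hl, l', hl', h⟩)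
    · rcases Nat.le_one_iff_eq_zero_or_eq_one.1 h with h | h
      · exact Or.inl (Finset.card_eq_zero.1 h)
      · exact Or.inr (Or.inl (Finset.card_eq_one.1 h))
  · rw [localDensity_empty]; simp
  · rw [localDensity_singleton a b p (h₁ l)]; simp
  · have h3 := localDensity_le a b p hl hl' (h₂ l l' hne)
    have h4 : 0 ≤ localDensity a b p B := by unfold localDensity; positivity
    have h5 : (p : ℝ)⁻¹ ^ B.card ≤ ((p : ℝ) ^ 2)⁻¹ := by
      rw [← inv_pow]
      exact pow_le_pow_of_le_one (by positivity) (inv_le_one_of_one_le₀ hp1)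
        (Finset.one_lt_card.2 ⟨l, hl, l', hl', hne⟩)
    have h6 : 0 ≤ (p : ℝ)⁻¹ ^ B.card := by positivity
    rw [abs_le]
    constructor <;> linarith

end LocalDensity

section ChineseRemainder

variable {Λ ι : Type} [Fintype Λ] [DecidableEq Λ] [Fintype ι] [DecidableEq ι]

/-- The residues modulo `∏ p ∈ s, p` that reduce modulo every `p ∈ s` to a common zero of the
forms indexed by `B p`. -/
def crtSet (a : Λ → ι → ℤ) (b : Λ → ℤ) (s : Finset ℕ) (B : ℕ → Finset Λ) :
    Set (ι → ZMod (∏ p : s, (p : ℕ))) :=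
  {x | ∀ p : s, ∀ l ∈ B p, ∑ i, (a l i : ZMod p) *
    ZMod.castHom (Finset.dvd_prod_of_mem (fun p : s => (p : ℕ)) (Finset.mem_univ p)) (ZMod p) (x i) +
      (b l : ZMod p) = 0}

lemma card_crtSet (a : Λ → ι → ℤ) (b : Λ → ℤ) {s : Finset ℕ} (hs : ∀ p ∈ s, p.Prime)
    (B : ℕ → Finset Λ) :
    (Nat.card (crtSet a b s B) : ℝ) / ((∏ p : s, (p : ℕ) : ℕ) : ℝ) ^ Fintype.card ι =
      ∏ p ∈ s, localDensity a b p (B p) := by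
  have hcop : Pairwise (Function.onFun Nat.Coprime fun p : s => (p : ℕ)) := fun p q hpq =>
    (Nat.coprime_primes (hs p p.2) (hs q q.2)).2 fun h => hpq (Subtype.ext h)
  let Φ : (ι → ZMod (∏ p : s, (p : ℕ))) ≃ (∀ p : s, ι → ZMod p) :=
    ((Equiv.refl ι).arrowCongr (ZMod.prodEquivPi (fun p : s => (p : ℕ)) hcop).toEquiv).trans
      (Equiv.piComm _)
  have h1 : Nat.card (crtSet a b s B) = ∏ p : s, Nat.card {x : ι → ZMod p //
      ∀ l ∈ B p, ∑ i, (a l i : ZMod p) * x i + (b l : ZMod p) = 0} := by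
    rw [← Nat.card_pi]
    refine Nat.card_congr ((Φ.subtypeEquiv (q := fun y => ∀ p : s, ∀ l ∈ B p,
      ∑ i, (a l i : ZMod p) * y p i + (b l : ZMod p) = 0) fun x => ?_).trans
      (Equiv.subtypePiEquivPi (p := fun (p : s) (x : ι → ZMod p) => ∀ l ∈ B p,
        ∑ i, (a l i : ZMod p) * x i + (b l : ZMod p) = 0)))
    refine forall_congr' fun p => forall_congr' fun l => forall_congr' fun _ => ?_
    have : ∀ i, Φ x p i = ZMod.castHom
        (Finset.dvd_prod_of_mem (fun p : s => (p : ℕ)) (Finset.mem_univ p)) (ZMod p) (x i) :=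
      fun i => ZMod.prodEquivPi_apply _ hcop (x i) p
    simp only [this]
  rw [h1, ← Finset.prod_coe_sort s]
  unfold localDensity
  rw [Finset.prod_div_distrib]
  push_cast
  rw [Finset.prod_pow]

lemma intCast_mem_crtSet (a : Λ → ι → ℤ) (b : Λ → ℤ) (s : Finset ℕ) (B : ℕ → Finset Λ)
    (n : ι → ℤ) : (fun i => (n i : ZMod (∏ p : s, (p : ℕ)))) ∈ crtSet a b s B ↔
      ∀ p ∈ s, ∀ l ∈ B p, (p : ℤ) ∣ ∑ i, a l i * n i + b l := by
  rw [crtSet, Set.mem_ofPred_eq, Subtype.forall]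
  refine forall_congr' fun p => forall_congr' fun _ => forall_congr' fun l =>
    forall_congr' fun _ => ?_
  rw [← ZMod.intCast_zmod_eq_zero_iff_dvd]
  simp only [map_intCast]
  push_cast
  rfl

end ChineseRemainder

section Equidistribution

variable {ι : Type} [Fintype ι] [DecidableEq ι] {V : Type} [Fintype V]

/-- The weight `μ` is equidistributed in residue classes up to the error `κ`, when elements of
`V` are viewed as integers through `val`. -/
def Equidistributed (μ : V → ℝ) (val : V → ℤ) (κ : ℝ) : Prop :=
  ∀ q : ℕ, 0 < q → ∀ a : ZMod q,
    |(∑ v, if (val v : ZMod q) = a then μ v else 0) - (q : ℝ)⁻¹| ≤ κ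

lemma abs_prod_sub_prod_le_sum {α : Type*} (s : Finset α) {f g : α → ℝ}
    (hf₀ : ∀ i ∈ s, 0 ≤ f i) (hf₁ : ∀ i ∈ s, f i ≤ 1) (hg₀ : ∀ i ∈ s, 0 ≤ g i)
    (hg₁ : ∀ i ∈ s, g i ≤ 1) :
    |∏ i ∈ s, f i - ∏ i ∈ s, g i| ≤ ∑ i ∈ s, |f i - g i| := by
  classical
  induction s using Finset.induction_on with
  | empty => simp
  | insert i s hi ih =>
    simp only [Finset.forall_mem_insert] at hf₀ hf₁ hg₀ hg₁
    rw [Finset.prod_insert hi, Finset.prod_insert hi, Finset.sum_insert hi]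
    have h1 := ih hf₀.2 hf₁.2 hg₀.2 hg₁.2
    have h2 : f i * ∏ i ∈ s, f i - g i * ∏ i ∈ s, g i =
        (f i - g i) * ∏ i ∈ s, f i + g i * (∏ i ∈ s, f i - ∏ i ∈ s, g i) := by ring
    rw [h2]
    refine (abs_add_le _ _).trans (add_le_add ?_ ?_)
    · rw [abs_mul, abs_of_nonneg (Finset.prod_nonneg hf₀.2)]
      exact mul_le_of_le_one_right (abs_nonneg _) (Finset.prod_le_one hf₀.2 hf₁.2)
    · rw [abs_mul, abs_of_nonneg hg₀.1]
      exact (mul_le_of_le_one_left (abs_nonneg _) hg₁.1).trans h1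

open Classical in
lemma abs_wE_residues_sub_le {μ : ι → V → ℝ} (hμ : IsWeight μ) {val : V → ℤ} {κ : ℝ}
    (hκ : ∀ i, Equidistributed (μ i) val κ) {q : ℕ} (hq : 0 < q) (S : Set (ι → ZMod q)) :
    |wE μ (fun x => if (fun i => (val (x i) : ZMod q)) ∈ S then 1 else 0) -
      (Nat.card S : ℝ) / (q : ℝ) ^ Fintype.card ι| ≤
      (q : ℝ) ^ Fintype.card ι * (Fintype.card ι * κ) := by
  have : NeZero q := ⟨hq.ne'⟩
  have hq1 : (1 : ℝ) ≤ q := by exact_mod_cast hq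
  have hκ0 : ∀ i : ι, 0 ≤ κ := fun i => (abs_nonneg _).trans (hκ i q hq 0)
  set T : Finset (ι → ZMod q) := Finset.univ.filter (· ∈ S) with hT
  have hcard : Nat.card S = T.card := by
    rw [Nat.card_eq_fintype_card, ← Set.toFinset_card]
    congr 1
    ext; simp [hT]
  set p : ι → ZMod q → ℝ := fun i a => ∑ v, if (val v : ZMod q) = a then μ i v else 0 with hp
  have h1 : wE μ (fun x => if (fun i => (val (x i) : ZMod q)) ∈ S then 1 else 0) =
      ∑ a ∈ T, ∏ i, p i (a i) := by
    have h2 : ∀ a : ι → ZMod q, ∏ i, p i (a i) =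
        ∑ x : ι → V, (∏ i, μ i (x i)) * if (fun i => (val (x i) : ZMod q)) = a then 1 else 0 :=
      fun a => by
        rw [hp, Finset.prod_univ_sum, Fintype.piFinset_univ]
        refine Finset.sum_congr rfl fun x _ => ?_
        split_ifs with hx
        · rw [mul_one]
          exact Finset.prod_congr rfl fun i _ => if_pos (congrFun hx i)
        · obtain ⟨i, hi⟩ := Function.ne_iff.1 hx
          rw [mul_zero]
          exact Finset.prod_eq_zero (Finset.mem_univ i) (if_neg hi)
    simp only [h2]
    rw [Finset.sum_comm, wE]
    refine Finset.sum_congr rfl fun x _ => ?_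
    rw [← Finset.mul_sum, Finset.sum_ite_eq]
    simp [hT]
  have hp0 : ∀ i a, 0 ≤ p i a := fun i a => Finset.sum_nonneg fun v _ => by
    split_ifs
    exacts [hμ.nonneg i v, le_rfl]
  have hp1 : ∀ i a, p i a ≤ 1 := fun i a => by
    rw [← hμ.sum_one i]
    exact Finset.sum_le_sum fun v _ => by
      split_ifs
      exacts [le_rfl, hμ.nonneg i v]
  have h3 : ∀ a ∈ T, |∏ i, p i (a i) - ∏ _i : ι, (q : ℝ)⁻¹| ≤ Fintype.card ι * κ := fun a _ => by
    refine (abs_prod_sub_prod_le_sum _ (fun i _ => hp0 i _) (fun i _ => hp1 i _)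
      (fun i _ => by positivity) (fun i _ => inv_le_one_of_one_le₀ hq1)).trans ?_
    refine (Finset.sum_le_card_nsmul _ _ κ fun i _ => hκ i q hq (a i)).trans_eq ?_
    rw [Finset.card_univ, nsmul_eq_mul]
  have h4 : (Nat.card S : ℝ) / (q : ℝ) ^ Fintype.card ι = ∑ a ∈ T, ∏ _i : ι, (q : ℝ)⁻¹ := by
    rw [Finset.sum_const, nsmul_eq_mul, Finset.prod_const, Finset.card_univ, hcard, inv_pow,
      div_eq_mul_inv]
  rw [h1, h4, ← Finset.sum_sub_distrib]
  refine (Finset.abs_sum_le_sum_abs _ _).trans ((Finset.sum_le_card_nsmul _ _ _ h3).trans ?_)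
  rw [nsmul_eq_mul]
  refine mul_le_mul_of_nonneg_right ?_ ?_
  · have : T.card ≤ q ^ Fintype.card ι := by
      refine (Finset.card_le_univ _).trans_eq ?_
      rw [Fintype.card_fun, ZMod.card]
    exact_mod_cast this
  · rcases isEmpty_or_nonempty ι with h | ⟨⟨i⟩⟩
    · simp
    · exact mul_nonneg (by positivity) (hκ0 i)

end Equidistribution

section SieveLinearForms

variable {Λ ι : Type} [Fintype Λ] [DecidableEq Λ] [Fintype ι] [DecidableEq ι]
  {V : Type} [Fintype V] {P : Finset ℕ} {R : ℕ}

lemma card_sieveLevel_le (hP : ∀ p ∈ P, p.Prime) : (sieveLevel P R).card ≤ R := by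
  have h1 : Set.MapsTo (fun m : Finset ℕ => ∏ p ∈ m, p) (sieveLevel P R) (Finset.Icc 1 R) :=
    fun m hm => by
      have hm' := mem_sieveLevel.1 (Finset.mem_coe.1 hm)
      rw [Finset.mem_coe, Finset.mem_Icc]
      exact ⟨Finset.prod_pos fun p hp => (hP p (hm'.1 hp)).pos, hm'.2⟩
  refine (Finset.card_le_card_of_injOn _ h1 fun m hm m' hm' hmm => ?_).trans_eq (by simp)
  have hm := mem_sieveLevel.1 (Finset.mem_coe.1 hm)
  have hm' := mem_sieveLevel.1 (Finset.mem_coe.1 hm')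
  rw [← Nat.primeFactors_prod fun p hp => hP p (hm.1 hp),
    ← Nat.primeFactors_prod fun p hp => hP p (hm'.1 hp)]
  exact congrArg Nat.primeFactors hmm

lemma sieveMass_le (hP : ∀ p ∈ P, p.Prime) : sieveMass P R ≤ R := by
  have h2 : ∀ p ∈ P, 2 ≤ p := fun p hp => (hP p hp).two_le
  have h1 : sieveMass P R ≤ (sieveLevel P R).card • (1 : ℝ) :=
    Finset.sum_le_card_nsmul _ _ _ fun m hm =>
      inv_le_one_of_one_le₀ (one_le_eulerProd h2 (mem_sieveLevel.1 hm).1)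
  rw [nsmul_eq_mul, mul_one] at h1
  exact h1.trans (by exact_mod_cast card_sieveLevel_le hP)

/-- The families of pairs of sets of product at most `R`. -/
def levelPairs (Λ : Type) [Fintype Λ] [DecidableEq Λ] (P : Finset ℕ) (R : ℕ) :
    Finset (Λ → Finset ℕ × Finset ℕ) :=
  Fintype.piFinset fun _ => sieveLevel P R ×ˢ sieveLevel P R

lemma mem_levelPairs {D : Λ → Finset ℕ × Finset ℕ} :
    D ∈ levelPairs Λ P R ↔ ∀ l, (D l).1 ∈ sieveLevel P R ∧ (D l).2 ∈ sieveLevel P R := by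
  simp [levelPairs, Fintype.mem_piFinset, Finset.mem_product]

lemma sum_subsetPairs_eq (hP : ∀ p ∈ P, 2 ≤ p) (F : (Λ → Finset ℕ × Finset ℕ) → ℝ) :
    ∑ D ∈ subsetPairs Λ P, (∏ l, sieveCoeff P R (D l).1 * sieveCoeff P R (D l).2) * F D =
    ∑ D ∈ levelPairs Λ P R, (∏ l, sieveCoeff P R (D l).1 * sieveCoeff P R (D l).2) * F D := by
  symm
  refine Finset.sum_subset (fun D hD => ?_) fun D _ hD => ?_
  · rw [mem_levelPairs] at hD
    exact mem_subsetPairs.2 fun l =>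
      ⟨(mem_sieveLevel.1 (hD l).1).1, (mem_sieveLevel.1 (hD l).2).1⟩
  · rw [mem_levelPairs, not_forall] at hD
    obtain ⟨l, hl⟩ := hD
    rw [not_and_or] at hl
    refine mul_eq_zero_of_left (Finset.prod_eq_zero (Finset.mem_univ l) ?_) _
    rcases hl with hl | hl
    · rw [sieveCoeff_eq_zero hP hl, zero_mul]
    · rw [sieveCoeff_eq_zero hP hl, mul_zero]

open Classical in
lemma prod_sieve_eq (n : Λ → ℤ) : ∏ l, sieve P R (n l) = sieveMass P R ^ Fintype.card Λ *
    ∑ D ∈ subsetPairs Λ P, (∏ l, sieveCoeff P R (D l).1 * sieveCoeff P R (D l).2) *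
      if ∀ l, ∀ p ∈ (D l).1 ∪ (D l).2, (p : ℤ) ∣ n l then 1 else 0 := by
  unfold sieve
  rw [Finset.prod_mul_distrib, Finset.prod_const, Finset.card_univ]
  congr 1
  simp only [sq, Finset.sum_mul_sum, ← Finset.sum_product']
  rw [Finset.prod_univ_sum, subsetPairs]
  refine Finset.sum_congr rfl fun D _ => ?_
  split_ifs with h
  · rw [mul_one]
    refine Finset.prod_congr rfl fun l _ => ?_
    rw [if_pos fun p hp => h l p (Finset.mem_union_left _ hp),
      if_pos fun p hp => h l p (Finset.mem_union_right _ hp)]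
  · rw [mul_zero]
    push Not at h
    obtain ⟨l, p, hp, hpn⟩ := h
    refine Finset.prod_eq_zero (Finset.mem_univ l) ?_
    rcases Finset.mem_union.1 hp with hp | hp
    · exact mul_eq_zero_of_left (if_neg fun h => hpn (h p hp)) _
    · exact mul_eq_zero_of_right _ (if_neg fun h => hpn (h p hp))

open Classical in
lemma abs_wE_dvd_sub_le {μ : ι → V → ℝ} (hμ : IsWeight μ) {val : V → ℤ} {κ : ℝ} (hκ0 : 0 ≤ κ)
    (hκ : ∀ i, Equidistributed (μ i) val κ) (hP : ∀ p ∈ P, p.Prime) (a : Λ → ι → ℤ) (b : Λ → ℤ)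
    {D : Λ → Finset ℕ × Finset ℕ} (hD : D ∈ levelPairs Λ P R) :
    |wE μ (fun x => if ∀ l, ∀ p ∈ (D l).1 ∪ (D l).2, (p : ℤ) ∣ ∑ i, a l i * val (x i) + b l
      then 1 else 0) - ∏ p ∈ P, localDensity a b p (sieveHit D p)| ≤
      ((R : ℝ) ^ (2 * Fintype.card Λ)) ^ Fintype.card ι * (Fintype.card ι * κ) := by
  rw [mem_levelPairs] at hD
  set s : Finset ℕ := Finset.univ.biUnion fun l => (D l).1 ∪ (D l).2 with hs
  have hmem : ∀ p, p ∈ s ↔ ∃ l, p ∈ (D l).1 ∪ (D l).2 := fun p => by simp [hs]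
  have hsP : s ⊆ P := fun p hp => by
    obtain ⟨l, hl⟩ := (hmem p).1 hp
    rcases Finset.mem_union.1 hl with h | h
    · exact (mem_sieveLevel.1 (hD l).1).1 h
    · exact (mem_sieveLevel.1 (hD l).2).1 h
  have hsp : ∀ p ∈ s, p.Prime := fun p hp => hP p (hsP hp)
  have h1 : ∏ p ∈ P, localDensity a b p (sieveHit D p) =
      ∏ p ∈ s, localDensity a b p (sieveHit D p) := by
    symm
    refine Finset.prod_subset hsP fun p hp hps => ?_
    have : Fact p.Prime := ⟨hP p hp⟩
    have h2 : sieveHit D p = ∅ := by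
      rw [sieveHit, Finset.filter_eq_empty_iff]
      exact fun l _ h => hps ((hmem p).2 ⟨l, h⟩)
    rw [h2, localDensity_empty]
  have h2 : ∀ x : ι → V, (∀ l, ∀ p ∈ (D l).1 ∪ (D l).2, (p : ℤ) ∣ ∑ i, a l i * val (x i) + b l) ↔
      (fun i => (val (x i) : ZMod (∏ p : s, (p : ℕ)))) ∈ crtSet a b s (sieveHit D) := fun x => by
    rw [intCast_mem_crtSet]
    constructor
    · intro h p _ l hl
      exact h l p (Finset.mem_filter.1 hl).2
    · intro h l p hp
      exact h p ((hmem p).2 ⟨l, hp⟩) l (Finset.mem_filter.2 ⟨Finset.mem_univ _, hp⟩)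
  have hq : 0 < ∏ p : s, (p : ℕ) := Finset.prod_pos fun p _ => (hsp p p.2).pos
  have hqR : ∏ p : s, (p : ℕ) ≤ R ^ (2 * Fintype.card Λ) := by
    have hpos : ∀ l, 0 < (∏ p ∈ (D l).1, p) * ∏ p ∈ (D l).2, p := fun l => Nat.mul_pos
      (Finset.prod_pos fun p hp => (hP p ((mem_sieveLevel.1 (hD l).1).1 hp)).pos)
      (Finset.prod_pos fun p hp => (hP p ((mem_sieveLevel.1 (hD l).2).1 hp)).pos)
    have h3 : ∏ p ∈ s, p ∣ ∏ l, (∏ p ∈ (D l).1, p) * ∏ p ∈ (D l).2, p := by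
      refine Finset.prod_primes_dvd _ (fun p hp => (hsp p hp).prime) fun p hp => ?_
      obtain ⟨l, hl⟩ := (hmem p).1 hp
      refine dvd_trans ?_ (Finset.dvd_prod_of_mem _ (Finset.mem_univ l))
      rcases Finset.mem_union.1 hl with h | h
      · exact (Finset.dvd_prod_of_mem (fun p => p) h).mul_right _
      · exact (Finset.dvd_prod_of_mem (fun p => p) h).mul_left _
    rw [Finset.prod_coe_sort s fun p => p]
    refine (Nat.le_of_dvd (Finset.prod_pos fun l _ => hpos l) h3).trans ?_
    refine (Finset.prod_le_prod' fun l _ => Nat.mul_le_mul (mem_sieveLevel.1 (hD l).1).2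
      (mem_sieveLevel.1 (hD l).2).2).trans_eq ?_
    rw [Finset.prod_const, Finset.card_univ, ← sq, pow_mul]
  have hqR' : ((∏ p : s, (p : ℕ) : ℕ) : ℝ) ≤ (R : ℝ) ^ (2 * Fintype.card Λ) := by
    exact_mod_cast hqR
  simp only [h2]
  rw [h1, ← card_crtSet a b hsp]
  refine (abs_wE_residues_sub_le hμ hκ hq _).trans ?_
  exact mul_le_mul_of_nonneg_right (pow_le_pow_left₀ (by positivity) hqR' _) (by positivity)

/-- The linear forms estimate for the Selberg sieve. -/
theorem abs_wE_prod_sieve_sub_one_le {μ : ι → V → ℝ} (hμ : IsWeight μ) {val : V → ℤ} {κ : ℝ}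
    (hκ0 : 0 ≤ κ) (hκ : ∀ i, Equidistributed (μ i) val κ) (hP : ∀ p ∈ P, p.Prime) (hR : 1 ≤ R)
    (a : Λ → ι → ℤ) (b : Λ → ℤ) (h₁ : ∀ p ∈ P, ∀ l, ∃ i, (a l i : ZMod p) ≠ 0)
    (h₂ : ∀ p ∈ P, ∀ l l', l ≠ l' →
      ∃ i j, (a l i * a l' j - a l j * a l' i : ZMod p) ≠ 0) :
    |wE μ (fun x => ∏ l, sieve P R (∑ i, a l i * val (x i) + b l)) - 1| ≤
      (∏ p ∈ P, (1 + 64 ^ Fintype.card Λ * ((p : ℝ) ^ 2)⁻¹) - 1) +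
      (R : ℝ) ^ (5 * Fintype.card Λ + 2 * Fintype.card Λ * Fintype.card ι) *
        (Fintype.card ι * κ) := by
  classical
  have hP2 : ∀ p ∈ P, 2 ≤ p := fun p hp => (hP p hp).two_le
  have hV := one_le_sieveMass hP2 hR
  set L := Fintype.card Λ with hL
  set n := Fintype.card ι with hn
  have hmain := abs_sieve_main_sub_one_le (Λ := Λ) hP2 hR (localDensity a b)
    fun p hp B => by
      have : Fact p.Prime := ⟨hP p hp⟩
      exact abs_localDensity_sub_le a b p (h₁ p hp) (h₂ p hp) B
  rw [sum_subsetPairs_eq hP2] at hmain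
  simp only [prod_sieve_eq, sum_subsetPairs_eq hP2]
  rw [wE_const_mul, wE_sum]
  simp only [wE_const_mul]
  have herr : |sieveMass P R ^ L * (∑ D ∈ levelPairs Λ P R,
      (∏ l, sieveCoeff P R (D l).1 * sieveCoeff P R (D l).2) *
        wE μ (fun x => if ∀ l, ∀ p ∈ (D l).1 ∪ (D l).2, (p : ℤ) ∣ ∑ i, a l i * val (x i) + b l
          then 1 else 0)) - sieveMass P R ^ L * (∑ D ∈ levelPairs Λ P R,
      (∏ l, sieveCoeff P R (D l).1 * sieveCoeff P R (D l).2) *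
        ∏ p ∈ P, localDensity a b p (sieveHit D p))| ≤
      (R : ℝ) ^ (5 * L + 2 * L * n) * (n * κ) := by
    rw [← mul_sub, ← Finset.sum_sub_distrib, abs_mul, abs_of_nonneg (by positivity)]
    have h3 : ∀ D ∈ levelPairs Λ P R, |(∏ l, sieveCoeff P R (D l).1 * sieveCoeff P R (D l).2) *
        wE μ (fun x => if ∀ l, ∀ p ∈ (D l).1 ∪ (D l).2, (p : ℤ) ∣ ∑ i, a l i * val (x i) + b l
          then 1 else 0) - (∏ l, sieveCoeff P R (D l).1 * sieveCoeff P R (D l).2) *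
        ∏ p ∈ P, localDensity a b p (sieveHit D p)| ≤
        ((R : ℝ) ^ 2) ^ L * (((R : ℝ) ^ (2 * L)) ^ n * (n * κ)) := fun D hD => by
      rw [← mul_sub, abs_mul, Finset.abs_prod]
      refine mul_le_mul ?_ (abs_wE_dvd_sub_le hμ hκ0 hκ hP a b hD) (abs_nonneg _) (by positivity)
      refine (Finset.prod_le_prod (fun l _ => abs_nonneg _) fun l _ => (?_ : _ ≤ (R : ℝ) ^ 2)).trans_eq ?_
      · rw [abs_mul, sq]
        exact mul_le_mul (abs_sieveCoeff_le hP2 hR _) (abs_sieveCoeff_le hP2 hR _) (abs_nonneg _)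
          (by positivity)
      · rw [Finset.prod_const, Finset.card_univ]
    have h4 : ((levelPairs Λ P R).card : ℝ) ≤ ((R : ℝ) ^ 2) ^ L := by
      rw [levelPairs, Fintype.card_piFinset, Finset.prod_const, Finset.card_product,
        Finset.card_univ]
      have : ((sieveLevel P R).card : ℝ) ≤ R := by exact_mod_cast card_sieveLevel_le hP
      push_cast
      rw [← sq]
      gcongr
    have h5 : sieveMass P R ^ L ≤ (R : ℝ) ^ L :=
      pow_le_pow_left₀ (by positivity) (sieveMass_le hP) _
    refine (mul_le_mul_of_nonneg_left ((Finset.abs_sum_le_sum_abs _ _).trans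
      (Finset.sum_le_card_nsmul _ _ _ h3)) (by positivity)).trans ?_
    rw [nsmul_eq_mul]
    refine (mul_le_mul h5 (mul_le_mul_of_nonneg_right h4 (by positivity)) (by positivity)
      (by positivity)).trans_eq ?_
    rw [← pow_mul, ← pow_mul, pow_add, show 5 * L = L + 2 * L + 2 * L by ring, pow_add, pow_add]
    ring
  rw [add_comm]
  exact (abs_sub_le _ _ _).trans (add_le_add herr hmain)

end SieveLinearForms

section SieveMass

/-- The primes in the interval `(w, R]`. -/
def sievePrimes (w R : ℕ) : Finset ℕ := (Finset.Ioc w R).filter Nat.Prime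

lemma mem_sievePrimes {w R p : ℕ} : p ∈ sievePrimes w R ↔ (w < p ∧ p ≤ R) ∧ p.Prime := by
  simp [sievePrimes]

lemma prod_sievePrimes_sub_one_le {w : ℕ} (hw : 1 ≤ w) (R : ℕ) {C : ℝ} (hC : 0 ≤ C) :
    ∏ p ∈ sievePrimes w R, (1 + C * ((p : ℝ) ^ 2)⁻¹) - 1 ≤ Real.exp (C / w) - 1 := by
  have hsum : ∑ p ∈ sievePrimes w R, ((p : ℝ) ^ 2)⁻¹ ≤ (w : ℝ)⁻¹ := by
    have h1 : ∑ p ∈ sievePrimes w R, ((p : ℝ) ^ 2)⁻¹ ≤ ∑ p ∈ Finset.Ioc w R, ((p : ℝ) ^ 2)⁻¹ :=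
      Finset.sum_le_sum_of_subset_of_nonneg (Finset.filter_subset _ _) fun _ _ _ => by positivity
    rcases le_total w R with h | h
    · have h2 := sum_Ioc_inv_sq_le_sub (α := ℝ) (show w ≠ 0 by omega) h
      have : (0 : ℝ) ≤ (R : ℝ)⁻¹ := by positivity
      linarith
    · rw [Finset.Ioc_eq_empty (by omega), Finset.sum_empty] at h1
      exact h1.trans (by positivity)
  have h2 : ∏ p ∈ sievePrimes w R, (1 + C * ((p : ℝ) ^ 2)⁻¹) ≤ Real.exp (C / w) := by
    refine (Finset.prod_le_prod (fun p _ => by positivity) fun p _ =>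
      (add_comm (1 : ℝ) _).trans_le (Real.add_one_le_exp _)).trans ?_
    rw [← Real.exp_sum, ← Finset.mul_sum, div_eq_mul_inv]
    exact Real.exp_le_exp.2 (mul_le_mul_of_nonneg_left hsum hC)
  linarith

lemma sum_Icc_inv_pow_le {p : ℕ} (hp : 2 ≤ p) (R : ℕ) :
    ∑ e ∈ Finset.Icc 1 R, ((p : ℝ) ^ e)⁻¹ ≤ ((p : ℝ) - 1)⁻¹ := by
  have hp' : (2 : ℝ) ≤ p := by exact_mod_cast hp
  have h0 : (p : ℝ) - 1 ≠ 0 := by linarith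
  have h1 : ∑ e ∈ Finset.Icc 1 R, ((p : ℝ) ^ e)⁻¹ =
      ((p : ℝ) - 1)⁻¹ * (1 - ((p : ℝ) ^ R)⁻¹) := by
    induction R with
    | zero => simp
    | succ n ih =>
      rw [Finset.sum_Icc_succ_top (by omega), ih, pow_succ]
      field_simp
      ring
  rw [h1]
  refine mul_le_of_le_one_right (inv_nonneg.2 (by linarith)) ?_
  have : (0 : ℝ) ≤ ((p : ℝ) ^ R)⁻¹ := by positivity
  linarith

lemma sum_inv_le_eulerProd_inv (R : ℕ) (s : Finset ℕ) (hs : ∀ p ∈ s, p.Prime) :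
    ∑ k ∈ (Finset.Icc 1 R).filter (fun k => k.primeFactors = s), (k : ℝ)⁻¹ ≤ (eulerProd s)⁻¹ := by
  classical
  have h1 : ∏ p ∈ s, ∑ e ∈ Finset.Icc 1 R, ((p : ℝ) ^ e)⁻¹ ≤ (eulerProd s)⁻¹ := by
    rw [eulerProd, ← Finset.prod_inv_distrib]
    exact Finset.prod_le_prod (fun p _ => Finset.sum_nonneg fun _ _ => by positivity)
      fun p hp => sum_Icc_inv_pow_le (hs p hp).two_le R
  refine le_trans ?_ h1
  rw [Finset.prod_sum]
  set Φ : ℕ → (p : ℕ) → p ∈ s → ℕ := fun k p _ => k.factorization p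
  have hk : ∀ k ∈ (Finset.Icc 1 R).filter (fun k => k.primeFactors = s),
      ∏ x ∈ s.attach, x.1 ^ Φ k x.1 x.2 = k := fun k hk => by
    obtain ⟨hk1, hks⟩ := Finset.mem_filter.1 hk
    have hk0 : k ≠ 0 := by have := (Finset.mem_Icc.1 hk1).1; omega
    rw [Finset.prod_attach s fun p => p ^ k.factorization p, ← hks]
    exact Nat.prod_factorization_pow_eq_self hk0
  have h2 : ∑ k ∈ (Finset.Icc 1 R).filter (fun k => k.primeFactors = s), (k : ℝ)⁻¹ =
      ∑ k ∈ (Finset.Icc 1 R).filter (fun k => k.primeFactors = s),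
        ∏ x ∈ s.attach, ((x.1 : ℝ) ^ Φ k x.1 x.2)⁻¹ :=
    Finset.sum_congr rfl fun k hk' => by
      conv_lhs => rw [← hk k hk']
      rw [Finset.prod_inv_distrib]
      push_cast
      rfl
  rw [h2, ← Finset.sum_image (s := (Finset.Icc 1 R).filter (fun k => k.primeFactors = s)) (g := Φ)
    (f := fun g => ∏ x ∈ s.attach, ((x.1 : ℝ) ^ g x.1 x.2)⁻¹)]
  · refine Finset.sum_le_sum_of_subset_of_nonneg (fun g hg => ?_) fun _ _ _ =>
      Finset.prod_nonneg fun _ _ => by positivity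
    obtain ⟨k, hk', rfl⟩ := Finset.mem_image.1 hg
    obtain ⟨hk1, hks⟩ := Finset.mem_filter.1 hk'
    obtain ⟨hk1, hkR⟩ := Finset.mem_Icc.1 hk1
    rw [Finset.mem_pi]
    intro p hp
    rw [Finset.mem_Icc]
    refine ⟨(hs p hp).factorization_pos_of_dvd (by omega) ?_, ?_⟩
    · exact Nat.dvd_of_mem_primeFactors (hks ▸ hp)
    · exact (Nat.factorization_lt p (by omega)).le.trans hkR
  · intro k hk₁ k' hk₂ h
    rw [← hk k hk₁, ← hk k' hk₂, h]

lemma log_le_sieveMass_primes (R : ℕ) : Real.log (R + 1) ≤ sieveMass (sievePrimes 0 R) R := by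
  classical
  have h1 := log_add_one_le_harmonic R
  rw [harmonic_eq_sum_Icc] at h1
  push_cast at h1
  refine h1.trans ?_
  rw [sieveMass, ← Finset.sum_fiberwise_of_maps_to (t := sieveLevel (sievePrimes 0 R) R)
    (g := Nat.primeFactors)]
  · exact Finset.sum_le_sum fun s hs => sum_inv_le_eulerProd_inv R s fun p hp =>
      (mem_sievePrimes.1 ((mem_sieveLevel.1 hs).1 hp)).2
  · intro k hk
    obtain ⟨hk1, hkR⟩ := Finset.mem_Icc.1 hk
    rw [mem_sieveLevel]
    refine ⟨fun p hp => mem_sievePrimes.2 ⟨⟨(Nat.prime_of_mem_primeFactors hp).pos, ?_⟩,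
      Nat.prime_of_mem_primeFactors hp⟩, ?_⟩
    · exact (Nat.le_of_mem_primeFactors hp).trans hkR
    · exact (Nat.le_of_dvd (by omega) (Nat.prod_primeFactors_dvd k)).trans hkR

lemma sieveMass_le_sum_mul (w R : ℕ) : sieveMass (sievePrimes 0 R) R ≤
    (∑ s ∈ (sievePrimes 0 w).powerset, (eulerProd s)⁻¹) * sieveMass (sievePrimes w R) R := by
  classical
  have hpr : ∀ w' R', ∀ p ∈ sievePrimes w' R', 2 ≤ p := fun _ _ p hp =>
    (mem_sievePrimes.1 hp).2.two_le
  rw [sieveMass, sieveMass, Finset.sum_mul_sum, ← Finset.sum_product']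
  set Ψ : Finset ℕ → Finset ℕ × Finset ℕ := fun m => (m.filter (· ≤ w), m.filter (w < ·))
  have hunion : ∀ m : Finset ℕ, m.filter (· ≤ w) ∪ m.filter (w < ·) = m := fun m => by
    ext p; simp only [Finset.mem_union, Finset.mem_filter]
    have := le_or_gt p w
    tauto
  have hdisj : ∀ m : Finset ℕ, Disjoint (m.filter (· ≤ w)) (m.filter (w < ·)) := fun m =>
    Finset.disjoint_left.2 fun p hp hp' => by
      have h1 := (Finset.mem_filter.1 hp).2
      have h2 := (Finset.mem_filter.1 hp').2
      omega
  have hinj : Set.InjOn Ψ (sieveLevel (sievePrimes 0 R) R) := fun m _ m' _ h => by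
    rw [← hunion m, ← hunion m']
    exact congrArg₂ (· ∪ ·) (Prod.ext_iff.1 h).1 (Prod.ext_iff.1 h).2
  have hsum : ∀ m ∈ sieveLevel (sievePrimes 0 R) R,
      (eulerProd m)⁻¹ = (eulerProd (Ψ m).1)⁻¹ * (eulerProd (Ψ m).2)⁻¹ := fun m _ => by
    conv_lhs => rw [← hunion m, eulerProd, Finset.prod_union (hdisj m), mul_inv]
    rfl
  rw [Finset.sum_congr rfl hsum, ← Finset.sum_image (s := sieveLevel (sievePrimes 0 R) R) (g := Ψ)
    (f := fun x => (eulerProd x.1)⁻¹ * (eulerProd x.2)⁻¹) hinj]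
  refine Finset.sum_le_sum_of_subset_of_nonneg (fun x hx => ?_) fun x hx _ => ?_
  · obtain ⟨m, hm, rfl⟩ := Finset.mem_image.1 hx
    obtain ⟨hm1, hm2⟩ := mem_sieveLevel.1 hm
    refine Finset.mem_product.2 ⟨Finset.mem_powerset.2 fun p hp => ?_,
      mem_sieveLevel.2 ⟨fun p hp => ?_, ?_⟩⟩
    · obtain ⟨hpm, hpw⟩ := Finset.mem_filter.1 hp
      obtain ⟨⟨h1, h2⟩, h3⟩ := mem_sievePrimes.1 (hm1 hpm)
      exact mem_sievePrimes.2 ⟨⟨h1, hpw⟩, h3⟩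
    · obtain ⟨hpm, hpw⟩ := Finset.mem_filter.1 hp
      obtain ⟨⟨h1, h2⟩, h3⟩ := mem_sievePrimes.1 (hm1 hpm)
      exact mem_sievePrimes.2 ⟨⟨hpw, h2⟩, h3⟩
    · exact (mem_sieveLevel.1 (subset_mem_sieveLevel (hpr 0 R) hm (Finset.filter_subset _ _))).2
  · obtain ⟨h1, h2⟩ := Finset.mem_product.1 hx
    exact mul_nonneg (inv_nonneg.2 (eulerProd_pos (hpr _ _) (Finset.mem_powerset.1 h1)).le)
      (eulerProd_inv_nonneg (hpr _ _) h2)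

lemma primorial_eq_prod_sievePrimes (w : ℕ) : primorial w = ∏ p ∈ sievePrimes 0 w, p := by
  refine Finset.prod_congr (Finset.ext fun p => ?_) fun _ _ => rfl
  simp only [Finset.mem_filter, Finset.mem_range, mem_sievePrimes]
  constructor
  · exact fun h => ⟨⟨h.2.pos, by omega⟩, h.2⟩
  · exact fun h => ⟨by omega, h.2⟩

lemma sum_powerset_eulerProd_inv_mul_totient (w : ℕ) :
    (∑ s ∈ (sievePrimes 0 w).powerset, (eulerProd s)⁻¹) * (Nat.totient (primorial w) : ℝ) =
      primorial w := by
  have h1 : ∑ s ∈ (sievePrimes 0 w).powerset, (eulerProd s)⁻¹ =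
      ∏ p ∈ sievePrimes 0 w, (1 + ((p : ℝ) - 1)⁻¹) := by
    rw [Finset.prod_one_add]
    exact Finset.sum_congr rfl fun s _ => by rw [eulerProd, Finset.prod_inv_distrib]
  have h2 : (Nat.totient (primorial w) : ℝ) =
      primorial w * ∏ p ∈ sievePrimes 0 w, (1 - (p : ℝ)⁻¹) := by
    have h3 := Nat.totient_eq_mul_prod_factors (primorial w)
    rw [primorial_eq_prod_sievePrimes w,
      Nat.primeFactors_prod fun p hp => (mem_sievePrimes.1 hp).2] at h3
    rw [primorial_eq_prod_sievePrimes w]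
    have h4 := congrArg (Rat.cast (K := ℝ)) h3
    push_cast at h4 ⊢
    exact h4
  rw [h1, h2, mul_left_comm, ← Finset.prod_mul_distrib, Finset.prod_eq_one, mul_one]
  intro p hp
  have : (2 : ℝ) ≤ p := by exact_mod_cast (mem_sievePrimes.1 hp).2.two_le
  have h0 : (p : ℝ) - 1 ≠ 0 := by linarith
  field_simp
  ring

/-- The lower bound for the mass of the Selberg sieve by primes in `(w, R]`. -/
theorem totient_mul_log_le_sieveMass (w R : ℕ) :
    (Nat.totient (primorial w) : ℝ) * Real.log (R + 1) ≤
      primorial w * sieveMass (sievePrimes w R) R := by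
  rw [← sum_powerset_eulerProd_inv_mul_totient w, mul_right_comm, mul_comm]
  exact mul_le_mul_of_nonneg_right ((log_le_sieveMass_primes R).trans (sieveMass_le_sum_mul w R))
    (by positivity)

end SieveMass

section Reweighting

variable {ι : Type} [Fintype ι] [DecidableEq ι] {V : Type} [Fintype V]

/-- The weight `u` multiplied by the density `g` and normalised. -/
noncomputable def reweight (u g : ι → V → ℝ) (i : ι) (v : V) : ℝ :=
  u i v * g i v / ∑ v, u i v * g i v

lemma isWeight_reweight {u g : ι → V → ℝ} (hu : ∀ i v, 0 ≤ u i v) (hg : ∀ i v, 0 ≤ g i v)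
    (hc : ∀ i, 0 < ∑ v, u i v * g i v) : IsWeight (reweight u g) where
  nonneg i v := div_nonneg (mul_nonneg (hu i v) (hg i v)) (hc i).le
  sum_one i := by
    simp only [reweight]
    rw [← Finset.sum_div, div_self (hc i).ne']

lemma wE_reweight (u g : ι → V → ℝ) (F : (ι → V) → ℝ) :
    wE (reweight u g) F =
      wE u (fun x => (∏ i, g i (x i)) * F x) / ∏ i, ∑ v, u i v * g i v := by
  unfold wE
  rw [Finset.sum_div]
  refine Finset.sum_congr rfl fun x _ => ?_
  simp only [reweight]
  rw [Finset.prod_div_distrib, Finset.prod_mul_distrib]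
  ring

lemma wE_wE_reweight (u g : ι → V → ℝ) (F : (ι → V) → (ι → V) → ℝ) :
    wE (reweight u g) (fun x => wE (reweight u g) fun y => F x y) =
      wE u (fun x => wE u fun y => (∏ i, g i (x i) * g i (y i)) * F x y) /
        (∏ i, ∑ v, u i v * g i v) ^ 2 := by
  rw [wE_reweight]
  simp only [wE_reweight u g]
  rw [sq, ← div_div]
  congr 1
  rw [div_eq_mul_inv, ← wE_mul_const]
  congr 1
  funext x
  rw [div_eq_mul_inv, ← mul_assoc, ← wE_const_mul]
  congr 2
  funext y
  rw [Finset.prod_mul_distrib]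
  ring

lemma sum_le_wE_of_dependsOn {μ : ι → V → ℝ} (hμ : IsWeight μ) {F : (ι → V) → ℝ}
    (hF : ∀ x, 0 ≤ F x) {i : ι} (hFi : DependsOn F {i}ᶜ) {β : Type*} (S : Finset β)
    (pt : β → ι → V) (hpt : ∀ a ∈ S, ∀ b ∈ S, (∀ k, k ≠ i → pt a k = pt b k) → a = b) :
    ∑ a ∈ S, (∏ k ∈ Finset.univ.erase i, μ k (pt a k)) * F (pt a) ≤ wE μ F := by
  classical
  have h1 : ∀ a ∈ S, (∏ k ∈ Finset.univ.erase i, μ k (pt a k)) * F (pt a) =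
      ∑ v : V, (∏ k, μ k (Function.update (pt a) i v k)) * F (Function.update (pt a) i v) :=
    fun a _ => by
      have h2 : ∀ v, (∏ k, μ k (Function.update (pt a) i v k)) *
          F (Function.update (pt a) i v) =
          μ i v * ((∏ k ∈ Finset.univ.erase i, μ k (pt a k)) * F (pt a)) := fun v => by
        have h3 : F (Function.update (pt a) i v) = F (pt a) := hFi fun k hk =>
          Function.update_of_ne hk _ _
        rw [h3, ← Finset.mul_prod_erase _ _ (Finset.mem_univ i), Function.update_self, mul_assoc]
        congr 2
        exact Finset.prod_congr rfl fun k hk => by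
          rw [Function.update_of_ne (Finset.ne_of_mem_erase hk)]
      simp only [h2]
      rw [← Finset.sum_mul, hμ.sum_one, one_mul]
  rw [Finset.sum_congr rfl h1, ← Finset.sum_product', ← Finset.sum_image
    (f := fun x => (∏ k, μ k (x k)) * F x) (g := fun q : β × V => Function.update (pt q.1) i q.2)]
  · exact Finset.sum_le_sum_of_subset_of_nonneg (Finset.subset_univ _) fun x _ _ =>
      mul_nonneg (hμ.prod_nonneg x) (hF x)
  · rintro ⟨a, v⟩ ha ⟨b, w⟩ hb h
    rw [Finset.mem_coe, Finset.mem_product] at ha hb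
    have h3 : a = b := hpt a ha.1 b hb.1 fun k hk => by
      have := congrFun h k
      simpa [Function.update_of_ne hk] using this
    have h4 : v = w := by
      have := congrFun h i
      simpa using this
    rw [h3, h4]

end Reweighting

section CornerCount

variable {d : ℕ}

/-- The `j`-th coordinate of the corner with vertex `u ∘ some` and sum of coordinates of the other
vertices equal to `u none`. -/
def cornerForm (j : Fin d) (u : Option (Fin d) → ℤ) : ℤ :=
  u none - ∑ k ∈ Finset.univ.erase j, u (some k)

/-- The vertex in direction `j` of the corner with vertex `u ∘ some` and sum of coordinates of the
other vertices equal to `u none`. -/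
def cornerPoint (j : Fin d) (u : Option (Fin d) → ℤ) (k : Fin d) : ℤ :=
  if k = j then cornerForm j u else u (some k)

lemma cornerForm_congr {j : Fin d} {u v : Option (Fin d) → ℤ} (h : ∀ o, o ≠ some j → u o = v o) :
    cornerForm j u = cornerForm j v := by
  unfold cornerForm
  rw [h none (by simp), Finset.sum_congr rfl fun k hk => h (some k) (by
    simpa using Finset.ne_of_mem_erase hk)]

lemma cornerPoint_congr {j : Fin d} {u v : Option (Fin d) → ℤ} (h : ∀ o, o ≠ some j → u o = v o) :
    cornerPoint j u = cornerPoint j v := by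
  funext k
  unfold cornerPoint
  split_ifs with hk
  · exact cornerForm_congr h
  · exact h (some k) (by simpa using hk)

/-- The common range of the variables. -/
abbrev Box (d M : ℕ) : Type := Finset.Icc (1 : ℤ) (d * M : ℕ)

/-- The length of the range of each variable. -/
def boxSide (d M : ℕ) : Option (Fin d) → ℕ
  | none => d * M
  | some _ => M

/-- The uniform weight on the range of each variable. -/
noncomputable def boxWeight (d M : ℕ) (o : Option (Fin d)) (v : Box d M) : ℝ :=
  if (v : ℤ) ≤ boxSide d M o then (boxSide d M o : ℝ)⁻¹ else 0

lemma boxSide_pos {M : ℕ} (hd : 1 ≤ d) (hM : 1 ≤ M) (o : Option (Fin d)) : 0 < boxSide d M o := by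
  cases o
  · exact Nat.mul_pos hd hM
  · exact hM

lemma boxSide_le {M : ℕ} (hd : 1 ≤ d) (o : Option (Fin d)) : boxSide d M o ≤ d * M := by
  cases o
  · exact le_rfl
  · exact Nat.le_mul_of_pos_left M hd

lemma boxWeight_nonneg (M : ℕ) (o : Option (Fin d)) (v : Box d M) : 0 ≤ boxWeight d M o v := by
  unfold boxWeight
  split_ifs <;> positivity

lemma boxWeight_le (M : ℕ) (o : Option (Fin d)) (v : Box d M) :
    boxWeight d M o v ≤ (boxSide d M o : ℝ)⁻¹ := by
  unfold boxWeight
  split_ifs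
  · exact le_rfl
  · positivity

lemma sum_boxWeight_mul {M : ℕ} (hd : 1 ≤ d) (o : Option (Fin d)) (g : ℤ → ℝ) :
    ∑ v, boxWeight d M o v * g v =
      (boxSide d M o : ℝ)⁻¹ * ∑ n ∈ Finset.Icc (1 : ℤ) (boxSide d M o), g n := by
  unfold boxWeight
  rw [Finset.sum_coe_sort (Finset.Icc (1 : ℤ) (d * M : ℕ))
    fun n => (if n ≤ boxSide d M o then (boxSide d M o : ℝ)⁻¹ else 0) * g n, Finset.mul_sum]
  simp only [ite_mul, zero_mul]
  rw [← Finset.sum_filter]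
  refine Finset.sum_congr (Finset.ext fun n => ?_) fun _ _ => rfl
  have := boxSide_le (M := M) hd o
  simp only [Finset.mem_filter, Finset.mem_Icc]
  omega

lemma sum_boxWeight {M : ℕ} (hd : 1 ≤ d) (hM : 1 ≤ M) (o : Option (Fin d)) :
    ∑ v, boxWeight d M o v = 1 := by
  have h := sum_boxWeight_mul (M := M) hd o fun _ => 1
  have h0 : (boxSide d M o : ℝ) ≠ 0 := by exact_mod_cast (boxSide_pos hd hM o).ne'
  simp only [mul_one, Finset.sum_const, Int.card_Icc, nsmul_eq_mul] at h
  rw [h]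
  simp [h0]

lemma isWeight_boxWeight {M : ℕ} (hd : 1 ≤ d) (hM : 1 ≤ M) : IsWeight (boxWeight d M) where
  nonneg := boxWeight_nonneg M
  sum_one := sum_boxWeight hd hM

lemma card_mul_pow_le {M : ℕ} (hM : 1 ≤ M) (hd : 1 ≤ d) {s : Fin d → ℤ → ℝ} {B : ℝ}
    {S : Finset (Fin d → ℤ)} (hs : ∀ j n, 0 ≤ s j n)
    (hS : ∀ a ∈ S, ∀ j, 1 ≤ a j ∧ a j ≤ M) (hB : ∀ a ∈ S, ∀ j, s j (a j) = B)
    (hm : ∀ j, |∑ v, boxWeight d M (some j) v * s j v - 1| ≤ 1 / 2) :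
    S.card * B ^ d ≤ 2 ^ d * (M : ℝ) ^ d := by
  have hM0 : (0 : ℝ) < M := by exact_mod_cast hM
  have h1 : ∑ a ∈ S, ∏ j, s j (a j) = S.card * B ^ d := by
    rw [← nsmul_eq_mul, ← Finset.sum_const]
    refine Finset.sum_congr rfl fun a ha => ?_
    rw [Finset.prod_congr rfl fun j _ => hB a ha j, Finset.prod_const, Finset.card_univ,
      Fintype.card_fin]
  have h2 : ∑ a ∈ S, ∏ j, s j (a j) ≤
      ∑ a ∈ Fintype.piFinset fun _ : Fin d => Finset.Icc (1 : ℤ) M, ∏ j, s j (a j) :=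
    Finset.sum_le_sum_of_subset_of_nonneg (fun a ha => Fintype.mem_piFinset.2 fun j =>
      Finset.mem_Icc.2 (hS a ha j)) fun a _ _ => Finset.prod_nonneg fun j _ => hs j _
  rw [← h1]
  refine h2.trans ?_
  rw [← Finset.prod_univ_sum, ← mul_pow]
  have h5 : ((2 : ℝ) * M) ^ d = ∏ _j : Fin d, (2 : ℝ) * M := by simp
  rw [h5]
  refine Finset.prod_le_prod (fun j _ => Finset.sum_nonneg fun n _ => hs j n) fun j _ => ?_
  have h3 := (abs_le.1 (hm j)).2
  rw [sum_boxWeight_mul hd (some j)] at h3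
  have h4 : (M : ℝ)⁻¹ * ∑ n ∈ Finset.Icc (1 : ℤ) M, s j n ≤ 2 := by
    have : boxSide d M (some j) = M := rfl
    rw [this] at h3
    linarith
  rw [inv_mul_le_iff₀ hM0] at h4
  linarith

open Classical in
/-- The parametrised nondegenerate and degenerate corners of `S`. -/
noncomputable def boxCorners (d M : ℕ) (S : Finset (Fin d → ℤ)) :
    Finset (Option (Fin d) → Box d M) :=
  Finset.univ.filter fun x => (fun k => (x (some k) : ℤ)) ∈ S ∧
    ∀ j, cornerPoint j (fun o => (x o : ℤ)) ∈ S

/-- The point of the box representing the degenerate corner at `a`. -/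
def diagPoint {M : ℕ} (hd : 1 ≤ d) (a : Fin d → ℤ) (ha : ∀ j, 1 ≤ a j ∧ a j ≤ M) :
    Option (Fin d) → Box d M
  | none => ⟨∑ k, a k, Finset.mem_Icc.2 ⟨by
      have h := Finset.single_le_sum (f := a) (s := Finset.univ)
        (fun k _ => zero_le_one.trans (ha k).1) (Finset.mem_univ ⟨0, hd⟩)
      exact (ha _).1.trans h, by
      refine (Finset.sum_le_card_nsmul _ _ _ fun k _ => (ha k).2).trans_eq ?_
      simp⟩⟩
  | some k => ⟨a k, Finset.mem_Icc.2 ⟨(ha k).1, (ha k).2.trans (by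
      exact_mod_cast Nat.le_mul_of_pos_left M hd)⟩⟩

lemma cornerForm_sum (j : Fin d) (u : Option (Fin d) → ℤ) (h : u none = ∑ k, u (some k)) :
    cornerForm j u = u (some j) := by
  rw [cornerForm, h, ← Finset.add_sum_erase _ _ (Finset.mem_univ j)]
  ring

lemma cornerPoint_diagPoint {M : ℕ} (hd : 1 ≤ d) (a : Fin d → ℤ) (ha : ∀ j, 1 ≤ a j ∧ a j ≤ M)
    (j : Fin d) : cornerPoint j (fun o => (diagPoint hd a ha o : ℤ)) = a := by
  funext k
  unfold cornerPoint
  split_ifs with hk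
  · rw [cornerForm_sum j _ rfl, hk]
    rfl
  · rfl

lemma diagPoint_injective_off {M : ℕ} (hd : 1 ≤ d) {a b : Fin d → ℤ}
    (ha : ∀ j, 1 ≤ a j ∧ a j ≤ M) (hb : ∀ j, 1 ≤ b j ∧ b j ≤ M) (i : Option (Fin d))
    (h : ∀ k, k ≠ i → diagPoint hd a ha k = diagPoint hd b hb k) : a = b := by
  have h1 : ∀ k, some k ≠ i → a k = b k := fun k hk => congrArg Subtype.val (h (some k) hk)
  funext k
  by_cases hk : some k = i
  · subst hk
    have h2 : ∑ k, a k = ∑ k, b k := congrArg Subtype.val (h none (by simp))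
    rw [← Finset.add_sum_erase _ _ (Finset.mem_univ k),
      ← Finset.add_sum_erase _ b (Finset.mem_univ k), Finset.sum_congr rfl fun k' hk' =>
        h1 k' (by simpa using Finset.ne_of_mem_erase hk')] at h2
    exact add_right_cancel h2
  · exact h1 k hk

end CornerCount

section RelativeCorners

variable {d : ℕ}

/-- The densities with respect to which the variables are reweighted. -/
def boxDensity (M : ℕ) (s : Fin d → ℤ → ℝ) : Option (Fin d) → Box d M → ℝ
  | none => fun _ => 1
  | some j => fun v => s j v

/-- The majorants of the edges. -/
def cornerMajorant (M : ℕ) (s : Fin d → ℤ → ℝ) :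
    Option (Fin d) → (Option (Fin d) → Box d M) → ℝ
  | none => fun _ => 1
  | some j => fun x => s j (cornerForm j fun o => (x o : ℤ))

open Classical in
/-- The edge functions. -/
noncomputable def cornerEdge (M : ℕ) (B : ℝ) (S : Finset (Fin d → ℤ)) :
    Option (Fin d) → (Option (Fin d) → Box d M) → ℝ
  | none => fun x => if (fun k => (x (some k) : ℤ)) ∈ S then 1 else 0
  | some j => fun x => if cornerPoint j (fun o => (x o : ℤ)) ∈ S then B else 0

lemma dependsOn_cornerMajorant (M : ℕ) (s : Fin d → ℤ → ℝ) (i : Option (Fin d)) :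
    DependsOn (cornerMajorant M s i) {i}ᶜ := by
  cases i with
  | none => exact fun x y _ => rfl
  | some j =>
    intro x y h
    exact congrArg (s j) (cornerForm_congr fun o ho => congrArg Subtype.val (h o ho))

lemma dependsOn_cornerEdge (M : ℕ) (B : ℝ) (S : Finset (Fin d → ℤ)) (i : Option (Fin d)) :
    DependsOn (cornerEdge M B S i) {i}ᶜ := by
  cases i with
  | none =>
    intro x y h
    have h1 : (fun k => (x (some k) : ℤ)) = fun k => (y (some k) : ℤ) :=
      funext fun k => congrArg Subtype.val (h (some k) (by simp))
    simp only [cornerEdge, h1]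
  | some j =>
    intro x y h
    have h1 : cornerPoint j (fun o => (x o : ℤ)) = cornerPoint j fun o => (y o : ℤ) :=
      cornerPoint_congr fun o ho => congrArg Subtype.val (h o ho)
    simp only [cornerEdge, h1]

lemma cornerEdge_nonneg (M : ℕ) {B : ℝ} (hB : 0 ≤ B) (S : Finset (Fin d → ℤ))
    (i : Option (Fin d)) (x : Option (Fin d) → Box d M) : 0 ≤ cornerEdge M B S i x := by
  cases i <;> simp only [cornerEdge] <;> split_ifs <;> first | exact hB | positivity

lemma cornerEdge_le_cornerMajorant (M : ℕ) {B : ℝ} {S : Finset (Fin d → ℤ)} {s : Fin d → ℤ → ℝ}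
    (hs : ∀ j n, 0 ≤ s j n) (hB : ∀ a ∈ S, ∀ j, s j (a j) = B) (i : Option (Fin d))
    (x : Option (Fin d) → Box d M) : cornerEdge M B S i x ≤ cornerMajorant M s i x := by
  cases i with
  | none =>
    simp only [cornerEdge, cornerMajorant]
    split_ifs
    exacts [le_rfl, zero_le_one]
  | some j =>
    simp only [cornerEdge, cornerMajorant]
    split_ifs with h
    · have := hB _ h j
      simp only [cornerPoint, if_true] at this
      exact this.ge
    · exact hs j _

lemma prod_cornerEdge (M : ℕ) (B : ℝ) (S : Finset (Fin d → ℤ)) (x : Option (Fin d) → Box d M) :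
    ∏ i, cornerEdge M B S i x = if x ∈ boxCorners d M S then B ^ d else 0 := by
  rw [Fintype.prod_option]
  split_ifs with h
  · obtain ⟨h1, h2⟩ := (Finset.mem_filter.1 h).2
    simp only [cornerEdge, if_pos h1, if_pos (h2 _)]
    simp
  · have h1 : ¬ ((fun k => (x (some k) : ℤ)) ∈ S ∧
        ∀ j, cornerPoint j (fun o => (x o : ℤ)) ∈ S) := fun h' =>
      h (Finset.mem_filter.2 ⟨Finset.mem_univ _, h'⟩)
    rw [not_and_or, not_forall] at h1
    rcases h1 with h1 | ⟨j, hj⟩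
    · exact mul_eq_zero_of_left (if_neg h1) _
    · exact mul_eq_zero_of_right _ (Finset.prod_eq_zero (Finset.mem_univ j) (if_neg hj))

/-- The reweighted measures on the variables. -/
noncomputable def cornerWeight (M : ℕ) (s : Fin d → ℤ → ℝ) : Option (Fin d) → Box d M → ℝ :=
  reweight (boxWeight d M) (boxDensity M s)

lemma boxDensity_nonneg (M : ℕ) {s : Fin d → ℤ → ℝ} (hs : ∀ j n, 0 ≤ s j n) (i : Option (Fin d))
    (v : Box d M) : 0 ≤ boxDensity M s i v := by
  cases i with
  | none => exact zero_le_one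
  | some j => exact hs j v

variable {M : ℕ} {s : Fin d → ℤ → ℝ} {B : ℝ} {S : Finset (Fin d → ℤ)}

lemma abs_sum_boxDensity_sub_one_le (hd : 1 ≤ d) (hM : 1 ≤ M)
    (hm : ∀ j, |∑ v, boxWeight d M (some j) v * s j v - 1| ≤ 1 / 2) (i : Option (Fin d)) :
    |∑ v, boxWeight d M i v * boxDensity M s i v - 1| ≤ 1 / 2 := by
  cases i with
  | none =>
    simp only [boxDensity, mul_one]
    rw [sum_boxWeight hd hM, sub_self, abs_zero]
    positivity
  | some j => exact hm j

lemma sum_boxDensity_bounds (hd : 1 ≤ d) (hM : 1 ≤ M)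
    (hm : ∀ j, |∑ v, boxWeight d M (some j) v * s j v - 1| ≤ 1 / 2) (i : Option (Fin d)) :
    1 / 2 ≤ ∑ v, boxWeight d M i v * boxDensity M s i v ∧
      ∑ v, boxWeight d M i v * boxDensity M s i v ≤ 2 := by
  have h := abs_le.1 (abs_sum_boxDensity_sub_one_le hd hM hm i)
  constructor <;> linarith [h.1, h.2]

lemma isWeight_cornerWeight (hd : 1 ≤ d) (hM : 1 ≤ M) (hs : ∀ j n, 0 ≤ s j n)
    (hm : ∀ j, |∑ v, boxWeight d M (some j) v * s j v - 1| ≤ 1 / 2) :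
    IsWeight (cornerWeight M s) :=
  isWeight_reweight (boxWeight_nonneg M) (boxDensity_nonneg M hs) fun i =>
    (by norm_num : (0 : ℝ) < 1 / 2).trans_le (sum_boxDensity_bounds hd hM hm i).1

lemma cornerWeight_none (hd : 1 ≤ d) (hM : 1 ≤ M) (v : Box d M) :
    cornerWeight M s none v = ((d * M : ℕ) : ℝ)⁻¹ := by
  simp only [cornerWeight, reweight, boxDensity, mul_one]
  rw [sum_boxWeight hd hM, div_one, boxWeight]
  exact if_pos (Finset.mem_Icc.1 v.2).2

lemma cornerWeight_some_le (hd : 1 ≤ d) (hM : 1 ≤ M) (hB : 0 ≤ B)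
    (hm : ∀ j, |∑ v, boxWeight d M (some j) v * s j v - 1| ≤ 1 / 2) (j : Fin d) (v : Box d M)
    (hv : s j v = B) : cornerWeight M s (some j) v ≤ 2 * (B / M) := by
  have h1 := (sum_boxDensity_bounds hd hM hm (some j)).1
  simp only [cornerWeight, reweight]
  rw [div_le_iff₀ (by linarith)]
  have h2 : boxWeight d M (some j) v * boxDensity M s (some j) v ≤ B / M := by
    simp only [boxDensity]
    rw [hv, div_eq_inv_mul]
    exact mul_le_mul_of_nonneg_right (boxWeight_le M (some j) v) hB
  have h3 : (0 : ℝ) ≤ B / M := by positivity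
  nlinarith

lemma le_cornerWeight_some (hd : 1 ≤ d) (hM : 1 ≤ M) (hB : 0 ≤ B)
    (hm : ∀ j, |∑ v, boxWeight d M (some j) v * s j v - 1| ≤ 1 / 2) (j : Fin d) (v : Box d M)
    (hvM : (v : ℤ) ≤ M) (hv : s j v = B) : B / (2 * M) ≤ cornerWeight M s (some j) v := by
  have h1 := sum_boxDensity_bounds hd hM hm (some j)
  simp only [cornerWeight, reweight]
  rw [le_div_iff₀ (by linarith [h1.1])]
  have h2 : boxWeight d M (some j) v * boxDensity M s (some j) v = B / M := by
    simp only [boxDensity]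
    rw [hv, div_eq_inv_mul, boxWeight]
    congr 1
    exact if_pos hvM
  have hM0 : (0 : ℝ) < M := by exact_mod_cast hM
  have h3 : B / (2 * M) = B / M / 2 := by field_simp
  have h4 : (0 : ℝ) ≤ B / M := by positivity
  rw [h2, h3]
  nlinarith [h1.2]

lemma wE_prod_cornerEdge_le (hd : 1 ≤ d) (hM : 1 ≤ M) (hB : 0 ≤ B) (hs : ∀ j n, 0 ≤ s j n)
    (hS : ∀ a ∈ S, ∀ j, s j (a j) = B)
    (hm : ∀ j, |∑ v, boxWeight d M (some j) v * s j v - 1| ≤ 1 / 2) :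
    wE (cornerWeight M s) (fun x => ∏ i, cornerEdge M B S i x) ≤
      (boxCorners d M S).card * ((2 * (B / M)) ^ d * (M : ℝ)⁻¹ * B ^ d) := by
  have hw := isWeight_cornerWeight hd hM hs hm
  have hM0 : (0 : ℝ) < M := by exact_mod_cast hM
  simp only [prod_cornerEdge, wE, mul_ite, mul_zero]
  rw [← Finset.sum_filter, Finset.filter_mem_eq_inter, Finset.univ_inter, ← nsmul_eq_mul]
  refine Finset.sum_le_card_nsmul _ _ _ fun x hx => ?_
  refine mul_le_mul_of_nonneg_right ?_ (by positivity)
  rw [Fintype.prod_option, mul_comm]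
  have h1 := (Finset.mem_filter.1 hx).2.1
  refine mul_le_mul ?_ ?_ (hw.nonneg _ _) (by positivity)
  · refine (Finset.prod_le_prod (fun j _ => hw.nonneg _ _) fun j _ =>
      cornerWeight_some_le hd hM hB hm j _ (hS _ h1 j)).trans_eq ?_
    simp
  · rw [cornerWeight_none hd hM]
    refine inv_anti₀ hM0 ?_
    exact_mod_cast Nat.le_mul_of_pos_left M hd

lemma le_prod_erase_mul_cornerEdge (hd : 1 ≤ d) (hM : 1 ≤ M) (hB : 0 < B)
    (hs : ∀ j n, 0 ≤ s j n) (hS : ∀ a ∈ S, ∀ j, s j (a j) = B)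
    (hm : ∀ j, |∑ v, boxWeight d M (some j) v * s j v - 1| ≤ 1 / 2) {a : Fin d → ℤ} (haS : a ∈ S)
    (ha : ∀ j, 1 ≤ a j ∧ a j ≤ M) (i : Option (Fin d)) :
    (B / (2 * M)) ^ d * (d : ℝ)⁻¹ ≤
      (∏ k ∈ Finset.univ.erase i, cornerWeight M s k (diagPoint hd a ha k)) *
        cornerEdge M B S i (diagPoint hd a ha) := by
  have hw := isWeight_cornerWeight hd hM hs hm
  have hM0 : (0 : ℝ) < M := by exact_mod_cast hM
  have hd0 : (0 : ℝ) < d := by exact_mod_cast hd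
  have hd1 : (1 : ℝ) ≤ d := by exact_mod_cast hd
  set low : Option (Fin d) → ℝ := fun o => o.elim ((d * M : ℕ) : ℝ)⁻¹ fun _ => B / (2 * M)
  have hlow0 : ∀ o, 0 < low o := fun o => by
    cases o
    · exact inv_pos.2 (by exact_mod_cast Nat.mul_pos hd hM)
    · exact div_pos hB (by positivity)
  have hlow : ∀ o, low o ≤ cornerWeight M s o (diagPoint hd a ha o) := fun o => by
    cases o with
    | none => exact (cornerWeight_none hd hM _).ge
    | some j => exact le_cornerWeight_some hd hM hB.le hm j _ (ha j).2 (hS a haS j)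
  have h1 : ∏ k ∈ Finset.univ.erase i, low k ≤
      ∏ k ∈ Finset.univ.erase i, cornerWeight M s k (diagPoint hd a ha k) :=
    Finset.prod_le_prod (fun k _ => (hlow0 k).le) fun k _ => hlow k
  have h2 : ∏ k ∈ Finset.univ.erase i, low k =
      (B / (2 * M)) ^ d * ((d * M : ℕ) : ℝ)⁻¹ / low i := by
    rw [eq_div_iff (hlow0 i).ne', Finset.prod_erase_mul _ _ (Finset.mem_univ i),
      Fintype.prod_option, mul_comm]
    simp only [low, Option.elim, Finset.prod_const, Finset.card_univ, Fintype.card_fin]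
  refine le_trans ?_ (mul_le_mul_of_nonneg_right h1 (cornerEdge_nonneg M hB.le S i _))
  rw [h2]
  cases i with
  | none =>
    have h3 : cornerEdge M B S none (diagPoint hd a ha) = 1 := if_pos haS
    rw [h3, mul_one]
    change _ ≤ _ * _ / ((d * M : ℕ) : ℝ)⁻¹
    rw [mul_div_assoc, div_self (inv_ne_zero (by positivity)), mul_one]
    exact mul_le_of_le_one_right (by positivity) (inv_le_one_of_one_le₀ hd1)
  | some j =>
    have h3 : cornerEdge M B S (some j) (diagPoint hd a ha) = B :=
      if_pos ((cornerPoint_diagPoint hd a ha j).symm ▸ haS)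
    rw [h3]
    change _ ≤ _ * _ / (B / (2 * M)) * B
    have h4 : (B / (2 * M)) ^ d * ((d * M : ℕ) : ℝ)⁻¹ / (B / (2 * M)) * B =
        (B / (2 * M)) ^ d * (d : ℝ)⁻¹ * 2 := by
      push_cast
      field_simp
    rw [h4]
    exact le_mul_of_one_le_right (by positivity) (by norm_num)

lemma wE_wE_prod_cornerMajorant_eq (𝒜 : Option (Fin d) → Finset (Finset (Option (Fin d)))) :
    (wE (cornerWeight M s) fun x => wE (cornerWeight M s) fun y =>
      ∏ i, ∏ A ∈ 𝒜 i, cornerMajorant M s i (A.piecewise y x)) =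
    (wE (boxWeight d M) fun x => wE (boxWeight d M) fun y =>
      (∏ j, s j (x (some j)) * s j (y (some j))) *
        ∏ j, ∏ A ∈ 𝒜 (some j), s j (cornerForm j fun o => (A.piecewise y x o : ℤ))) /
      (∏ i, ∑ v, boxWeight d M i v * boxDensity M s i v) ^ 2 := by
  rw [cornerWeight, wE_wE_reweight]
  simp only [Fintype.prod_option, boxDensity, cornerMajorant, Finset.prod_const_one, one_mul]

/-- The relative corners theorem. -/
theorem exists_mul_le_card_boxCorners (hd : 1 ≤ d) {δ : ℝ} (hδ : 0 < δ) :
    ∃ ε : ℝ, 0 < ε ∧ ∀ (M : ℕ) (s : Fin d → ℤ → ℝ) (B : ℝ) (S : Finset (Fin d → ℤ)), 1 ≤ M →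
      0 < B → (∀ j n, 0 ≤ s j n) → (∀ a ∈ S, ∀ j, 1 ≤ a j ∧ a j ≤ M) →
      (∀ a ∈ S, ∀ j, s j (a j) = B) →
      (∀ j, |∑ v, boxWeight d M (some j) v * s j v - 1| ≤ 1 / 2) →
      (∀ 𝒜 : Fin d → Finset (Finset (Option (Fin d))), (∀ j, ∀ A ∈ 𝒜 j, some j ∉ A) →
        |(wE (boxWeight d M) fun x => wE (boxWeight d M) fun y =>
          (∏ j, s j (x (some j)) * s j (y (some j))) *
            ∏ j, ∏ A ∈ 𝒜 j, s j (cornerForm j fun o => (A.piecewise y x o : ℤ))) - 1| ≤ ε) →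
      δ * (M : ℝ) ^ d ≤ S.card * B ^ d →
      ε * (M : ℝ) ^ (d + 1) ≤ (boxCorners d M S).card * B ^ (2 * d) := by
  have hd0 : (0 : ℝ) < d := by exact_mod_cast hd
  set δ' : ℝ := δ / (2 * (d * 2 ^ d * (d + 1))) with hδ'
  have hδ'0 : 0 < δ' := by positivity
  obtain ⟨ε₀, hε₀, hcover⟩ := exists_cover (Option (Fin d)) hδ'0
  refine ⟨min (1 / 2) (min (ε₀ / 4) (ε₀ / 2 ^ d)), by positivity, ?_⟩
  intro M s B S hM hB hs hSM hSB hm hLF hdens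
  set ε : ℝ := min (1 / 2) (min (ε₀ / 4) (ε₀ / 2 ^ d)) with hε
  have hε1 : ε ≤ 1 / 2 := min_le_left _ _
  have hε2 : ε ≤ ε₀ / 4 := (min_le_right _ _).trans (min_le_left _ _)
  have hε3 : ε ≤ ε₀ / 2 ^ d := (min_le_right _ _).trans (min_le_right _ _)
  have hM0 : (0 : ℝ) < M := by exact_mod_cast hM
  have hw := isWeight_cornerWeight hd hM hs hm
  have hub := isWeight_boxWeight hd hM
  set C : ℝ := (∏ i, ∑ v, boxWeight d M i v * boxDensity M s i v) ^ 2 with hC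
  have hC0 : 0 < C := pow_pos (Finset.prod_pos fun i _ =>
    (by norm_num : (0 : ℝ) < 1 / 2).trans_le (sum_boxDensity_bounds hd hM hm i).1) 2
  have hC1 : |C - 1| ≤ ε := by
    have h1 := wE_wE_prod_cornerMajorant_eq (M := M) (s := s) (d := d) fun _ => ∅
    simp only [Finset.prod_empty, Finset.prod_const_one, wE_const hw] at h1
    rw [eq_div_iff hC0.ne', one_mul] at h1
    have h2 := hLF (fun _ => ∅) (by simp)
    simp only [Finset.prod_empty, Finset.prod_const_one] at h2
    rw [h1]
    exact h2
  by_cases hE : wE (cornerWeight M s) (fun x => ∏ i, cornerEdge M B S i x) ≤ ε₀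
  · exfalso
    obtain ⟨r, hrd, hr0, hr1, hrδ⟩ := hcover (Box d M) (cornerWeight M s) (cornerMajorant M s)
      (cornerEdge M B S) hw (dependsOn_cornerMajorant M s)
      (fun i x => (cornerEdge_nonneg M hB.le S i x).trans
        (cornerEdge_le_cornerMajorant M hs hSB i x))
      (fun 𝒜 h𝒜 => by
        rw [wE_wE_prod_cornerMajorant_eq, ← hC]
        have h1 := hLF (fun j => 𝒜 (some j)) fun j => h𝒜 (some j)
        rw [div_sub_one hC0.ne', abs_div, abs_of_pos hC0, div_le_iff₀ hC0]
        rw [abs_le] at h1 hC1 ⊢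
        constructor <;> nlinarith [h1.1, h1.2, hC1.1, hC1.2])
      (dependsOn_cornerEdge M B S) (cornerEdge_nonneg M hB.le S)
      (cornerEdge_le_cornerMajorant M hs hSB) hE
    set β : ℝ := (B / (2 * M)) ^ d * (d : ℝ)⁻¹ with hβ
    have hβ0 : 0 < β := by positivity
    set pt : S → Option (Fin d) → Box d M := fun a => diagPoint hd a.1 (hSM a.1 a.2)
    have h1 : ∀ i, ∑ a ∈ S.attach, β * r i (pt a) ≤ δ' := fun i => by
      refine le_trans ?_ ((sum_le_wE_of_dependsOn hw (F := fun x => cornerEdge M B S i x * r i x)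
        (fun x => mul_nonneg (cornerEdge_nonneg M hB.le S i x) (hr0 i x)) (i := i)
        (fun x y hxy => ?_) S.attach pt fun a _ b _ hab => ?_).trans (hrδ i))
      · refine Finset.sum_le_sum fun a _ => ?_
        rw [← mul_assoc]
        exact mul_le_mul_of_nonneg_right (le_prod_erase_mul_cornerEdge hd hM hB hs hSB hm a.2
          (hSM a.1 a.2) i) (hr0 i _)
      · change _ * _ = _ * _
        rw [dependsOn_cornerEdge M B S i hxy, hrd i hxy]
      · exact Subtype.ext (diagPoint_injective_off hd _ _ i hab)
    have h2 : S.card * β ≤ (d + 1) * δ' := by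
      calc S.card * β = ∑ a ∈ S.attach, β * 1 := by simp [mul_comm]
        _ ≤ ∑ a ∈ S.attach, β * ∑ i, r i (pt a) :=
          Finset.sum_le_sum fun a _ => mul_le_mul_of_nonneg_left (hr1 _) hβ0.le
        _ = ∑ i, ∑ a ∈ S.attach, β * r i (pt a) := by
          simp only [Finset.mul_sum]
          exact Finset.sum_comm
        _ ≤ ∑ _i : Option (Fin d), δ' := Finset.sum_le_sum fun i _ => h1 i
        _ = (d + 1) * δ' := by simp
    have h3 : S.card * β = S.card * B ^ d / (d * 2 ^ d * M ^ d) := by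
      rw [hβ, div_pow, mul_pow]
      field_simp
    rw [h3, div_le_iff₀ (by positivity), hδ'] at h2
    have h4 : (d + 1) * (δ / (2 * (d * 2 ^ d * (d + 1)))) * (d * 2 ^ d * (M : ℝ) ^ d) =
        δ * M ^ d / 2 := by
      field_simp
    have h5 : 0 < δ * (M : ℝ) ^ d := by positivity
    linarith
  · rw [not_le] at hE
    have h1 := hE.le.trans (wE_prod_cornerEdge_le hd hM hB.le hs hSB hm)
    have h2 : ((boxCorners d M S).card : ℝ) * ((2 * (B / M)) ^ d * (M : ℝ)⁻¹ * B ^ d) =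
        (boxCorners d M S).card * B ^ (2 * d) * 2 ^ d / M ^ (d + 1) := by
      rw [mul_pow, div_pow, two_mul, pow_add, pow_succ]
      field_simp
    rw [h2, le_div_iff₀ (by positivity)] at h1
    have h3 : ε * (M : ℝ) ^ (d + 1) ≤ ε₀ / 2 ^ d * M ^ (d + 1) :=
      mul_le_mul_of_nonneg_right hε3 (by positivity)
    refine h3.trans ?_
    rw [div_mul_eq_mul_div, div_le_iff₀ (by positivity)]
    exact h1

end RelativeCorners

section Averages

variable {ι : Type} [Fintype ι] [DecidableEq ι] {V : Type} [Fintype V]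

lemma wE_apply {μ : ι → V → ℝ} (hμ : IsWeight μ) (i : ι) (g : V → ℝ) :
    wE μ (fun x => g (x i)) = ∑ v, μ i v * g v := by
  have h1 : wE μ (fun x => g (x i)) =
      ∑ x : ι → V, ∏ k, μ k (x k) * (if k = i then g (x k) else 1) := by
    refine Finset.sum_congr rfl fun x _ => ?_
    rw [Finset.prod_mul_distrib, Finset.prod_ite_eq' Finset.univ i, if_pos (Finset.mem_univ i)]
  have h2 := Finset.prod_univ_sum (fun _ : ι => (Finset.univ : Finset V))
    fun k v => μ k v * if k = i then g v else 1
  rw [Fintype.piFinset_univ] at h2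
  rw [h1, ← h2, Finset.prod_eq_single_of_mem i (Finset.mem_univ i)]
  · simp
  · intro k _ hk
    simp [hk, hμ.sum_one]

lemma wE_sumElim {κ : Type} [Fintype κ] [DecidableEq κ] (μ : ι → V → ℝ) (μ' : κ → V → ℝ)
    (F : (ι → V) → (κ → V) → ℝ) :
    wE (Sum.elim μ μ') (fun z => F (fun i => z (Sum.inl i)) fun k => z (Sum.inr k)) =
      wE μ fun x => wE μ' fun y => F x y := by
  simp only [wE, Finset.mul_sum]
  rw [← Fintype.sum_prod_type', ← (Equiv.sumArrowEquivProdArrow ι κ V).symm.sum_comp]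
  refine Finset.sum_congr rfl fun x _ => ?_
  rw [Fintype.prod_sum_type, mul_assoc]
  rfl

lemma IsWeight.sumElim {κ : Type} [Fintype κ] [DecidableEq κ] {μ : ι → V → ℝ} {μ' : κ → V → ℝ}
    (hμ : IsWeight μ) (hμ' : IsWeight μ') : IsWeight (Sum.elim μ μ') where
  nonneg i v := by
    cases i
    exacts [hμ.nonneg _ v, hμ'.nonneg _ v]
  sum_one i := by
    cases i
    exacts [hμ.sum_one _, hμ'.sum_one _]

lemma coprime_primorial {w R p : ℕ} (hp : p ∈ sievePrimes w R) :
    ((primorial w : ℤ) : ZMod p) ≠ 0 := by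
  obtain ⟨⟨h1, h2⟩, h3⟩ := mem_sievePrimes.1 hp
  rw [Int.cast_natCast, Ne, ZMod.natCast_eq_zero_iff, primorial_eq_prod_sievePrimes,
    h3.prime.dvd_finsetProd_iff]
  rintro ⟨q, hq, hpq⟩
  obtain ⟨⟨h4, h5⟩, h6⟩ := mem_sievePrimes.1 hq
  have := (Nat.prime_dvd_prime_iff_eq h3 h6).1 hpq
  omega

/-- The error term in the linear forms estimate for at most `L` forms in at most `n` variables. -/
noncomputable def formsError (L n w R M : ℕ) : ℝ :=
  (Real.exp (64 ^ L / w) - 1) + (R : ℝ) ^ (5 * L + 2 * L * n) * (n * (M : ℝ)⁻¹)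

lemma abs_wE_prod_sieve_sub_one_le_formsError {Λ : Type} [Fintype Λ] [DecidableEq Λ]
    {μ : ι → V → ℝ} (hμ : IsWeight μ) {val : V → ℤ} {M L n w R : ℕ}
    (hμM : ∀ i, Equidistributed (μ i) val (M : ℝ)⁻¹) (hw : 1 ≤ w) (hR : 1 ≤ R)
    (hL : Fintype.card Λ ≤ L) (hn : Fintype.card ι ≤ n) (c : Λ → ι → ℤ) (b : Λ → ℤ)
    (h₁ : ∀ l, ∃ i, IsUnit (c l i))
    (h₂ : ∀ l l', l ≠ l' → ∃ i j, IsUnit (c l i * c l' j - c l j * c l' i)) :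
    |wE μ (fun x => ∏ l, sieve (sievePrimes w R) R
      (primorial w * ∑ i, c l i * val (x i) + b l)) - 1| ≤ formsError L n w R M := by
  have hR' : (1 : ℝ) ≤ R := by exact_mod_cast hR
  have hunit : ∀ p ∈ sievePrimes w R, ∀ z : ℤ, IsUnit z → (z : ZMod p) ≠ 0 := fun p hp z hz => by
    have : Fact p.Prime := ⟨(mem_sievePrimes.1 hp).2⟩
    exact (hz.map (Int.castRingHom (ZMod p))).ne_zero
  have h3 := abs_wE_prod_sieve_sub_one_le hμ (by positivity) hμM
    (fun p hp => (mem_sievePrimes.1 hp).2) hR (fun l i => primorial w * c l i) b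
    (fun p hp l => by
      have : Fact p.Prime := ⟨(mem_sievePrimes.1 hp).2⟩
      obtain ⟨i, hi⟩ := h₁ l
      refine ⟨i, ?_⟩
      rw [Int.cast_mul]
      exact mul_ne_zero (coprime_primorial hp) (hunit p hp _ hi))
    (fun p hp l l' hl => by
      have : Fact p.Prime := ⟨(mem_sievePrimes.1 hp).2⟩
      obtain ⟨i, j, hij⟩ := h₂ l l' hl
      refine ⟨i, j, ?_⟩
      have h4 := mul_ne_zero (mul_ne_zero (coprime_primorial hp) (coprime_primorial hp))
        (hunit p hp _ hij)
      push_cast at h4 ⊢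
      convert h4 using 1
      ring)
  have h5 : ∀ (l : Λ) (x : ι → V), ∑ i, (primorial w * c l i) * val (x i) =
      primorial w * ∑ i, c l i * val (x i) := fun l x => by
    rw [Finset.mul_sum]
    exact Finset.sum_congr rfl fun i _ => by ring
  simp only [h5] at h3
  refine h3.trans (add_le_add ?_ ?_)
  · refine (prod_sievePrimes_sub_one_le hw R (by positivity)).trans ?_
    gcongr
    norm_num
  · gcongr

end Averages

section CornerForms

variable {d : ℕ}

lemma equidistributed_boxWeight {M : ℕ} (hd : 1 ≤ d) (hM : 1 ≤ M) (o : Option (Fin d)) :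
    Equidistributed (boxWeight d M o) (fun v => (v : ℤ)) (M : ℝ)⁻¹ := by
  intro q hq a
  obtain ⟨z, rfl⟩ := ZMod.intCast_surjective a
  set K := boxSide d M o with hK
  have hK0 : (0 : ℝ) < K := by exact_mod_cast boxSide_pos hd hM o
  have hMK : (M : ℝ) ≤ K := by
    have : M ≤ K := by
      cases o
      · exact Nat.le_mul_of_pos_left M hd
      · exact le_rfl
    exact_mod_cast this
  have hM0 : (0 : ℝ) < M := by exact_mod_cast hM
  have hq0 : (0 : ℝ) < q := by exact_mod_cast hq
  have hq0' : (0 : ℤ) < q := by exact_mod_cast hq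
  have h1 := sum_boxWeight_mul (M := M) hd o fun n => if (n : ZMod q) = z then 1 else 0
  simp only [mul_ite, mul_one, mul_zero] at h1
  rw [h1, Finset.sum_boole]
  set cnt := ((Finset.Icc (1 : ℤ) (K : ℤ)).filter fun n : ℤ => (n : ZMod q) = (z : ZMod q)).card
    with hcnt
  have h2 : (cnt : ℤ) = max (⌊((K : ℤ) - z : ℚ) / ((q : ℤ) : ℚ)⌋ -
      ⌊(((0 : ℤ) : ℚ) - z) / ((q : ℤ) : ℚ)⌋) 0 := by
    have h3 := Int.Ioc_filter_modEq_card 0 (K : ℤ) hq0' z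
    rw [← h3, hcnt]
    congr 2
    ext n
    simp only [Finset.mem_filter, Finset.mem_Icc, Finset.mem_Ioc,
      ZMod.intCast_eq_intCast_iff]
    constructor
    · exact fun h => ⟨⟨by omega, h.1.2⟩, h.2⟩
    · exact fun h => ⟨⟨by omega, h.1.2⟩, h.2⟩
  have hqQ : (0 : ℚ) < q := by exact_mod_cast hq
  have h4 : |(cnt : ℚ) - K / q| ≤ 1 := by
    have h5 : (cnt : ℚ) = max ((⌊((K : ℤ) - z : ℚ) / ((q : ℤ) : ℚ)⌋ : ℚ) -
      ⌊(((0 : ℤ) : ℚ) - z) / ((q : ℤ) : ℚ)⌋) 0 := by exact_mod_cast congrArg (Int.cast (R := ℚ)) h2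
    have h6 := Int.floor_le (((K : ℤ) - z : ℚ) / ((q : ℤ) : ℚ))
    have h7 := Int.lt_floor_add_one (((K : ℤ) - z : ℚ) / ((q : ℤ) : ℚ))
    have h8 := Int.floor_le ((((0 : ℤ) : ℚ) - z) / ((q : ℤ) : ℚ))
    have h9 := Int.lt_floor_add_one ((((0 : ℤ) : ℚ) - z) / ((q : ℤ) : ℚ))
    have h10 : ((K : ℤ) - z : ℚ) / ((q : ℤ) : ℚ) - (((0 : ℤ) : ℚ) - z) / ((q : ℤ) : ℚ) =
        (K : ℚ) / q := by
      push_cast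
      field_simp
      ring
    have h11 : (0 : ℚ) ≤ (K : ℚ) / q := by positivity
    rw [h5, abs_le]
    constructor
    · have := le_max_left ((⌊((K : ℤ) - z : ℚ) / ((q : ℤ) : ℚ)⌋ : ℚ) -
        ⌊(((0 : ℤ) : ℚ) - z) / ((q : ℤ) : ℚ)⌋) 0
      linarith
    · rw [sub_le_iff_le_add]
      refine max_le ?_ ?_ <;> linarith
  have h12 : |(cnt : ℝ) - K / q| ≤ 1 := by
    have := (Rat.cast_le (K := ℝ)).2 h4
    push_cast at this
    exact this
  have h13 : (K : ℝ)⁻¹ * cnt - (q : ℝ)⁻¹ = (K : ℝ)⁻¹ * (cnt - K / q) := by field_simp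
  rw [h13, abs_mul, abs_of_pos (inv_pos.2 hK0)]
  calc (K : ℝ)⁻¹ * |(cnt : ℝ) - K / q| ≤ (K : ℝ)⁻¹ * 1 := by gcongr
    _ ≤ (M : ℝ)⁻¹ := by rw [mul_one]; exact inv_anti₀ hM0 hMK

/-- The coefficients of the linear form `cornerForm j`. -/
def cornerCoeff (j : Fin d) : Option (Fin d) → ℤ
  | none => 1
  | some k => if k = j then 0 else -1

lemma sum_cornerCoeff_mul (j : Fin d) (u : Option (Fin d) → ℤ) :
    ∑ o, cornerCoeff j o * u o = cornerForm j u := by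
  rw [Fintype.sum_option, cornerForm, ← Finset.add_sum_erase _ _ (Finset.mem_univ j)]
  simp only [cornerCoeff, one_mul, if_true, zero_mul, zero_add, sub_eq_add_neg,
    ← Finset.sum_neg_distrib]
  congr 1
  exact Finset.sum_congr rfl fun k hk => by rw [if_neg (Finset.ne_of_mem_erase hk)]; ring

/-- The index type of the linear forms in the linear forms condition for corners. -/
abbrev FormIndex (𝒜 : Fin d → Finset (Finset (Option (Fin d)))) : Type :=
  (Fin d ⊕ Fin d) ⊕ (Σ j : Fin d, {A // A ∈ 𝒜 j})

variable {𝒜 : Fin d → Finset (Finset (Option (Fin d)))}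

/-- The coefficients of the linear forms in the linear forms condition for corners. -/
def formCoeff : FormIndex 𝒜 → Option (Fin d) ⊕ Option (Fin d) → ℤ
  | Sum.inl q, o => if o = Sum.map some some q then 1 else 0
  | Sum.inr q, Sum.inl i => if i ∈ q.2.1 then 0 else cornerCoeff q.1 i
  | Sum.inr q, Sum.inr i => if i ∈ q.2.1 then cornerCoeff q.1 i else 0

/-- The copy of the variable `i` selected by `A`. -/
def copyVar (A : Finset (Option (Fin d))) (i : Option (Fin d)) : Option (Fin d) ⊕ Option (Fin d) :=
  if i ∈ A then Sum.inr i else Sum.inl i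

lemma formCoeff_inr_copyVar (q : Σ j : Fin d, {A // A ∈ 𝒜 j}) (A : Finset (Option (Fin d)))
    (i : Option (Fin d)) : formCoeff (𝒜 := 𝒜) (Sum.inr q) (copyVar A i) =
      if (i ∈ q.2.1 ↔ i ∈ A) then cornerCoeff q.1 i else 0 := by
  unfold copyVar
  by_cases h : i ∈ A <;> by_cases h' : i ∈ q.2.1 <;> simp [formCoeff, h, h']

lemma formCoeff_inl_copyVar (q : Fin d ⊕ Fin d) (A : Finset (Option (Fin d))) :
    formCoeff (𝒜 := 𝒜) (Sum.inl q) (copyVar A none) = 0 := by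
  unfold copyVar
  by_cases h : none ∈ A <;> cases q <;> simp [formCoeff, h]

lemma exists_isUnit_formCoeff (l : FormIndex 𝒜) : ∃ o, IsUnit (formCoeff l o) := by
  rcases l with q | q
  · exact ⟨Sum.map some some q, by simp [formCoeff]⟩
  · exact ⟨copyVar q.2.1 none, by rw [formCoeff_inr_copyVar]; simp [cornerCoeff]⟩

lemma exists_isUnit_minor_inr (h𝒜 : ∀ j, ∀ A ∈ 𝒜 j, some j ∉ A)
    {q q' : Σ j : Fin d, {A // A ∈ 𝒜 j}} (hq : q ≠ q') :
    ∃ o o', IsUnit (formCoeff (𝒜 := 𝒜) (Sum.inr q) o * formCoeff (𝒜 := 𝒜) (Sum.inr q') o' -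
      formCoeff (𝒜 := 𝒜) (Sum.inr q) o' * formCoeff (𝒜 := 𝒜) (Sum.inr q') o) := by
  obtain ⟨j, A, hA⟩ := q
  obtain ⟨j', A', hA'⟩ := q'
  by_cases h1 : none ∈ A ↔ none ∈ A'
  · suffices h : ∃ i : Option (Fin d), cornerCoeff j i = -1 ∧
        ((i ∈ A' ↔ i ∈ A) → cornerCoeff j' i = 0) by
      obtain ⟨i, hi, hi'⟩ := h
      refine ⟨copyVar A none, copyVar A i, ?_⟩
      simp only [formCoeff_inr_copyVar, iff_self, if_true, hi, h1.symm]
      by_cases h2 : i ∈ A' ↔ i ∈ A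
      · simp only [if_pos h2, hi' h2]
        simp [cornerCoeff]
      · simp [h2, cornerCoeff]
    by_cases hj : j = j'
    · subst hj
      have hAA : A ≠ A' := fun h => hq (by subst h; rfl)
      obtain ⟨i, hi⟩ : ∃ i, ¬ (i ∈ A' ↔ i ∈ A) := by
        by_contra! h
        exact hAA (Finset.ext fun i => (h i).symm)
      refine ⟨i, ?_, fun h => absurd h hi⟩
      cases i with
      | none => exact absurd h1.symm hi
      | some k =>
        refine if_neg fun hk => hi ?_
        subst hk
        exact iff_of_false (h𝒜 _ _ hA') (h𝒜 _ _ hA)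
    · exact ⟨some j', if_neg (Ne.symm hj), fun _ => if_pos rfl⟩
  · refine ⟨copyVar A none, copyVar A' none, ?_⟩
    have h2 : ¬ (none ∈ A' ↔ none ∈ A) := fun h => h1 h.symm
    simp [formCoeff_inr_copyVar, h1, h2, cornerCoeff]

lemma exists_isUnit_minor (h𝒜 : ∀ j, ∀ A ∈ 𝒜 j, some j ∉ A) {l l' : FormIndex 𝒜} (hl : l ≠ l') :
    ∃ o o', IsUnit (formCoeff l o * formCoeff l' o' - formCoeff l o' * formCoeff l' o) := by
  rcases l with q | q <;> rcases l' with q' | q'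
  · have h1 : Sum.map some some q ≠ Sum.map some some q' := fun h => hl (congrArg Sum.inl
      (Sum.map_injective.2 ⟨Option.some_injective _, Option.some_injective _⟩ h))
    refine ⟨Sum.map some some q, Sum.map some some q', ?_⟩
    simp [formCoeff, h1, h1.symm]
  · refine ⟨Sum.map some some q, copyVar q'.2.1 none, ?_⟩
    rw [formCoeff_inl_copyVar, formCoeff_inr_copyVar]
    simp [formCoeff, cornerCoeff]
  · refine ⟨copyVar q.2.1 none, Sum.map some some q', ?_⟩
    rw [formCoeff_inl_copyVar, formCoeff_inr_copyVar]
    simp [formCoeff, cornerCoeff]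
  · exact exists_isUnit_minor_inr h𝒜 fun h => hl (congrArg _ h)

lemma sum_formCoeff_inr_mul (q : Σ j : Fin d, {A // A ∈ 𝒜 j}) {V : Type} (val : V → ℤ)
    (z : Option (Fin d) ⊕ Option (Fin d) → V) :
    ∑ o, formCoeff (𝒜 := 𝒜) (Sum.inr q) o * val (z o) =
      cornerForm q.1 fun o => val (q.2.1.piecewise (fun i => z (Sum.inr i))
        (fun i => z (Sum.inl i)) o) := by
  rw [← sum_cornerCoeff_mul, Fintype.sum_sum_type, ← Finset.sum_add_distrib]
  refine Finset.sum_congr rfl fun i _ => ?_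
  by_cases h : i ∈ q.2.1 <;> simp [formCoeff, h]

lemma card_formIndex_le : Fintype.card (FormIndex 𝒜) ≤ 2 * d + d * 2 ^ (d + 1) := by
  rw [Fintype.card_sum, Fintype.card_sum, Fintype.card_sigma, Fintype.card_fin]
  have h1 : ∑ j : Fin d, Fintype.card {A // A ∈ 𝒜 j} ≤ d * 2 ^ (d + 1) := by
    refine (Finset.sum_le_card_nsmul _ _ (2 ^ (d + 1)) fun j _ => ?_).trans_eq (by simp)
    refine (Fintype.card_subtype_le _).trans_eq ?_
    rw [Fintype.card_finset, Fintype.card_option, Fintype.card_fin]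
  omega

variable (d) in
/-- A bound for the number of linear forms in the linear forms condition for corners. -/
def formCount : ℕ := 2 * d + d * 2 ^ (d + 1)

variable {M w R : ℕ}

lemma abs_sum_boxWeight_mul_sieve_sub_one_le (hd : 1 ≤ d) (hM : 1 ≤ M) (hw : 1 ≤ w) (hR : 1 ≤ R)
    (j : Fin d) (b : ℤ) :
    |∑ v, boxWeight d M (some j) v * sieve (sievePrimes w R) R (primorial w * v + b) - 1| ≤
      formsError (formCount d) (2 * (d + 1)) w R M := by
  have h1 := abs_wE_prod_sieve_sub_one_le_formsError (Λ := Unit) (isWeight_boxWeight hd hM)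
    (equidistributed_boxWeight hd hM) hw hR (L := formCount d) (n := 2 * (d + 1))
    (by rw [Fintype.card_unit, formCount]; omega) (by simp)
    (fun _ o => if o = some j then 1 else 0) (fun _ => b) (fun _ => ⟨some j, by simp⟩)
    (fun l l' h => absurd (Subsingleton.elim l l') h)
  simp only [Finset.univ_unique, Finset.prod_singleton, ite_mul, one_mul, zero_mul,
    Finset.sum_ite_eq', Finset.mem_univ, if_true] at h1
  rwa [wE_apply (isWeight_boxWeight hd hM) (some j)
    fun v => sieve (sievePrimes w R) R (primorial w * v + b)] at h1

lemma abs_wE_wE_prod_sieve_sub_one_le (hd : 1 ≤ d) (hM : 1 ≤ M) (hw : 1 ≤ w) (hR : 1 ≤ R)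
    (b : Fin d → ℤ) (h𝒜 : ∀ j, ∀ A ∈ 𝒜 j, some j ∉ A) {s : Fin d → ℤ → ℝ}
    (hs : ∀ j n, s j n = sieve (sievePrimes w R) R (primorial w * n + b j)) :
    |(wE (boxWeight d M) fun x => wE (boxWeight d M) fun y =>
      (∏ j, s j (x (some j)) * s j (y (some j))) *
        ∏ j, ∏ A ∈ 𝒜 j, s j (cornerForm j fun o => (A.piecewise y x o : ℤ))) - 1| ≤
      formsError (formCount d) (2 * (d + 1)) w R M := by
  have hu := isWeight_boxWeight (d := d) hd hM
  have h1 := abs_wE_prod_sieve_sub_one_le_formsError (Λ := FormIndex 𝒜) (hu.sumElim hu)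
    (val := fun v => (v : ℤ)) (M := M) (w := w) (R := R)
    (fun i => by
      cases i
      exacts [equidistributed_boxWeight hd hM _, equidistributed_boxWeight hd hM _]) hw hR
    (L := formCount d) (n := 2 * (d + 1)) card_formIndex_le (by simp; omega) formCoeff
    (Sum.elim (Sum.elim b b) fun q => b q.1) exists_isUnit_formCoeff
    (fun l l' hl => exists_isUnit_minor h𝒜 hl)
  rw [← wE_sumElim]
  refine le_of_eq_of_le ?_ h1
  congr 3
  funext z
  rw [Fintype.prod_sum_type, Fintype.prod_sum_type, Fintype.prod_sigma, Finset.prod_mul_distrib]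
  simp only [hs]
  congr 1
  · congr 1 <;>
    · refine Finset.prod_congr rfl fun j _ => ?_
      simp [formCoeff]
  · refine Finset.prod_congr rfl fun j _ => ?_
    rw [← Finset.prod_coe_sort]
    refine Finset.prod_congr rfl fun A _ => ?_
    rw [sum_formCoeff_inr_mul ⟨j, A⟩ (fun v : Box d M => (v : ℤ)) z]
    rfl

end CornerForms

section LargePoints

open Classical

variable {d : ℕ}

/-- The `d`-tuples of primes in `[1,N]`. -/
def primeBox (d N : ℕ) : Finset (Fin d → ℤ) :=
  Fintype.piFinset fun _ => ((Finset.Icc 1 N).filter Nat.Prime).map Nat.castEmbedding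

lemma mem_primeBox {N : ℕ} {a : Fin d → ℤ} :
    a ∈ primeBox d N ↔ ∀ j, ∃ p : ℕ, (p ≤ N ∧ p.Prime) ∧ (p : ℤ) = a j := by
  simp only [primeBox, Fintype.mem_piFinset, Finset.mem_map, Finset.mem_filter, Finset.mem_Icc,
    Nat.castEmbedding_apply]
  refine forall_congr' fun j => exists_congr fun p => and_congr_left fun _ => ?_
  exact ⟨fun h => ⟨h.1.2, h.2⟩, fun h => ⟨⟨h.2.one_le, h.1⟩, h.2⟩⟩

/-- The points of `A ∩ [1,N]^d` all of whose coordinates are primes exceeding `√N`. -/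
noncomputable def largePoints (A : Set (Fin d → ℤ)) (N : ℕ) : Finset (Fin d → ℤ) :=
  (primeBox d N).filter fun a => a ∈ A ∧ ∀ j, (Nat.sqrt N : ℤ) < a j

lemma ncard_le_card_largePoints_add {A : Set (Fin d → ℤ)} (hA : ∀ x ∈ A, ∀ i, 0 < x i ∧ Prime (x i))
    (N : ℕ) : (A ∩ {x | ∀ i, 1 ≤ x i ∧ x i ≤ (N : ℤ)}).ncard ≤
      (largePoints A N).card + d * (Nat.sqrt N * primeCount N ^ (d - 1)) := by
  set P : Finset ℤ := ((Finset.Icc 1 N).filter Nat.Prime).map Nat.castEmbedding with hP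
  set bad : Fin d → Finset (Fin d → ℤ) := fun i =>
    Fintype.piFinset fun j => if j = i then Finset.Icc 1 (Nat.sqrt N : ℤ) else P with hbad
  have hbadcard : ∀ i, (bad i).card = Nat.sqrt N * primeCount N ^ (d - 1) := fun i => by
    rw [hbad, Fintype.card_piFinset, ← Finset.mul_prod_erase _ _ (Finset.mem_univ i), if_pos rfl]
    congr 1
    · simp
    · rw [Finset.prod_congr rfl (g := fun _ => primeCount N)]
      · rw [Finset.prod_const, Finset.card_erase_of_mem (Finset.mem_univ i), Finset.card_univ,
          Fintype.card_fin]
      · intro j hj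
        rw [if_neg (Finset.ne_of_mem_erase hj), hP, Finset.card_map, primeCount]
  have hmem : ∀ x ∈ A, (∀ i, 1 ≤ x i ∧ x i ≤ (N : ℤ)) → x ∈ primeBox d N := fun x hx hxN => by
    refine mem_primeBox.2 fun j => ⟨(x j).natAbs, ⟨?_, Int.prime_iff_natAbs_prime.1 (hA x hx j).2⟩, ?_⟩
    · have := hxN j
      omega
    · have := hxN j
      omega
  have h1 : A ∩ {x | ∀ i, 1 ≤ x i ∧ x i ≤ (N : ℤ)} ⊆
      ((largePoints A N ∪ Finset.univ.biUnion bad : Finset (Fin d → ℤ)) : Set (Fin d → ℤ)) := by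
    rintro x ⟨hx, hxN⟩
    have hx' := hmem x hx hxN
    rw [Finset.mem_coe, Finset.mem_union]
    by_cases h : ∀ j, (Nat.sqrt N : ℤ) < x j
    · exact Or.inl (Finset.mem_filter.2 ⟨hx', hx, h⟩)
    · push Not at h
      obtain ⟨i, hi⟩ := h
      refine Or.inr (Finset.mem_biUnion.2 ⟨i, Finset.mem_univ i, ?_⟩)
      refine Fintype.mem_piFinset.2 fun j => ?_
      split_ifs with hj
      · subst hj
        exact Finset.mem_Icc.2 ⟨(hxN j).1, hi⟩
      · exact Fintype.mem_piFinset.1 hx' j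
  calc _ ≤ (largePoints A N ∪ Finset.univ.biUnion bad).card := by
        rw [← Set.ncard_coe_finset]
        exact Set.ncard_le_ncard h1 (Finset.finite_toSet _)
    _ ≤ (largePoints A N).card + ∑ i, (bad i).card :=
        (Finset.card_union_le _ _).trans (Nat.add_le_add_left Finset.card_biUnion_le _)
    _ = _ := by simp [hbadcard]

/-- The quotients by `W` of the points of `T` congruent to `b` modulo `W`. -/
noncomputable def residueClass (T : Finset (Fin d → ℤ)) (W : ℕ) (b : Fin d → ℤ) :
    Finset (Fin d → ℤ) :=
  (T.filter fun a => ∀ j, a j % W = b j).image fun a j => a j / W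

lemma mem_of_mem_residueClass {T : Finset (Fin d → ℤ)} {W : ℕ} {b n : Fin d → ℤ}
    (hn : n ∈ residueClass T W b) : (fun j => W * n j + b j) ∈ T := by
  obtain ⟨a, ha, rfl⟩ := Finset.mem_image.1 hn
  obtain ⟨ha, hb⟩ := Finset.mem_filter.1 ha
  convert ha using 1
  funext j
  rw [← hb j]
  exact Int.mul_ediv_add_emod _ _

lemma exists_card_le_mul_card_residueClass (T : Finset (Fin d → ℤ)) {W : ℕ} (hW : 0 < W)
    (hT : ∀ a ∈ T, ∀ j, ∃ p : ℕ, W.Coprime p ∧ (p : ℤ) = a j) :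
    ∃ b : Fin d → ℤ, (∀ j, 0 ≤ b j ∧ b j < W) ∧
      (T.card : ℝ) ≤ (Nat.totient W : ℝ) ^ d * (residueClass T W b).card := by
  set t : Finset (Fin d → ℤ) := Fintype.piFinset fun _ =>
    ((Finset.range W).filter fun r => W.Coprime r).map Nat.castEmbedding with ht
  have htcard : t.card = Nat.totient W ^ d := by
    rw [ht, Fintype.card_piFinset]
    simp [Nat.totient]
  have hφ : (0 : ℝ) < (Nat.totient W : ℝ) ^ d := by
    have := Nat.totient_pos.2 hW
    positivity
  have hmaps : ∀ a ∈ T, (fun j => a j % (W : ℤ)) ∈ t := fun a ha => by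
    refine Fintype.mem_piFinset.2 fun j => ?_
    obtain ⟨p, hp, hpa⟩ := hT a ha j
    refine Finset.mem_map.2 ⟨p % W, Finset.mem_filter.2 ⟨Finset.mem_range.2 (Nat.mod_lt _ hW), ?_⟩, ?_⟩
    · rw [Nat.coprime_comm, Nat.Coprime, ← Nat.gcd_rec]
      exact hp
    · rw [Nat.castEmbedding_apply, ← hpa, Int.natCast_mod]
  have htne : t.Nonempty := by
    rw [← Finset.card_pos, htcard]
    exact pow_pos (Nat.totient_pos.2 hW) d
  obtain ⟨b, hb, hle⟩ := Finset.exists_le_card_fiber_of_nsmul_le_card_of_maps_to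
    (b := (T.card : ℝ) / (Nat.totient W : ℝ) ^ d) hmaps htne (by
      rw [htcard, nsmul_eq_mul]
      push_cast
      rw [mul_div_cancel₀ _ hφ.ne'])
  refine ⟨b, fun j => ?_, ?_⟩
  · obtain ⟨r, hr, hrb⟩ := Finset.mem_map.1 (Fintype.mem_piFinset.1 hb j)
    have := Finset.mem_range.1 (Finset.mem_filter.1 hr).1
    rw [Nat.castEmbedding_apply] at hrb
    omega
  · rw [div_le_iff₀' hφ] at hle
    refine hle.trans (mul_le_mul_of_nonneg_left ?_ hφ.le)
    rw [residueClass, Finset.card_image_of_injOn]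
    · exact_mod_cast Finset.card_le_card fun a ha => by
        obtain ⟨h1, h2⟩ := Finset.mem_filter.1 ha
        exact Finset.mem_filter.2 ⟨h1, fun j => congrFun h2 j⟩
    · intro a ha a' ha' haa
      funext j
      have h1 := (Finset.mem_filter.1 (Finset.mem_coe.1 ha)).2 j
      have h2 := (Finset.mem_filter.1 (Finset.mem_coe.1 ha')).2 j
      have h3 : a j / (W : ℤ) = a' j / W := congrFun haa j
      rw [← Int.mul_ediv_add_emod (a j) W, ← Int.mul_ediv_add_emod (a' j) W, h1, h2, h3]

lemma cornerPairs_finite (hd : 1 ≤ d) (A : Set (Fin d → ℤ)) (N : ℕ) : (cornerPairs d A N).Finite := by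
  refine Set.Finite.subset (((Fintype.piFinset fun _ : Fin d => Finset.Icc (1 : ℤ) N) ×ˢ
    Finset.Icc (-N : ℤ) N : Finset ((Fin d → ℤ) × ℤ)).finite_toSet) ?_
  rintro ⟨x, t⟩ ⟨-, ⟨-, h1⟩, h2⟩
  rw [Finset.mem_coe, Finset.mem_product]
  refine ⟨Fintype.mem_piFinset.2 fun j => Finset.mem_Icc.2 (h1 j), Finset.mem_Icc.2 ?_⟩
  have h3 := (h2 ⟨0, hd⟩).2 ⟨0, hd⟩
  have h4 := h1 ⟨0, hd⟩
  rw [if_pos rfl] at h3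
  dsimp only at h3 h4 ⊢
  omega

lemma card_boxCorners_le (hd : 1 ≤ d) {A : Set (Fin d → ℤ)} {N M W : ℕ} (hW : 0 < W)
    {b : Fin d → ℤ} {S : Finset (Fin d → ℤ)} (hS : ∀ a ∈ S, ∀ j, 1 ≤ a j ∧ a j ≤ M)
    (hSA : ∀ a ∈ S, (fun j => W * a j + b j) ∈ A ∧
      ∀ j, 1 ≤ W * a j + b j ∧ W * a j + b j ≤ N) :
    (boxCorners d M S).card ≤ (cornerPairs d A N).ncard + M ^ d := by
  have hW0 : (W : ℤ) ≠ 0 := by exact_mod_cast hW.ne'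
  set t : (Option (Fin d) → Box d M) → ℤ := fun x => x none - ∑ k, (x (some k) : ℤ) with ht
  have hform : ∀ (x : Option (Fin d) → Box d M) j,
      cornerForm j (fun o => (x o : ℤ)) = x (some j) + t x := fun x j => by
    have := Finset.add_sum_erase Finset.univ (fun k => (x (some k) : ℤ)) (Finset.mem_univ j)
    simp only [cornerForm, ht]
    linarith
  rw [← Finset.card_filter_add_card_filter_not (s := boxCorners d M S) fun x => t x ≠ 0]
  refine add_le_add ?_ ?_
  · rw [← Set.ncard_coe_finset]
    refine Set.ncard_le_ncard_of_injOn
      (fun x => ((fun j => W * (x (some j) : ℤ) + b j), W * t x)) ?_ ?_ (cornerPairs_finite hd A N)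
    · intro x hx
      obtain ⟨h1, h2⟩ := Finset.mem_filter.1 (Finset.mem_coe.1 hx)
      obtain ⟨-, h3, h4⟩ := Finset.mem_filter.1 h1
      have h5 : ∀ i j, W * cornerPoint i (fun o => (x o : ℤ)) j + b j =
          W * (x (some j) : ℤ) + b j + if j = i then W * t x else 0 := fun i j => by
        rw [cornerPoint]
        split_ifs with hj
        · subst hj
          rw [hform]
          ring
        · ring
      refine ⟨mul_ne_zero hW0 h2, hSA _ h3, fun i => ?_⟩
      have h6 := hSA _ (h4 i)
      simp only [h5] at h6
      exact h6
    · intro x _ y _ hxy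
      obtain ⟨h1, h2⟩ := Prod.ext_iff.1 hxy
      have h3 : ∀ j, (x (some j) : ℤ) = y (some j) := fun j => by
        have := congrFun h1 j
        exact mul_left_cancel₀ hW0 (add_right_cancel this)
      have h4 : t x = t y := mul_left_cancel₀ hW0 h2
      funext o
      cases o with
      | none =>
        refine Subtype.ext ?_
        simp only [ht, h3] at h4
        linarith
      | some j => exact Subtype.ext (h3 j)
  · have hcard : (Fintype.piFinset fun _ : Fin d => Finset.Icc (1 : ℤ) M).card = M ^ d := by
      simp [Fintype.card_piFinset]
    rw [← hcard]
    refine Finset.card_le_card_of_injOn (fun x j => (x (some j) : ℤ)) ?_ ?_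
    · intro x hx
      obtain ⟨-, h3, -⟩ := Finset.mem_filter.1 (Finset.mem_filter.1 (Finset.mem_coe.1 hx)).1
      exact Finset.mem_coe.2 (Fintype.mem_piFinset.2 fun j => Finset.mem_Icc.2 (hS _ h3 j))
    · intro x hx y hy hxy
      have h1 := not_not.1 (Finset.mem_filter.1 (Finset.mem_coe.1 hx)).2
      have h2 := not_not.1 (Finset.mem_filter.1 (Finset.mem_coe.1 hy)).2
      have h3 : ∀ j, (x (some j) : ℤ) = y (some j) := fun j => congrFun hxy j
      funext o
      cases o with
      | none =>
        refine Subtype.ext ?_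
        simp only [ht, h3] at h1 h2
        linarith
      | some j => exact Subtype.ext (h3 j)

end LargePoints

section Asymptotics

lemma primeCount_eq_primeCounting (N : ℕ) : primeCount N = Nat.primeCounting N := by
  rw [primeCount, Nat.primeCounting, Nat.primeCounting', Nat.count_eq_card_filter_range]
  congr 1
  ext p
  simp only [Finset.mem_filter, Finset.mem_Icc, Finset.mem_range]
  exact ⟨fun h => ⟨by omega, h.2⟩, fun h => ⟨⟨h.2.one_le, by omega⟩, h.2⟩⟩

lemma eventually_mul_log_pow_le (c : ℝ) (m : ℕ) :
    ∀ᶠ N : ℕ in atTop, c * Real.log N ^ m ≤ N := by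
  have h1 := (Real.isLittleO_pow_log_id_atTop (n := m)).comp_tendsto
    (tendsto_natCast_atTop_atTop (R := ℝ))
  filter_upwards [h1.def (c := (|c| + 1)⁻¹) (by positivity)] with N hN
  simp only [Function.comp_apply, id_eq, Real.norm_eq_abs, Nat.abs_cast] at hN
  rw [inv_mul_eq_div, le_div_iff₀' (by positivity)] at hN
  have h2 := abs_nonneg (Real.log N ^ m)
  have h3 := le_abs_self (c * Real.log N ^ m)
  rw [abs_mul] at h3
  linarith

lemma eventually_mul_sqrt_le (c : ℝ) : ∀ᶠ N : ℕ in atTop, c * Nat.sqrt N ≤ N := by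
  filter_upwards [eventually_ge_atTop (⌈c⌉₊ ^ 2)] with N hN
  have h1 : ⌈c⌉₊ ≤ Nat.sqrt N := Nat.le_sqrt'.2 hN
  have h2 : c ≤ Nat.sqrt N := (Nat.le_ceil c).trans (by exact_mod_cast h1)
  have h3 : (Nat.sqrt N : ℝ) * Nat.sqrt N ≤ N := by exact_mod_cast Nat.sqrt_le N
  exact (mul_le_mul_of_nonneg_right h2 (Nat.cast_nonneg _)).trans h3

lemma eventually_div_log_le_primeCount :
    ∀ᶠ N : ℕ in atTop, (N : ℝ) / (2 * Real.log N) ≤ primeCount N := by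
  have h1 := (tendsto_add_atTop_nat 1).eventually (eventually_mul_log_pow_le 10 1)
  filter_upwards [h1, eventually_ge_atTop 2] with N hN hN2
  have h2 : (2 : ℝ) ≤ N := by exact_mod_cast hN2
  have hl : 0 < Real.log N := Real.log_pos (by linarith)
  rw [primeCount_eq_primeCounting]
  refine le_trans ?_ (Chebyshev.pi_ge N)
  rw [div_mul_eq_div_div]
  gcongr
  have := Real.log_two_gt_d9
  push_cast at hN
  nlinarith

lemma eventually_mul_sqrt_le_primeCount (c : ℝ) :
    ∀ᶠ N : ℕ in atTop, c * Nat.sqrt N ≤ primeCount N := by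
  filter_upwards [eventually_div_log_le_primeCount, eventually_ge_atTop 2,
    eventually_mul_log_pow_le ((2 * c) ^ 2) 2] with N h1 hN2 h3
  have h2 : (2 : ℝ) ≤ N := by exact_mod_cast hN2
  have hl : 0 < Real.log N := Real.log_pos (by linarith)
  refine le_trans ?_ h1
  rw [le_div_iff₀ (by positivity)]
  have h4 : 2 * c * Real.log N ≤ Real.sqrt N := by
    refine Real.le_sqrt_of_sq_le ?_
    rw [mul_pow]
    exact h3
  have h5 : (Nat.sqrt N : ℝ) ≤ Real.sqrt N := Real.nat_sqrt_le_real_sqrt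
  calc c * Nat.sqrt N * (2 * Real.log N) = (2 * c * Real.log N) * Nat.sqrt N := by ring
    _ ≤ Real.sqrt N * Real.sqrt N := by gcongr
    _ = N := Real.mul_self_sqrt (by positivity)

lemma exists_exp_div_sub_one_le (a : ℝ) {ε : ℝ} (hε : 0 < ε) :
    ∃ w : ℕ, 1 ≤ w ∧ Real.exp (a / w) - 1 ≤ ε := by
  have h1 : Tendsto (fun w : ℕ => Real.exp (a / w)) atTop (𝓝 (Real.exp 0)) :=
    (Real.continuous_exp.tendsto 0).comp (tendsto_const_div_atTop_nhds_zero_nat a)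
  rw [Real.exp_zero] at h1
  obtain ⟨w, h2, h3⟩ := ((eventually_ge_atTop 1).and
    (h1.eventually (gt_mem_nhds (show (1 : ℝ) < 1 + ε by linarith)))).exists
  exact ⟨w, h2, by linarith⟩

end Asymptotics

section Arithmetic

variable {d : ℕ}

lemma mul_pow_le_card_mul_pow {α k π B N l r φ W M T S : ℝ} (hα : 0 < α) (hk : 0 < k) (hl : 0 < l)
    (hφ : 0 < φ) (hW : 0 < W) (hB : 0 ≤ B) (hM : 0 ≤ M) (hN : 0 ≤ N) (hπ : N / (2 * l) ≤ π)
    (hφB : φ * r ≤ W * B) (hr : l ≤ 2 * k * r) (hMN : W * M ≤ N) (hT : α / 4 * π ^ d ≤ T)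
    (hS : T ≤ φ ^ d * S) : α / 4 * (1 / (4 * k)) ^ d * M ^ d ≤ S * B ^ d := by
  have h1 : φ * (1 / (4 * k) * M) ≤ π * B := by
    have h2 : φ * l / (2 * k * W) ≤ B := by
      rw [div_le_iff₀ (by positivity)]
      nlinarith [mul_le_mul_of_nonneg_left hr hφ.le]
    calc φ * (1 / (4 * k) * M) = (W * M) / (2 * l) * (φ * l / (2 * k * W)) := by
          field_simp
          ring
      _ ≤ N / (2 * l) * (φ * l / (2 * k * W)) := by gcongr
      _ ≤ π * B := mul_le_mul hπ h2 (by positivity) (le_trans (by positivity) hπ)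
  have h3 : φ ^ d * (α / 4 * (1 / (4 * k)) ^ d * M ^ d) ≤ φ ^ d * (S * B ^ d) := by
    calc φ ^ d * (α / 4 * (1 / (4 * k)) ^ d * M ^ d) = α / 4 * (φ * (1 / (4 * k) * M)) ^ d := by
          simp only [mul_pow]
          ring
      _ ≤ α / 4 * (π * B) ^ d := by gcongr
      _ = α / 4 * π ^ d * B ^ d := by rw [mul_pow, mul_assoc]
      _ ≤ φ ^ d * S * B ^ d := 
          mul_le_mul_of_nonneg_right (hT.trans hS) (by positivity)
      _ = _ := by ring
  exact le_of_mul_le_mul_left h3 (by positivity)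

lemma pow_le_mul_log_pow {α π B N l φ W M T S : ℝ} (hα : 0 < α) (hl : 0 < l) (hφ : 0 < φ)
    (hφW : φ ≤ W) (hB : 0 ≤ B) (hM : 0 ≤ M) (hN : 0 < N) (hπ : N / (2 * l) ≤ π) (hMN : W * M ≤ N)
    (hT : α / 4 * π ^ d ≤ T) (hS : T ≤ φ ^ d * S) (hSB : S * B ^ d ≤ 2 ^ d * M ^ d) :
    B ^ d ≤ 4 / α * 4 ^ d * l ^ d := by
  have h1 : α / 4 * (N / (2 * l)) ^ d * B ^ d ≤ (2 * N) ^ d := by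
    calc α / 4 * (N / (2 * l)) ^ d * B ^ d ≤ α / 4 * π ^ d * B ^ d := by gcongr
      _ ≤ φ ^ d * S * B ^ d := 
          mul_le_mul_of_nonneg_right (hT.trans hS) (by positivity)
      _ = φ ^ d * (S * B ^ d) := by ring
      _ ≤ φ ^ d * (2 ^ d * M ^ d) := by gcongr
      _ = (2 * (φ * M)) ^ d := by simp only [mul_pow]; ring
      _ ≤ (2 * N) ^ d := by
        gcongr
        exact (mul_le_mul_of_nonneg_right hφW hM).trans hMN
  have h2 : α / 4 * (N / (2 * l)) ^ d * (4 / α * 4 ^ d * l ^ d) = (2 * N) ^ d := by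
    have h3 : (N / (2 * l)) ^ d * (4 ^ d * l ^ d) = (2 * N) ^ d := by
      rw [← mul_pow, ← mul_pow]
      congr 1
      field_simp
      ring
    rw [← h3]
    field_simp
  rw [← h2] at h1
  exact le_of_mul_le_mul_left h1 (by positivity)

lemma mul_pow_div_log_pow_le {ε K W N M l B c p : ℝ} (hε : 0 < ε) (hK : 0 < K) (hW : 0 < W)
    (hl : 0 < l) (hB : 0 ≤ B) (hM : 0 ≤ M) (hN : 0 ≤ N) (hNM : N ≤ 2 * W * M) (hp : 0 ≤ p)
    (hc : ε * M ^ (d + 1) ≤ c * B ^ (2 * d)) (hcp : c ≤ p + M ^ d) (hBl : B ^ d ≤ K * l ^ d)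
    (hlM : 2 * K ^ 2 * l ^ (2 * d) ≤ ε * M) :
    ε / (2 * K ^ 2 * (2 * W) ^ (d + 1)) * N ^ (d + 1) / l ^ (2 * d) ≤ p := by
  have h1 : B ^ (2 * d) ≤ K ^ 2 * l ^ (2 * d) := by
    calc B ^ (2 * d) = (B ^ d) ^ 2 := by rw [← pow_mul, mul_comm]
      _ ≤ (K * l ^ d) ^ 2 := by gcongr
      _ = K ^ 2 * l ^ (2 * d) := by rw [mul_pow, ← pow_mul, mul_comm d 2]
  have h2 : ε * M ^ (d + 1) ≤ (p + M ^ d) * (K ^ 2 * l ^ (2 * d)) := by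
    refine hc.trans ?_
    calc c * B ^ (2 * d) ≤ (p + M ^ d) * B ^ (2 * d) := by gcongr
      _ ≤ _ := by gcongr
  have h3 : M ^ d * (2 * K ^ 2 * l ^ (2 * d)) ≤ M ^ d * (ε * M) := by gcongr
  have h4 : N ^ (d + 1) ≤ (2 * W) ^ (d + 1) * M ^ (d + 1) := by
    rw [← mul_pow]
    gcongr
  rw [div_le_iff₀ (by positivity), div_mul_eq_mul_div, div_le_iff₀ (by positivity)]
  calc ε * N ^ (d + 1) ≤ ε * ((2 * W) ^ (d + 1) * M ^ (d + 1)) := by gcongr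
    _ = (2 * W) ^ (d + 1) * (ε * M ^ (d + 1)) := by ring
    _ ≤ (2 * W) ^ (d + 1) * (2 * (p * (K ^ 2 * l ^ (2 * d)))) := by
      refine mul_le_mul_of_nonneg_left ?_ (by positivity)
      have h5 : M ^ d * (ε * M) = ε * M ^ (d + 1) := by ring
      linarith
    _ = _ := by ring

end Arithmetic

section Counting

variable {d : ℕ}

lemma formsError_le {L n w R M N : ℕ} {W ε : ℝ} (hε : 0 < ε) (hW : 0 < W) (hM : 1 ≤ M)
    (hw : Real.exp (64 ^ L / w) - 1 ≤ ε / 2)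
    (hR : R ^ (5 * L + 2 * L * n) ≤ Nat.sqrt N) (hNM : (N : ℝ) ≤ 2 * W * M)
    (hN : 4 * W * n / ε * Nat.sqrt N ≤ N) : formsError L n w R M ≤ ε := by
  have hM0 : (0 : ℝ) < M := by exact_mod_cast hM
  have h1 : (R : ℝ) ^ (5 * L + 2 * L * n) ≤ Nat.sqrt N := by exact_mod_cast hR
  have h2 : (R : ℝ) ^ (5 * L + 2 * L * n) * (n * (M : ℝ)⁻¹) ≤ ε / 2 := by
    refine (mul_le_mul_of_nonneg_right h1 (by positivity)).trans ?_
    rw [← mul_assoc, ← div_eq_mul_inv, div_le_iff₀ hM0]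
    rw [div_mul_eq_mul_div, div_le_iff₀ hε] at hN
    have h3 : 4 * W * (Nat.sqrt N * n) ≤ 4 * W * (ε / 2 * M) := by nlinarith
    exact le_of_mul_le_mul_left h3 (by positivity)
  unfold formsError
  linarith

lemma exists_mul_pow_le_ncard_cornerPairs (hd : 1 ≤ d) {α : ℝ} (hα : 0 < α) :
    ∃ C : ℝ, 0 < C ∧ ∀ᶠ N : ℕ in atTop, ∀ A : Set (Fin d → ℤ),
      (∀ x ∈ A, ∀ i, 0 < x i ∧ Prime (x i)) →
      α / 2 * (primeCount N : ℝ) ^ d ≤ ((A ∩ {x | ∀ i, 1 ≤ x i ∧ x i ≤ (N : ℤ)}).ncard : ℝ) →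
      C * (N : ℝ) ^ (d + 1) / Real.log N ^ (2 * d) ≤ ((cornerPairs d A N).ncard : ℝ) := by
  classical
  set L := formCount d with hL
  set n := 2 * (d + 1) with hn
  set k := 5 * L + 2 * L * n with hk
  have hk1 : 1 ≤ k := by
    have : 1 ≤ L := by rw [hL, formCount]; omega
    omega
  have hk0 : (0 : ℝ) < k := by exact_mod_cast hk1
  obtain ⟨ε, hε, hmain⟩ := exists_mul_le_card_boxCorners hd
    (show 0 < α / 4 * (1 / (4 * (k : ℝ))) ^ d by positivity)
  set η : ℝ := min ε (1 / 2) with hη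
  have hη0 : 0 < η := lt_min hε (by norm_num)
  obtain ⟨w, hw, hwη⟩ := exists_exp_div_sub_one_le (64 ^ L) (half_pos hη0)
  set W := primorial w with hW
  have hWpos : 0 < W := primorial_pos w
  have hW0 : (0 : ℝ) < W := by exact_mod_cast hWpos
  set K : ℝ := 4 / α * 4 ^ d with hK
  have hK0 : 0 < K := by positivity
  refine ⟨ε / (2 * K ^ 2 * (2 * W) ^ (d + 1)), by positivity, ?_⟩
  filter_upwards [eventually_ge_atTop 2, eventually_ge_atTop (2 * W), eventually_ge_atTop (W ^ 2),
    eventually_div_log_le_primeCount, eventually_mul_sqrt_le_primeCount (4 / α * d),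
    eventually_mul_sqrt_le (4 * W * n / η),
    eventually_mul_log_pow_le (2 * K ^ 2 * (2 * W) / ε) (2 * d)] with N hN2 hN2W hNW hπ hsqrt hNη hlog
  intro A hA hcard
  have hN2' : (2 : ℝ) ≤ N := by exact_mod_cast hN2
  have hl : 0 < Real.log N := Real.log_pos (by linarith)
  have hπ0 : (0 : ℝ) < primeCount N := lt_of_lt_of_le (by positivity) hπ
  have hWsqrt : W ≤ Nat.sqrt N := Nat.le_sqrt'.2 hNW
  set M := N / W with hM
  have hMW : W * M ≤ N := Nat.mul_div_le N W
  have hNM : N ≤ 2 * W * M := by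
    have h1 : N < W * M + W := by
      have := Nat.lt_mul_div_succ N hWpos
      rw [mul_add, mul_one] at this
      exact this
    have h2 : 2 ≤ M := (Nat.le_div_iff_mul_le hWpos).2 hN2W
    nlinarith
  have hM1 : 1 ≤ M := (Nat.le_div_iff_mul_le hWpos).2 (by omega)
  have hMW' : (W : ℝ) * M ≤ N := by exact_mod_cast hMW
  have hNM' : (N : ℝ) ≤ 2 * W * M := by exact_mod_cast hNM
  set R := Nat.nthRoot (2 * k) N with hR
  have h2k : 2 * k ≠ 0 := by omega
  have hR1 : 1 ≤ R := (Nat.le_nthRoot_iff h2k).2 (by rw [one_pow]; omega)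
  have hRk : R ^ k ≤ Nat.sqrt N := by
    rw [Nat.le_sqrt', ← pow_mul, mul_comm k 2]
    exact (Nat.le_nthRoot_iff h2k).1 le_rfl
  have hRsqrt : R ≤ Nat.sqrt N := (Nat.le_self_pow (by omega) R).trans hRk
  have hlogR : Real.log N ≤ 2 * k * Real.log (R + 1) := by
    have h1 : (N : ℝ) ≤ ((R : ℝ) + 1) ^ (2 * k) := by
      exact_mod_cast (Nat.lt_pow_nthRoot_add_one h2k N).le
    have h2 := Real.log_le_log (by linarith) h1
    rw [Real.log_pow] at h2
    exact_mod_cast h2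
  set T := largePoints A N with hT
  have hTprime : ∀ a ∈ T, ∀ j, ∃ p : ℕ, p.Prime ∧ p ≤ N ∧ Nat.sqrt N < p ∧ (p : ℤ) = a j :=
    fun a ha j => by
      obtain ⟨h1, -, h2⟩ := Finset.mem_filter.1 ha
      obtain ⟨p, ⟨h3, h4⟩, h5⟩ := mem_primeBox.1 h1 j
      refine ⟨p, h4, h3, ?_, h5⟩
      have := h2 j
      omega
  have hTcard : α / 4 * (primeCount N : ℝ) ^ d ≤ T.card := by
    have h1 : ((A ∩ {x | ∀ i, 1 ≤ x i ∧ x i ≤ (N : ℤ)}).ncard : ℝ) ≤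
        T.card + d * (Nat.sqrt N * (primeCount N : ℝ) ^ (d - 1)) := by
      exact_mod_cast ncard_le_card_largePoints_add hA N
    have h2 : (primeCount N : ℝ) ^ d = primeCount N * (primeCount N : ℝ) ^ (d - 1) := by
      rw [← pow_succ', Nat.sub_add_cancel hd]
    have h3 : d * Nat.sqrt N ≤ α / 4 * (primeCount N : ℝ) := by
      calc (d : ℝ) * Nat.sqrt N = α / 4 * (4 / α * d * Nat.sqrt N) := by field_simp
        _ ≤ _ := by gcongr
    have h4 : d * (Nat.sqrt N * (primeCount N : ℝ) ^ (d - 1)) ≤ α / 4 * (primeCount N : ℝ) ^ d := by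
      rw [h2, ← mul_assoc, ← mul_assoc]
      gcongr
    linarith
  obtain ⟨b, hb, hTS⟩ := exists_card_le_mul_card_residueClass T hWpos fun a ha j => by
    obtain ⟨p, h1, -, h2, h3⟩ := hTprime a ha j
    refine ⟨p, (Nat.coprime_comm.1 (h1.coprime_iff_not_dvd.2 fun h => ?_)), h3⟩
    have := Nat.le_of_dvd hWpos h
    omega
  set S := residueClass T W b with hS
  have hST : ∀ a ∈ S, (fun j => W * a j + b j) ∈ T := fun a ha => mem_of_mem_residueClass ha
  have hSM : ∀ a ∈ S, ∀ j, 1 ≤ a j ∧ a j ≤ M := fun a ha j => by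
    obtain ⟨p, h1, h2, h3, h4⟩ := hTprime _ (hST a ha) j
    have h5 := hb j
    have h6 : (W : ℤ) < W * a j + b j := by omega
    have h7 : (W : ℤ) * a j + b j ≤ N := by omega
    have hW' : (0 : ℤ) < W := by exact_mod_cast hWpos
    constructor
    · by_contra! h
      nlinarith
    · rw [hM, Int.natCast_div, Int.le_ediv_iff_mul_le hW']
      linarith
  have hP : ∀ p ∈ sievePrimes w R, 2 ≤ p := fun p hp => (mem_sievePrimes.1 hp).2.two_le
  set B := sieveMass (sievePrimes w R) R with hB
  have hB1 : 1 ≤ B := one_le_sieveMass hP hR1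
  have hB0 : 0 < B := by linarith
  have hφB : (Nat.totient W : ℝ) * Real.log (R + 1) ≤ W * B := totient_mul_log_le_sieveMass w R
  set s : Fin d → ℤ → ℝ := fun j m => sieve (sievePrimes w R) R (W * m + b j) with hs
  have hs0 : ∀ j m, 0 ≤ s j m := fun j m => sieve_nonneg hP hR1 _
  have hsB : ∀ a ∈ S, ∀ j, s j (a j) = B := fun a ha j => by
    obtain ⟨p, h1, h2, h3, h4⟩ := hTprime _ (hST a ha) j
    refine sieve_of_coprime hP hR1 fun q hq hqp => ?_
    obtain ⟨⟨-, h5⟩, h6⟩ := mem_sievePrimes.1 hq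
    rw [← h4, Int.natCast_dvd_natCast, Nat.prime_dvd_prime_iff_eq h6 h1] at hqp
    omega
  have herr : formsError L n w R M ≤ η := formsError_le hη0 hW0 hM1 hwη hRk hNM' hNη
  have hm : ∀ j, |∑ v, boxWeight d M (some j) v * s j v - 1| ≤ 1 / 2 := fun j =>
    (abs_sum_boxWeight_mul_sieve_sub_one_le hd hM1 hw hR1 j (b j)).trans
      (herr.trans (min_le_right _ _))
  have hφ : (0 : ℝ) < Nat.totient W := by exact_mod_cast Nat.totient_pos.2 hWpos
  have hcorners := hmain M s B S hM1 hB0 hs0 hSM hsB hm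
    (fun 𝒜 h𝒜 => (abs_wE_wE_prod_sieve_sub_one_le hd hM1 hw hR1 b h𝒜 fun j m => rfl).trans
      (herr.trans (min_le_left _ _)))
    (mul_pow_le_card_mul_pow hα hk0 hl hφ hW0 hB0.le (Nat.cast_nonneg _) (Nat.cast_nonneg _) hπ
      hφB hlogR hMW' hTcard hTS)
  have hBl := pow_le_mul_log_pow hα hl hφ (by exact_mod_cast Nat.totient_le W) hB0.le
    (Nat.cast_nonneg _) (by linarith) hπ hMW' hTcard hTS (card_mul_pow_le hM1 hd hs0 hSM hsB hm)
  have hbox : ((boxCorners d M S).card : ℝ) ≤ (cornerPairs d A N).ncard + (M : ℝ) ^ d := by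
    exact_mod_cast card_boxCorners_le hd hWpos hSM fun a ha => by
      refine ⟨(Finset.mem_filter.1 (hST a ha)).2.1, fun j => ?_⟩
      obtain ⟨p, h1, h2, -, h3⟩ := hTprime _ (hST a ha) j
      have := h1.one_le
      omega
  refine mul_pow_div_log_pow_le hε hK0 hW0 hl hB0.le (Nat.cast_nonneg M) (Nat.cast_nonneg _) hNM'
    (Nat.cast_nonneg _) hcorners hbox hBl ?_
  have h1 : 2 * W * (2 * K ^ 2 * Real.log N ^ (2 * d)) ≤ 2 * W * (ε * M) := by
    rw [div_mul_eq_mul_div, div_le_iff₀ hε] at hlog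
    calc 2 * W * (2 * K ^ 2 * Real.log N ^ (2 * d)) =
        2 * K ^ 2 * (2 * W) * Real.log N ^ (2 * d) := by ring
      _ ≤ N * ε := hlog
      _ ≤ (2 * W * M) * ε := by gcongr
      _ = _ := by ring
  exact le_of_mul_le_mul_left h1 (by positivity)

lemma frequently_half_mul_le_ncard {α : ℝ} (hα : 0 < α) {A : Set (Fin d → ℤ)}
    (hA : α ≤ relUpperDensity d A) : ∃ᶠ N : ℕ in atTop, α / 2 * (primeCount N : ℝ) ^ d ≤
      ((A ∩ {x | ∀ i, 1 ≤ x i ∧ x i ≤ (N : ℤ)}).ncard : ℝ) := by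
  have h1 : α / 2 < relUpperDensity d A := by linarith
  have h2 := frequently_lt_of_lt_limsup (by
    refine IsBoundedUnder.isCoboundedUnder_le ⟨0, ?_⟩
    exact eventually_map.2 (Eventually.of_forall fun N => by positivity)) h1
  refine h2.mono fun N hN => ?_
  rcases (show (0 : ℝ) ≤ (primeCount N : ℝ) ^ d by positivity).eq_or_lt with h3 | h3
  · rw [← h3, mul_zero]
    positivity
  · exact ((lt_div_iff₀ h3).1 hN).le

end Counting

end CornersInPrimes

/-- Quantitative count of corners in dense subsets of the `d`-tuples of primes. -/
theorem corners_count_in_dense_subsets_of_primes (d : ℕ) (hd : 1 ≤ d)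
    (α : ℝ) (hα : 0 < α) :
    ∃ C : ℝ, 0 < C ∧
    ∀ A : Set (Fin d → ℤ), (∀ x ∈ A, ∀ i, 0 < x i ∧ Prime (x i)) →
    α ≤ relUpperDensity d A →
    {N : ℕ | C * (N : ℝ) ^ (d + 1) / Real.log N ^ (2 * d) ≤
      ((cornerPairs d A N).ncard : ℝ)}.Infinite := by
  obtain ⟨C, hC, hev⟩ := CornersInPrimes.exists_mul_pow_le_ncard_cornerPairs hd hα
  refine ⟨C, hC, fun A hA hd => ?_⟩
  rw [← Nat.frequently_atTop_iff_infinite]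
  exact ((CornersInPrimes.frequently_half_mul_le_ncard hα hd).and_eventually hev).mono
    fun N hN => hN.2 A hA hN.1
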